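/- Let d be either a prime p with p ≡ 7 (mod 16), or d = pq for primes p ≡ 5 (mod 8) and q ≡ 3 (mod 8). Then Greenberg's conjecture holds for the fields L_{n,d}^+, i.e., there exists a constant B such that for every n ≥ 0 the order of the 2-Sylow subgroup of the ideal class group of L_{n,d}^+ is at most B. -/

import Mathlib

open IntermediateField NumberField

/-- The quadratic field `ℚ(√m)` realized inside `ℂ` (for `m` of either sign). -/
noncomputable def quadField (m : ℤ) : IntermediateField ℚ ℂ :=
  IntermediateField.adjoin ℚ {z : ℂ | z ^ 2 = (m : ℂ)}

/-- The 2-class group of a number field `K ⊆ ℂ`: the 2-primary component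
(= 2-Sylow subgroup) of the ideal class group of its ring of integers. -/
noncomputable def twoClassGroup (K : IntermediateField ℚ ℂ) :
    Subgroup (ClassGroup (𝓞 K)) :=
  CommGroup.primaryComponent _ 2

/-- `h₂(m)`: the 2-class number of the quadratic field `ℚ(√m)`. -/
noncomputable def h2 (m : ℤ) : ℕ := Nat.card (twoClassGroup (quadField m))

/-- `L_{n,d} = ℚ(ζ_{2^{n+2}}, √d)`, the `n`-th layer of the cyclotomic
`ℤ₂`-extension of `ℚ(√d, √-1)`. -/
noncomputable def Lfield (n : ℕ) (d : ℤ) : IntermediateField ℚ ℂ :=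
  IntermediateField.adjoin ℚ
    ({z : ℂ | z ^ 2 ^ (n + 2) = 1} ∪ {z : ℂ | z ^ 2 = (d : ℂ)})

/-- `ℚ(ζ_{2^{n+2}} + ζ_{2^{n+2}}⁻¹, √d) = ℚ(2cos(2π/2^{n+2}), √d)`.
For `d > 0` this is the maximal real subfield `L_{n,d}⁺` of `L_{n,d}`;
for `d < 0` it is the `n`-th layer `K_{n,|d|}` of the cyclotomic
`ℤ₂`-extension of the imaginary quadratic field `ℚ(√d)`. -/
noncomputable def LplusField (n : ℕ) (d : ℤ) : IntermediateField ℚ ℂ :=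
  IntermediateField.adjoin ℚ
    ({((2 * Real.cos (2 * Real.pi / 2 ^ (n + 2)) : ℝ) : ℂ)} ∪ {z : ℂ | z ^ 2 = (d : ℂ)})

open IntermediateField NumberField
namespace GB
set_option linter.unusedSectionVars false
open scoped nonZeroDivisors
section Inv
variable {A B : Type*} [CommRing A] [CommRing B] [IsDedekindDomain B] [Algebra A B]
  (s : B →+* B)

/-- data of an involution with fixed ring A -/
structure Invol (A : Type*) {B : Type*} [CommRing A] [CommRing B] [Algebra A B] (s : B →+* B) : Prop where
  inv : ∀ x, s (s x) = x
  alg : ∀ a : A, s (algebraMap A B a) = algebraMap A B a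
  fix : ∀ x, s x = x → ∃ a : A, algebraMap A B a = x
  inj : Function.Injective (algebraMap A B)
  nontriv : ∃ x, s x ≠ x

variable {s}

lemma Invol.mem_map (h : Invol A s) (I : Ideal B) (x : B) : x ∈ I.map s ↔ s x ∈ I := by
  have hs : Function.Surjective s := fun x => ⟨s x, h.inv x⟩
  constructor
  · intro hx
    obtain ⟨y, hy, rfl⟩ := (Ideal.mem_map_iff_of_surjective s hs).1 hx
    rwa [h.inv]
  · intro hx
    rw [← h.inv x]
    exact Ideal.mem_map_of_mem s hx

lemma Invol.map_map (h : Invol A s) (I : Ideal B) : (I.map s).map s = I := by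
  ext x; rw [h.mem_map, h.mem_map, h.inv]

lemma Invol.map_inj (h : Invol A s) {I J : Ideal B} (hh : I.map s = J.map s) : I = J := by
  rw [← h.map_map I, hh, h.map_map]

lemma Invol.map_prime (h : Invol A s) (I : Ideal B) (hI : I.IsPrime) : (I.map s).IsPrime := by
  have : I.map s = I.comap s := by ext x; rw [h.mem_map]; rfl
  rw [this]; exact Ideal.comap_isPrime s I

lemma Invol.map_ne (h : Invol A s) {I : Ideal B} (hI : I ≠ ⊥) : I.map s ≠ ⊥ := by
  intro h0
  apply hI
  rw [← h.map_map I, h0, Ideal.map_bot]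

lemma Invol.s_inj (h : Invol A s) : Function.Injective s := by
  intro x y hxy
  rw [← h.inv x, hxy, h.inv]

/-- two primes over the same prime are conjugate -/
lemma Invol.conj (h : Invol A s) {P Q : Ideal B} (hP : P.IsPrime) (hQ : Q.IsPrime) (hP0 : P ≠ ⊥)
    (hle : P.comap (algebraMap A B) ≤ Q.comap (algebraMap A B)) : Q = P ∨ Q = P.map s := by
  have key : (P : Set B) ⊆ (Q : Set B) ∪ (Q.map s : Ideal B) := by
    intro z hz
    obtain ⟨a, ha⟩ := h.fix (z * s z) (by rw [map_mul, h.inv, mul_comm])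
    have h1 : a ∈ P.comap (algebraMap A B) := by
      rw [Ideal.mem_comap, ha]; exact P.mul_mem_right _ hz
    have h2 := hle h1
    rw [Ideal.mem_comap, ha] at h2
    rcases hQ.mem_or_mem h2 with h3 | h3
    · exact Or.inl h3
    · exact Or.inr ((h.mem_map _ _).2 h3)
  have hPm : P.IsMaximal := hP.isMaximal hP0
  rcases Ideal.subset_union.1 key with h1 | h1
  · left; exact (hPm.eq_of_le hQ.ne_top h1).symm
  · right
    have := hPm.eq_of_le (h.map_prime Q hQ).ne_top h1
    rw [this, h.map_map]

/-- ramified primes -/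
def Ram (s : B →+* B) : Set (Ideal B) := {P | P.IsPrime ∧ P ≠ ⊥ ∧ ∀ x, x - s x ∈ P}

lemma Invol.ram_map (h : Invol A s) {P : Ideal B} (hP : P ∈ Ram s) : P.map s = P := by
  ext x
  rw [h.mem_map]
  constructor
  · intro hx
    have := P.add_mem (hP.2.2 x) hx
    simpa using this
  · intro hx
    have := P.sub_mem hx (hP.2.2 x)
    simpa using this

lemma Invol.trace (h : Invol A s) {P : Ideal B} {y : B} (hy : y + s y ∈ P) :
    y + s y ∈ (P.comap (algebraMap A B)).map (algebraMap A B) := by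
  obtain ⟨a, ha⟩ := h.fix (y + s y) (by rw [map_add, h.inv, add_comm])
  rw [← ha] at hy ⊢
  exact Ideal.mem_map_of_mem _ hy

/-- Dividing -/
lemma Invol.unram_aux (h : Invol A s) {P I : Ideal B} (hP : P.IsPrime) (hP0 : P ≠ ⊥)
    (hI : I ≤ P) (hI' : I ≤ P.map s) (hI0 : I ≠ ⊥) {x : B} (hx : x - s x ∉ P)
    (hPI : (P.comap (algebraMap A B)).map (algebraMap A B) ≤ I) :
    (P.comap (algebraMap A B)).map (algebraMap A B) = I := by
  have h1 : Ideal.span {x - s x} * I ≤ (P.comap (algebraMap A B)).map (algebraMap A B) := by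
    rw [Ideal.span_singleton_mul_le_iff]
    intro y hy
    have e : (x - s x) * y = (x * y + s (x * y)) - s x * (y + s y) := by
      rw [map_mul]; ring
    rw [e]
    have hy1 : y ∈ P := hI hy
    have hy2 : s y ∈ P := (h.mem_map _ _).1 (hI' hy)
    refine Ideal.sub_mem _ (h.trace (P.add_mem (P.mul_mem_left _ hy1) ?_)) (Ideal.mul_mem_left _ _ (h.trace (P.add_mem hy1 hy2)))
    rw [map_mul]; exact P.mul_mem_left _ hy2
  obtain ⟨J, hJ⟩ := Ideal.dvd_iff_le.2 hPI
  have hJ1 : J = 1 := by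
    by_contra hne
    obtain ⟨Q, hQ, hJQ⟩ := Ideal.exists_le_maximal J (by rwa [Ideal.one_eq_top] at hne)
    have h2 : Ideal.span {x - s x} ≤ J := by
      rw [← Ideal.dvd_iff_le]
      have := Ideal.dvd_iff_le.2 h1
      rw [hJ, mul_comm] at this
      exact (mul_dvd_mul_iff_right hI0).1 this
    have h3 : x - s x ∈ Q := hJQ (h2 (Ideal.mem_span_singleton_self _))
    have h4 : P.comap (algebraMap A B) ≤ Q.comap (algebraMap A B) := by
      rw [← Ideal.map_le_iff_le_comap, hJ]
      exact Ideal.mul_le_right.trans hJQ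
    rcases h.conj hP hQ.isPrime hP0 h4 with rfl | rfl
    · exact hx h3
    · rw [h.mem_map, map_sub, h.inv, ← neg_sub, neg_mem_iff] at h3
      exact hx h3
  rw [hJ, hJ1, mul_one]

lemma Invol.inert (h : Invol A s) {P : Ideal B} (hP : P.IsPrime) (hP0 : P ≠ ⊥) (hs : P.map s = P)
    (hR : P ∉ Ram s) : ∃ J : Ideal A, J.map (algebraMap A B) = P := by
  have : ∃ x, x - s x ∉ P := by
    by_contra hc
    push Not at hc
    exact hR ⟨hP, hP0, hc⟩
  obtain ⟨x, hx⟩ := this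
  exact ⟨_, h.unram_aux hP hP0 le_rfl hs.ge hP0 hx Ideal.map_comap_le⟩

lemma Invol.split (h : Invol A s) {P : Ideal B} (hP : P.IsPrime) (hP0 : P ≠ ⊥) (hs : P.map s ≠ P) :
    ∃ J : Ideal A, J.map (algebraMap A B) = P * P.map s := by
  have : ∃ x, x - s x ∉ P := by
    by_contra hc
    push Not at hc
    exact hs (h.ram_map ⟨hP, hP0, hc⟩)
  obtain ⟨x, hx⟩ := this
  have hm := h.map_ne hP0
  refine ⟨_, h.unram_aux hP hP0 Ideal.mul_le_left Ideal.mul_le_right (mul_ne_zero hP0 hm) hx ?_⟩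
  have hPm : P.IsMaximal := hP.isMaximal hP0
  have hPm' : (P.map s).IsMaximal := (h.map_prime P hP).isMaximal hm
  have hco : IsCoprime P (P.map s) := by
    rw [Ideal.isCoprime_iff_sup_eq]
    exact Ideal.IsMaximal.coprime_of_ne hPm hPm' hs.symm
  rw [Ideal.mul_eq_inf_of_coprime (Ideal.isCoprime_iff_sup_eq.1 hco)]
  refine le_inf Ideal.map_comap_le ?_
  rw [Ideal.map_le_iff_le_comap]
  intro a ha
  rw [Ideal.mem_comap, h.mem_map, h.alg]
  exact ha

lemma Invol.ram_sq (h : Invol A s) {P : Ideal B} (hP : P ∈ Ram s) :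
    ∃ J : Ideal A, J.map (algebraMap A B) = P * P := by
  classical
  obtain ⟨hPp, hP0, hR⟩ := hP
  set P0 := P.comap (algebraMap A B) with hP0def
  -- pick y in P not in P^2
  have hlt : P ^ 2 < P := by
    refine lt_of_le_of_ne (Ideal.pow_le_self two_ne_zero) ?_
    intro he
    have : P * P = P * 1 := by rw [mul_one, ← pow_two, he]
    have := mul_left_cancel₀ hP0 this
    exact hPp.ne_top (by rw [this, Ideal.one_eq_top])
  obtain ⟨y, hy, hy2⟩ := SetLike.exists_of_lt hlt
  have hsP := h.ram_map ⟨hPp, hP0, hR⟩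
  have hP2m : (P ^ 2).map s = P ^ 2 := by rw [Ideal.map_pow, hsP]
  have hsy : s y ∈ P := by rwa [← h.mem_map, hsP]
  have hsy2 : s y ∉ P ^ 2 := by rwa [← h.mem_map, hP2m]
  have hpr : Prime P := Ideal.prime_of_isPrime hP0 hPp
  -- span y = P * Y
  obtain ⟨Y, hY⟩ := Ideal.dvd_iff_le.2 ((Ideal.span_singleton_le_iff_mem _).2 hy)
  obtain ⟨Z, hZ⟩ := Ideal.dvd_iff_le.2 ((Ideal.span_singleton_le_iff_mem _).2 hsy)
  have hYn : ¬ P ∣ Y := by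
    rintro ⟨W, rfl⟩
    apply hy2
    rw [← Ideal.span_singleton_le_iff_mem, hY, ← mul_assoc, pow_two]
    exact Ideal.mul_le_left
  have hZn : ¬ P ∣ Z := by
    rintro ⟨W, rfl⟩
    apply hsy2
    rw [← Ideal.span_singleton_le_iff_mem, hZ, ← mul_assoc, pow_two]
    exact Ideal.mul_le_left
  obtain ⟨a, ha⟩ := h.fix (y * s y) (by rw [map_mul, h.inv, mul_comm])
  have ha0 : a ∈ P0 := by
    rw [hP0def, Ideal.mem_comap, ha]; exact P.mul_mem_right _ hy
  obtain ⟨J, hJ⟩ := Ideal.dvd_iff_le.2 (Ideal.map_comap_le : P0.map (algebraMap A B) ≤ P)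
  have hd : P0.map (algebraMap A B) ∣ P * P * (Y * Z) := by
    rw [Ideal.dvd_iff_le]
    have : P * P * (Y * Z) = Ideal.span {y * s y} := by
      rw [← Ideal.span_singleton_mul_span_singleton, hY, hZ]; ring
    rw [this, Ideal.span_singleton_le_iff_mem, ← ha]
    exact Ideal.mem_map_of_mem _ ha0
  rw [hJ, mul_assoc] at hd
  have hd2 : J ∣ P * (Y * Z) := (mul_dvd_mul_iff_left hP0).1 hd
  -- J is only divisible by P
  have hJonly : ∀ Q : Ideal B, Q.IsPrime → J ≤ Q → Q = P := by
    intro Q hQ hJQ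
    have h4 : P.comap (algebraMap A B) ≤ Q.comap (algebraMap A B) := by
      rw [← Ideal.map_le_iff_le_comap, hJ]
      exact Ideal.mul_le_right.trans hJQ
    rcases h.conj hPp hQ hP0 h4 with h5 | h5
    · exact h5
    · rw [h5, hsP]
  by_cases hPJ : P ∣ J
  · obtain ⟨J2, rfl⟩ := hPJ
    have hd3 : J2 ∣ Y * Z := (mul_dvd_mul_iff_left hP0).1 hd2
    have : J2 = 1 := by
      by_contra hne
      obtain ⟨Q, hQ, hJQ⟩ := Ideal.exists_le_maximal J2 (by rwa [Ideal.one_eq_top] at hne)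
      have := hJonly Q hQ.isPrime (Ideal.mul_le_right.trans hJQ)
      subst this
      have hQd : Q ∣ J2 := Ideal.dvd_iff_le.2 hJQ
      rcases hpr.dvd_or_dvd (hQd.trans hd3) with h6 | h6
      · exact hYn h6
      · exact hZn h6
    exact ⟨P0, by rw [hJ, this, mul_one]⟩
  · have : J = 1 := by
      by_contra hne
      obtain ⟨Q, hQ, hJQ⟩ := Ideal.exists_le_maximal J (by rwa [Ideal.one_eq_top] at hne)
      have := hJonly Q hQ.isPrime hJQ
      subst this
      exact hPJ (Ideal.dvd_iff_le.2 hJQ)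
    exact ⟨P0 * P0, by rw [Ideal.map_mul, hJ, this, mul_one]⟩

open UniqueFactorizationMonoid in
/-- parity -/
noncomputable def par (P J : Ideal B) : ℕ := by
  classical exact Multiset.count P (normalizedFactors J)

open UniqueFactorizationMonoid in
lemma par_mul (P : Ideal B) {I J : Ideal B} (hI : I ≠ ⊥) (hJ : J ≠ ⊥) :
    par P (I * J) = par P I + par P J := by
  classical
  unfold par
  rw [normalizedFactors_mul hI hJ, Multiset.count_add]

open UniqueFactorizationMonoid in
lemma par_prime {P Q : Ideal B} (hQ : Q.IsPrime) (hQ0 : Q ≠ ⊥) (hne : P ≠ Q) : par P Q = 0 := by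
  classical
  unfold par
  rw [normalizedFactors_irreducible (Ideal.prime_of_isPrime hQ0 hQ).irreducible, normalize_eq, Multiset.count_singleton, if_neg hne]

open UniqueFactorizationMonoid in
lemma par_self {Q : Ideal B} (hQ : Q.IsPrime) (hQ0 : Q ≠ ⊥) : par Q Q = 1 := by
  classical
  unfold par
  rw [normalizedFactors_irreducible (Ideal.prime_of_isPrime hQ0 hQ).irreducible, normalize_eq, Multiset.count_singleton, if_pos rfl]

lemma par_one (Q : Ideal B) : par Q 1 = 0 := by
  classical
  unfold par
  rw [UniqueFactorizationMonoid.normalizedFactors_one, Multiset.count_zero]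

open UniqueFactorizationMonoid in
lemma dvd_of_par {P J : Ideal B} (h : par P J ≠ 0) : P ∣ J := by
  classical
  unfold par at h
  exact dvd_of_mem_normalizedFactors (Multiset.count_ne_zero.1 h)

lemma Invol.extended (h : Invol A s) (J : Ideal B) (hJ0 : J ≠ ⊥) (hJ : J.map s = J)
    (hpar : ∀ P ∈ Ram s, Even (par P J)) : ∃ J0 : Ideal A, J0.map (algebraMap A B) = J := by
  induction J using (wellFounded_dvdNotUnit (α := Ideal B)).induction with
  | _ J ih =>
  by_cases h1 : J = 1
  · exact ⟨1, by rw [h1, Ideal.one_eq_top, Ideal.one_eq_top, Ideal.map_top]⟩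
  obtain ⟨P, hPm, hPJ⟩ := Ideal.exists_le_maximal J (by rwa [Ideal.one_eq_top] at h1)
  have hPp := hPm.isPrime
  have hPd : P ∣ J := Ideal.dvd_iff_le.2 hPJ
  have hP0 : P ≠ ⊥ := by
    rintro rfl
    exact hJ0 (le_bot_iff.1 hPJ)
  have hPu : ¬ IsUnit P := (Ideal.prime_of_isPrime hP0 hPp).not_unit
  -- common step
  have step : ∀ M : Ideal B, M ∣ J → ¬ IsUnit M → M.map s = M →
      (∀ Q ∈ Ram s, Even (par Q M)) → (∃ J0 : Ideal A, J0.map (algebraMap A B) = M) →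
      ∃ J0 : Ideal A, J0.map (algebraMap A B) = J := by
    rintro M ⟨J', rfl⟩ hMu hMs hMp ⟨M0, hM0⟩
    have hM : M ≠ ⊥ := by rintro rfl; exact hJ0 (by simp)
    have hJ' : J' ≠ ⊥ := by rintro rfl; exact hJ0 (by simp)
    have hJ's : J'.map s = J' := by
      rw [Ideal.map_mul, hMs] at hJ
      exact mul_left_cancel₀ hM hJ
    obtain ⟨J0, hJ0'⟩ := ih J' ⟨hJ', M, hMu, mul_comm _ _⟩ hJ' hJ's (by
      intro Q hQ
      have := hpar Q hQ
      rw [par_mul Q hM hJ', Nat.even_add] at this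
      exact this.1 (hMp Q hQ))
    exact ⟨M0 * J0, by rw [Ideal.map_mul, hM0, hJ0']⟩
  by_cases hR : P ∈ Ram s
  · have hsP := h.ram_map hR
    refine step (P * P) ?_ (fun hu => hPu (isUnit_of_mul_isUnit_left hu)) (by rw [Ideal.map_mul, hsP]) ?_ (h.ram_sq hR)
    · obtain ⟨J', rfl⟩ := hPd
      have hJ' : J' ≠ ⊥ := by rintro rfl; exact hJ0 (by simp)
      refine mul_dvd_mul_left _ (dvd_of_par ?_)
      have := hpar P hR
      rw [par_mul P hP0 hJ', par_self hPp hP0] at this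
      intro h0
      rw [h0] at this
      exact absurd this (by decide)
    · intro Q _
      rw [par_mul Q hP0 hP0]
      exact ⟨_, rfl⟩
  by_cases hsP : P.map s = P
  · refine step P hPd hPu hsP ?_ (h.inert hPp hP0 hsP hR)
    intro Q hQ
    rw [par_prime hPp hP0 (by rintro rfl; exact hR hQ)]
    exact Even.zero
  · refine step (P * P.map s) ?_ (fun hu => hPu (isUnit_of_mul_isUnit_left hu)) (by rw [Ideal.map_mul, h.map_map, mul_comm]) ?_ (h.split hPp hP0 hsP)
    · have h2 : P.map s ∣ J := by
        rw [← hJ, Ideal.dvd_iff_le]; exact Ideal.map_mono hPJ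
      obtain ⟨J', rfl⟩ := hPd
      refine mul_dvd_mul_left _ ?_
      have hpr := Ideal.prime_of_isPrime (h.map_ne hP0) (h.map_prime P hPp)
      refine (hpr.dvd_or_dvd h2).resolve_left ?_
      intro h3
      rw [Ideal.dvd_iff_le] at h3
      exact hsP (hPm.eq_of_le (h.map_prime P hPp).ne_top h3).symm
    · intro Q hQ
      have hm := h.map_ne hP0
      rw [par_mul Q hP0 hm, par_prime hPp hP0 (by rintro rfl; exact hR hQ),
        par_prime (h.map_prime P hPp) hm ?_]
      · exact Even.zero
      · rintro rfl
        have := h.ram_map hQ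
        rw [h.map_map] at this
        exact hsP this.symm

lemma Invol.par_map (h : Invol A s) {P : Ideal B} (hP : P ∈ Ram s) {J : Ideal B} (hJ : J ≠ ⊥) :
    par P (J.map s) = par P J := by
  have key : ∀ n : ℕ, ∀ J : Ideal B, P ^ n ∣ J → P ^ n ∣ J.map s := by
    rintro n J ⟨W, rfl⟩
    exact ⟨W.map s, by rw [Ideal.map_mul, Ideal.map_pow, h.ram_map hP]⟩
  have key2 : ∀ J : Ideal B, J ≠ ⊥ → ∀ n : ℕ, P ^ n ∣ J ↔ n ≤ par P J := by
    classical
    intro J hJ n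
    unfold par
    have hpr := Ideal.prime_of_isPrime hP.2.1 hP.1
    rw [Multiset.le_count_iff_replicate_le]
    have := UniqueFactorizationMonoid.dvd_iff_normalizedFactors_le_normalizedFactors (pow_ne_zero n hP.2.1) hJ
    rw [this, UniqueFactorizationMonoid.normalizedFactors_pow, UniqueFactorizationMonoid.normalizedFactors_irreducible hpr.irreducible, normalize_eq, Multiset.nsmul_singleton]
  have hm := h.map_ne hJ
  apply le_antisymm
  · rw [← key2 J hJ]
    have := key _ _ ((key2 _ hm _).2 le_rfl)
    rwa [h.map_map] at this
  · rw [← key2 _ hm]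
    exact key _ _ ((key2 _ hJ _).2 le_rfl)

lemma Invol.norm_ext (h : Invol A s) (J : Ideal B) (hJ0 : J ≠ ⊥) :
    ∃ J0 : Ideal A, J0.map (algebraMap A B) = J * J.map s := by
  refine h.extended _ (mul_ne_zero hJ0 (h.map_ne hJ0)) (by rw [Ideal.map_mul, h.map_map, mul_comm]) ?_
  intro P hP
  rw [par_mul P hJ0 (h.map_ne hJ0), h.par_map hP hJ0]
  exact ⟨_, rfl⟩

/-- Hilbert 90 -/
lemma Invol.h90 (h : Invol A s) {x y : B} (hy : y ≠ 0) (hxy : x * s x = y * s y) :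
    ∃ z, z ≠ 0 ∧ s z * x = z * y := by
  have key : ∀ w, s (s y * (y * w + x * s w)) * x = (s y * (y * w + x * s w)) * y := by
    intro w
    simp only [map_mul, map_add, h.inv]
    linear_combination (y * w) * hxy
  have hsy : s y ≠ 0 := by
    intro h0
    exact hy (h.s_inj (by rw [h0, map_zero]))
  by_cases h1 : y + x = 0
  · obtain ⟨w, hw⟩ := h.nontriv
    refine ⟨_, mul_ne_zero hsy ?_, key w⟩
    have : x = -y := by linear_combination h1
    rw [this]
    have e : y * w + -y * s w = y * (w - s w) := by ring
    rw [e]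
    exact mul_ne_zero hy (sub_ne_zero.2 (Ne.symm hw))
  · exact ⟨_, mul_ne_zero hsy (by simpa using h1), key 1⟩

end Inv
end GB

open IntermediateField NumberField
namespace GB
set_option linter.unusedSectionVars false
lemma rank_nullity {V W : Type*} [AddCommGroup V] [Module.Finite ℤ V] [AddCommGroup W] (g : V →ₗ[ℤ] W) :
    Module.finrank ℤ (LinearMap.range g) + Module.finrank ℤ (LinearMap.ker g) = Module.finrank ℤ V := by
  rw [← Submodule.finrank_quotient_add_finrank (LinearMap.ker g), g.quotKerEquivRange.finrank_eq]
section UnitIndex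
variable {V : Type*} [AddCommGroup V] [Module.Finite ℤ V]

/-- doubling -/
def dbl (V : Type*) [AddCommGroup V] : V →+ V := nsmulAddMonoidHom 2

lemma dbl_apply (x : V) : dbl V x = x + x := by
  simp [dbl, two_nsmul]

lemma two_index (e : V) (he : e ≠ 0) (he2 : e + e = 0)
    (ht : ∀ (x : V) (n : ℤ), n ≠ 0 → n • x = 0 → x = 0 ∨ x = e) :
    (dbl V).range.index = 2 ^ (Module.finrank ℤ V + 1) := by
  classical
  let T := Submodule.torsion ℤ V
  have hT : ∀ x, x ∈ T ↔ x = 0 ∨ x = e := by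
    intro x
    constructor
    · intro hx
      obtain ⟨n, hn⟩ := (Submodule.mem_torsion_iff x).1 hx
      exact ht x n (nonZeroDivisors.ne_zero n.2) hn
    · rintro (rfl | rfl)
      · exact T.zero_mem
      · refine (Submodule.mem_torsion_iff x).2 ⟨⟨2, mem_nonZeroDivisors_of_ne_zero two_ne_zero⟩, ?_⟩
        change (2 : ℤ) • x = 0
        rw [two_smul, he2]
  let F := V ⧸ T
  have : Module.Free ℤ F := inferInstance
  let b := Module.Free.chooseBasis ℤ F
  let I := Module.Free.ChooseBasisIndex ℤ F
  let φ : V →+ (I → ZMod 2) :=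
    { toFun := fun x i => ((b.repr (T.mkQ x) i : ℤ) : ZMod 2)
      map_zero' := by ext; simp
      map_add' := by intro x y; ext; simp }
  have hφ : Function.Surjective φ := by
    intro g
    obtain ⟨x, hx⟩ := T.mkQ_surjective (b.equivFun.symm (fun i => ((g i).val : ℤ)))
    refine ⟨x, ?_⟩
    ext i
    change ((b.repr (T.mkQ x) i : ℤ) : ZMod 2) = g i
    rw [hx, ← Module.Basis.equivFun_apply, LinearEquiv.apply_symm_apply]
    simp
  have hker : φ.ker = (dbl V).range ⊔ AddSubgroup.zmultiples e := by
    ext x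
    rw [AddMonoidHom.mem_ker, AddSubgroup.mem_sup]
    constructor
    · intro hx
      have h1 : ∀ i, ∃ m : ℤ, b.repr (T.mkQ x) i = 2 * m := by
        intro i
        have := congrFun hx i
        change ((b.repr (T.mkQ x) i : ℤ) : ZMod 2) = 0 at this
        rw [ZMod.intCast_zmod_eq_zero_iff_dvd] at this
        exact this
      choose m hm using h1
      obtain ⟨y, hy⟩ := T.mkQ_surjective (b.equivFun.symm m)
      have h2 : T.mkQ x = T.mkQ (y + y) := by
        apply b.equivFun.injective
        ext i
        rw [map_add, hy, map_add, LinearEquiv.apply_symm_apply]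
        change b.repr (T.mkQ x) i = m i + m i
        rw [hm i]; ring
      rw [← sub_eq_zero, ← map_sub, ← LinearMap.mem_ker, Submodule.ker_mkQ, hT] at h2
      refine ⟨y + y, ⟨y, dbl_apply y⟩, x - (y + y), ?_, by abel⟩
      rcases h2 with h2 | h2
      · rw [h2]; exact zero_mem _
      · rw [h2]; exact AddSubgroup.mem_zmultiples e
    · rintro ⟨_, ⟨y, rfl⟩, _, ⟨n, rfl⟩, rfl⟩
      have h1 : φ e = 0 := by
        ext i
        change ((b.repr (T.mkQ e) i : ℤ) : ZMod 2) = 0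
        have : T.mkQ e = 0 := by
          rw [← LinearMap.mem_ker, Submodule.ker_mkQ]
          exact (hT e).2 (Or.inr rfl)
        rw [this]; simp
      rw [map_add, dbl_apply, map_add]
      simp only [map_zsmul, h1, smul_zero, add_zero]
      ext i
      exact CharTwo.add_self_eq_zero _
  have hidx : φ.ker.index = 2 ^ Module.finrank ℤ V := by
    rw [AddSubgroup.index_ker, AddMonoidHom.range_eq_top.2 hφ, Nat.card_congr AddSubgroup.topEquiv.toEquiv]
    rw [Nat.card_fun, Nat.card_zmod, Nat.card_eq_fintype_card]
    congr 1
    rw [← Module.finrank_eq_card_chooseBasisIndex ℤ F]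
    have h1 := T.finrank_quotient_add_finrank
    have h2 : Module.finrank ℤ T = 0 := by
      rw [Module.finrank_eq_zero_iff]
      intro x
      obtain ⟨n, hn⟩ := (Submodule.mem_torsion_iff x.1).1 x.2
      exact ⟨n, nonZeroDivisors.ne_zero n.2, Subtype.ext hn⟩
    rw [h2, add_zero] at h1
    exact h1
  have hle : (dbl V).range ≤ φ.ker := by rw [hker]; exact le_sup_left
  rw [← AddSubgroup.relIndex_mul_index hle, hidx, hker]
  have h3 : (dbl V).range.relIndex ((dbl V).range ⊔ AddSubgroup.zmultiples e) = 2 := by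
    rw [sup_comm, AddSubgroup.relIndex_sup_right, ← AddSubgroup.inf_relIndex_right]
    have hm : ∀ x ∈ AddSubgroup.zmultiples e, x = 0 ∨ x = e := by
      rintro _ ⟨n, rfl⟩
      apply ht _ 2 two_ne_zero
      simp only [smul_smul, mul_comm 2 n]
      rw [← smul_smul, two_smul, he2, smul_zero]
    have : (dbl V).range ⊓ AddSubgroup.zmultiples e = ⊥ := by
      rw [eq_bot_iff]
      rintro x ⟨⟨y, rfl⟩, hx⟩
      rw [AddSubgroup.mem_bot]
      rcases hm _ hx with h | h
      · exact h
      · rw [dbl_apply] at h ⊢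
        have h5 : y = 0 ∨ y = e := by
          apply ht y 4 (by norm_num)
          have : (4 : ℤ) • y = (y + y) + (y + y) := by
            rw [← two_smul ℤ y, ← two_smul ℤ, smul_smul]; norm_num
          rw [this, h, he2]
        rcases h5 with rfl | rfl
        · simp
        · exact he2
    rw [this, AddSubgroup.relIndex_bot_left, Nat.card_zmultiples]
    refine addOrderOf_eq_prime ?_ he
    rw [two_nsmul, he2]
  rw [h3]; ring

lemma two_index_sub (H : AddSubgroup V) (e : V) (heH : e ∈ H) (he : e ≠ 0) (he2 : e + e = 0)
    (ht : ∀ (x : V) (n : ℤ), n ≠ 0 → n • x = 0 → x = 0 ∨ x = e) :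
    (H.map (dbl V)).relIndex H = 2 ^ (Module.finrank ℤ H + 1) := by
  have : Module.Finite ℤ H := by
    have : Module.Finite ℤ (AddSubgroup.toIntSubmodule H) := inferInstance
    exact this
  rw [← two_index (⟨e, heH⟩ : H) (by simpa [Subtype.ext_iff] using he) (Subtype.ext he2) ?_]
  · unfold AddSubgroup.relIndex
    congr 1
    ext x
    rw [AddSubgroup.mem_addSubgroupOf]
    constructor
    · rintro ⟨y, hy, h⟩
      exact ⟨⟨y, hy⟩, Subtype.ext (by rw [← h, dbl_apply, dbl_apply]; rfl)⟩
    · rintro ⟨y, h⟩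
      exact ⟨y.1, y.2, by rw [← h, dbl_apply, dbl_apply]; rfl⟩
  · intro x n hn h
    rcases ht x.1 n hn (by simpa [Subtype.ext_iff] using h) with h | h
    · exact Or.inl (Subtype.ext h)
    · exact Or.inr (Subtype.ext h)

lemma rank_sq (H R : AddSubgroup V) (h1 : H.map (dbl V) ≤ R) (h2 : R ≤ H) :
    Module.finrank ℤ R = Module.finrank ℤ H := by
  have hfR : Module.Finite ℤ R := by
    have : Module.Finite ℤ (AddSubgroup.toIntSubmodule R) := inferInstance
    exact this
  have hfH : Module.Finite ℤ H := by
    have : Module.Finite ℤ (AddSubgroup.toIntSubmodule H) := inferInstance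
    exact this
  apply le_antisymm
  · exact Submodule.finrank_mono (s := AddSubgroup.toIntSubmodule R) (t := AddSubgroup.toIntSubmodule H) h2
  · let g : H →+ R :=
      { toFun := fun x => ⟨x.1 + x.1, h1 ⟨x.1, x.2, dbl_apply x.1⟩⟩
        map_zero' := Subtype.ext (by simp)
        map_add' := fun x y => Subtype.ext (by simp; abel) }
    have h3 := rank_nullity g.toIntLinearMap
    have h4 : Module.finrank ℤ (LinearMap.ker g.toIntLinearMap) = 0 := by
      rw [Module.finrank_eq_zero_iff]
      intro x
      refine ⟨2, two_ne_zero, Subtype.ext (Subtype.ext ?_)⟩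
      have hx := congrArg Subtype.val (LinearMap.mem_ker.1 x.2)
      change x.1.1 + x.1.1 = 0 at hx
      rw [two_smul]
      exact hx
    have h5 := Submodule.finrank_le (LinearMap.range g.toIntLinearMap)
    omega

/-- The unit index computation. -/
lemma unit_index (τ : V →+ V) (hτ : ∀ x, τ (τ x) = x) (e : V) (heτ : τ e = e) (he : e ≠ 0)
    (he2 : e + e = 0) (ht : ∀ (x : V) (n : ℤ), n ≠ 0 → n • x = 0 → x = 0 ∨ x = e)
    (hr : Module.finrank ℤ V = 2 * Module.finrank ℤ (τ - AddMonoidHom.id V).ker + 1) :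
    (τ - AddMonoidHom.id V).range.relIndex (τ + AddMonoidHom.id V).ker =
      2 * (τ + AddMonoidHom.id V).range.relIndex (τ - AddMonoidHom.id V).ker ∧
    (τ + AddMonoidHom.id V).range.relIndex (τ - AddMonoidHom.id V).ker ≠ 0 := by
  set D := τ - AddMonoidHom.id V with hD
  set N := τ + AddMonoidHom.id V with hN
  have hDa : ∀ x, D x = τ x - x := fun x => rfl
  have hNa : ∀ x, N x = τ x + x := fun x => rfl
  have mD : ∀ x, x ∈ D.ker ↔ τ x = x := fun x => by
    rw [AddMonoidHom.mem_ker, hDa, sub_eq_zero]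
  have mN : ∀ x, x ∈ N.ker ↔ τ x = -x := fun x => by
    rw [AddMonoidHom.mem_ker, hNa, add_eq_zero_iff_eq_neg]
  have n1 : N.range ≤ D.ker := by
    rintro _ ⟨x, rfl⟩
    rw [mD, hNa, map_add, hτ, add_comm]
  have n2 : D.ker.map (dbl V) ≤ N.range := by
    rintro _ ⟨x, hx, rfl⟩
    exact ⟨x, by rw [hNa, dbl_apply, (mD x).1 hx]⟩
  have d1 : D.range ≤ N.ker := by
    rintro _ ⟨x, rfl⟩
    rw [mN, hDa, map_sub, hτ]; abel
  have d2 : N.ker.map (dbl V) ≤ D.range := by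
    rintro _ ⟨x, hx, rfl⟩
    exact ⟨-x, by rw [hDa, dbl_apply, map_neg, (mN x).1 hx]; abel⟩
  have i1 := AddSubgroup.relIndex_mul_relIndex _ _ _ n2 n1
  have i2 := AddSubgroup.relIndex_mul_relIndex _ _ _ d2 d1
  have c1 : (D.ker.map (dbl V)).comap N = D.ker ⊔ N.ker := by
    ext x
    rw [AddSubgroup.mem_comap, AddSubgroup.mem_sup]
    constructor
    · rintro ⟨v, hv, h⟩
      refine ⟨v, hv, x - v, ?_, by abel⟩
      rw [dbl_apply, hNa] at h
      rw [mN, map_sub, (mD v).1 hv]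
      have : τ x = v + v - x := by rw [h]; abel
      rw [this]; abel
    · rintro ⟨v, hv, w, hw, rfl⟩
      refine ⟨v, hv, ?_⟩
      rw [dbl_apply, hNa, map_add, (mD v).1 hv, (mN w).1 hw]; abel
  have c2 : (N.ker.map (dbl V)).comap D = D.ker ⊔ N.ker := by
    ext x
    rw [AddSubgroup.mem_comap, AddSubgroup.mem_sup]
    constructor
    · rintro ⟨v, hv, h⟩
      refine ⟨x + v, ?_, -v, neg_mem hv, by abel⟩
      rw [dbl_apply, hDa] at h
      rw [mD, map_add, (mN v).1 hv]
      have : τ x = v + v + x := by rw [h]; abel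
      rw [this]; abel
    · rintro ⟨v, hv, w, hw, rfl⟩
      refine ⟨-w, neg_mem hw, ?_⟩
      rw [dbl_apply, hDa, map_add, (mD v).1 hv, (mN w).1 hw]; abel
  have a1 : (D.ker.map (dbl V)).relIndex N.range = (D.ker ⊔ N.ker).index := by
    rw [← c1, AddSubgroup.index_comap]
  have a2 : (N.ker.map (dbl V)).relIndex D.range = (D.ker ⊔ N.ker).index := by
    rw [← c2, AddSubgroup.index_comap]
  have k1 := two_index_sub D.ker e ((mD e).2 heτ) he he2 ht
  have k2 := two_index_sub N.ker e ((mN e).2 (by rw [heτ]; exact eq_neg_of_add_eq_zero_left he2)) he he2 ht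
  have r1 : Module.finrank ℤ N.ker = Module.finrank ℤ D.ker + 1 := by
    have h3 := rank_nullity N.toIntLinearMap
    have h4 := rank_sq D.ker N.range n2 n1
    have h5 : Module.finrank ℤ (LinearMap.range N.toIntLinearMap) = Module.finrank ℤ N.range := rfl
    have h6 : Module.finrank ℤ (LinearMap.ker N.toIntLinearMap) = Module.finrank ℤ N.ker := rfl
    omega
  rw [a1, k1] at i1
  rw [a2, k2, r1] at i2
  have hne : (D.ker ⊔ N.ker).index ≠ 0 := by
    intro h; rw [h] at i1; simp at i1; exact absurd i1.symm (by positivity)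
  constructor
  · apply mul_left_cancel₀ hne
    rw [i2, mul_left_comm, i1]; ring
  · intro h; rw [h] at i1; simp at i1; exact absurd i1.symm (by positivity)
end UnitIndex
end GB

open IntermediateField NumberField
namespace GB
set_option linter.unusedSectionVars false
open scoped nonZeroDivisors
section Count
variable {A B : Type*} [CommRing A] [CommRing B] [IsDedekindDomain A] [IsDedekindDomain B] [Algebra A B]
  {s : B →+* B}

/-- action on units -/
def sU (s : B →+* B) : Bˣ →* Bˣ := Units.map (s : B →* B)
/-- norm on units -/
def nU (s : B →+* B) : Bˣ →* Bˣ := sU s * MonoidHom.id Bˣ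
/-- division map on units -/
def dU (s : B →+* B) : Bˣ →* Bˣ := sU s / MonoidHom.id Bˣ

lemma sU_val (u : Bˣ) : ((sU s u : Bˣ) : B) = s u := rfl
lemma nU_apply (u : Bˣ) : nU s u = sU s u * u := rfl
lemma dU_apply (u : Bˣ) : dU s u = sU s u / u := rfl
lemma mem_dker (u : Bˣ) : u ∈ (dU s).ker ↔ s u = u := by
  rw [MonoidHom.mem_ker, dU_apply, div_eq_one, Units.ext_iff, sU_val]
lemma mem_nker (u : Bˣ) : u ∈ (nU s).ker ↔ s u * u = 1 := by
  rw [MonoidHom.mem_ker, nU_apply, Units.ext_iff, Units.val_mul, sU_val, Units.val_one]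

/-- units that are norms of fractions -/
def Usub (_h : Invol A s) : Subgroup Bˣ where
  carrier := {u | s u = u ∧ ∃ x y : B, x ≠ 0 ∧ y ≠ 0 ∧ x * s x = u * (y * s y)}
  one_mem' := ⟨by simp, 1, 1, one_ne_zero, one_ne_zero, by simp⟩
  mul_mem' := by
    rintro u v ⟨hu, x, y, hx, hy, e⟩ ⟨hv, x', y', hx', hy', e'⟩
    refine ⟨by simp [hu, hv], x * x', y * y', mul_ne_zero hx hx', mul_ne_zero hy hy', ?_⟩
    rw [map_mul, map_mul, Units.val_mul]
    linear_combination (x' * s x') * e + (u * (y * s y)) * e'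
  inv_mem' := by
    rintro u ⟨hu, x, y, hx, hy, e⟩
    have h1 : s (u⁻¹ : Bˣ) = (u⁻¹ : Bˣ) := by
      have h2 : (u : B) * s (u⁻¹ : Bˣ) = 1 := by
        rw [← map_one s, ← Units.mul_inv u, map_mul, hu]
      rw [← mul_right_inj' u.ne_zero, h2, Units.mul_inv]
    refine ⟨h1, y, x, hy, hx, ?_⟩
    rw [e, ← mul_assoc, Units.inv_mul, one_mul]

lemma nrange_le_U (h : Invol A s) : (nU s).range ≤ Usub h := by
  rintro _ ⟨u, rfl⟩
  have e : ((nU s u : Bˣ) : B) = s u * u := rfl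
  refine ⟨?_, u, 1, u.ne_zero, one_ne_zero, ?_⟩
  · rw [e, map_mul, h.inv, mul_comm]
  · rw [e, map_one]; ring

lemma U_le_dker (h : Invol A s) : Usub h ≤ (dU s).ker := fun u hu => (mem_dker u).2 hu.1

/-- classes of order two containing a fixed ideal -/
def Cst (s : B →+* B) : Set (ClassGroup B) :=
  {c | c ^ 2 = 1 ∧ ∃ J : (Ideal B)⁰, (J : Ideal B).map s = J ∧ ClassGroup.mk0 J = c}

lemma odd_two_one {G : Type*} [Group G] {g : G} (h2 : g ^ 2 = 1) {n : ℕ} (hn : Odd n) (h : g ^ n = 1) :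
    g = 1 := by
  obtain ⟨k, rfl⟩ := hn
  rw [pow_succ, pow_mul, h2, one_pow, one_mul] at h
  exact h

lemma odd_two_pow {G : Type*} [Group G] {g : G} (h2 : g ^ 2 = 1) {n : ℕ} (hn : Odd n) : g ^ n = g := by
  obtain ⟨k, rfl⟩ := hn
  rw [pow_succ, pow_mul, h2, one_pow, one_mul]

lemma mk0_eq_one_span (I : (Ideal B)⁰) (h : ClassGroup.mk0 I = 1) : ∃ b, b ≠ 0 ∧ (I : Ideal B) = Ideal.span {b} := by
  rw [ClassGroup.mk0_eq_one_iff] at h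
  obtain ⟨b, hb⟩ := h
  refine ⟨b, ?_, hb⟩
  rintro rfl
  apply nonZeroDivisors.ne_zero I.2
  rw [hb]; simp

lemma count_st (h : Invol A s) {hh : ℕ} (hodd : Odd hh)
    (hpr : ∀ I : Ideal A, I ≠ ⊥ → ∃ a, I ^ hh = Ideal.span {a})
    [Finite (Ram s)] [Finite (ClassGroup B)] :
    Nat.card (Cst s) * (dU s).range.relIndex (nU s).ker ≤ 2 ^ Nat.card (Ram s) := by
  classical
  have hz : ∀ η : (nU s).ker, ∃ z : B, z ≠ 0 ∧ s z = z * η.1 := by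
    intro η
    obtain ⟨z, hz, e⟩ := h.h90 (x := 1) (y := (η.1 : B)) η.1.ne_zero (by
      have := (mem_nker η.1).1 η.2
      rw [map_one, mul_comm _ (s _), this, mul_one])
    exact ⟨z, hz, by rw [← e, mul_one]⟩
  choose z hz0 hzs using hz
  have hJ : ∀ c : Cst s, ∃ J : (Ideal B)⁰, (J : Ideal B).map s = J ∧ ClassGroup.mk0 J = c.1 := fun c => c.2.2
  choose J hJs hJc using hJ
  let Q := (nU s).ker ⧸ ((dU s).range.subgroupOf (nU s).ker)
  let f : Cst s × Q → (Ram s → ZMod 2) := fun cq P =>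
    ((par P.1 (J cq.1 : Ideal B) + par P.1 (Ideal.span {z (Quotient.out cq.2)}) : ℕ) : ZMod 2)
  have spz : ∀ η, (Ideal.span {z η}).map s = Ideal.span {z η} := by
    intro η
    rw [Ideal.map_span, Set.image_singleton, hzs]
    exact Ideal.span_singleton_mul_right_unit η.1.isUnit _
  have spz0 : ∀ η, Ideal.span {z η} ≠ ⊥ := fun η => by
    rw [Ne, Ideal.span_singleton_eq_bot]; exact hz0 η
  have J0 : ∀ c, (J c : Ideal B) ≠ ⊥ := fun c => nonZeroDivisors.ne_zero (J c).2
  -- extended ideals have principal odd power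
  have ext : ∀ W : Ideal B, W ≠ ⊥ → W.map s = W → (∀ P ∈ Ram s, Even (par P W)) →
      ∃ a : A, a ≠ 0 ∧ W ^ hh = Ideal.span {algebraMap A B a} := by
    intro W hW0 hW hp
    obtain ⟨I, hI⟩ := h.extended W hW0 hW hp
    have hI0 : I ≠ ⊥ := by rintro rfl; rw [Ideal.map_bot] at hI; exact hW0 hI.symm
    obtain ⟨a, ha⟩ := hpr I hI0
    refine ⟨a, ?_, ?_⟩
    · rintro rfl
      have := pow_ne_zero hh hI0
      rw [ha] at this
      exact this (by simp)
    · rw [← hI, ← Ideal.map_pow, ha, Ideal.map_span, Set.image_singleton]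
  have hf : Function.Injective f := by
    rintro ⟨c, q⟩ ⟨c', q'⟩ hcq
    have hpar : ∀ P ∈ Ram s, Even (par P (J c : Ideal B) + par P (Ideal.span {z q.out}) +
        (par P (J c' : Ideal B) + par P (Ideal.span {z q'.out}))) := by
      intro P hP
      have := congrFun hcq ⟨P, hP⟩
      change ((par P (J c : Ideal B) + par P (Ideal.span {z q.out}) : ℕ) : ZMod 2) =
        ((par P (J c' : Ideal B) + par P (Ideal.span {z q'.out}) : ℕ) : ZMod 2) at this
      rw [← ZMod.natCast_eq_zero_iff_even, Nat.cast_add, this]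
      exact CharTwo.add_self_eq_zero _
    have hcc : c = c' := by
      obtain ⟨a, ha0, ha⟩ := ext ((J c * Ideal.span {z q.out}) * (J c' * Ideal.span {z q'.out}))
        (mul_ne_zero (mul_ne_zero (J0 c) (spz0 _)) (mul_ne_zero (J0 c') (spz0 _)))
        (by simp only [Ideal.map_mul, hJs, spz]) (by
          intro P hP
          rw [par_mul P (mul_ne_zero (J0 c) (spz0 _)) (mul_ne_zero (J0 c') (spz0 _)),
            par_mul P (J0 c) (spz0 _), par_mul P (J0 c') (spz0 _)]
          exact hpar P hP)
      have hcl : (c.1 * c'.1) ^ hh = 1 := by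
        let Z : B := (z q.out * z q'.out) ^ hh
        have hZ : Z ≠ 0 := pow_ne_zero _ (mul_ne_zero (hz0 _) (hz0 _))
        rw [← hJc c, ← hJc c', ← map_mul, ← map_pow, ← map_one (ClassGroup.mk0 (R := B)), ClassGroup.mk0_eq_mk0_iff]
        refine ⟨Z, algebraMap A B a, hZ, ?_, ?_⟩
        · intro h0; exact ha0 (h.inj (by rw [h0, map_zero]))
        · have e1 : ((1 : (Ideal B)⁰) : Ideal B) = 1 := rfl
          rw [e1, mul_one, ← ha]
          push_cast
          simp only [Z]
          rw [← Ideal.span_singleton_pow, ← Ideal.span_singleton_mul_span_singleton, ← mul_pow]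
          congr 1; ring
      have h2 : (c.1 * c'.1) ^ 2 = 1 := by rw [mul_pow, c.2.1, c'.2.1, one_mul]
      have h3 := odd_two_one h2 hodd hcl
      have h4 : c'.1 * c'.1 = 1 := by rw [← pow_two]; exact c'.2.1
      exact Subtype.ext (mul_right_cancel (h3.trans h4.symm))
    subst hcc
    refine Prod.ext rfl ?_
    change q = q'
    rw [← Quotient.out_eq q, ← Quotient.out_eq q']
    set η := q.out
    set η' := q'.out
    obtain ⟨a, ha0, ha⟩ := ext (Ideal.span {z η} * Ideal.span {z η'})
        (mul_ne_zero (spz0 _) (spz0 _))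
        (by simp only [Ideal.map_mul, spz]) (by
          intro P hP
          rw [par_mul P (spz0 _) (spz0 _)]
          have := hpar P hP
          rw [show ∀ a b c : ℕ, a + b + (a + c) = 2 * a + (b + c) by intros; ring, Nat.even_add] at this
          exact this.1 (even_two_mul _))
    rw [Ideal.span_singleton_mul_span_singleton, Ideal.span_singleton_pow, Ideal.span_singleton_eq_span_singleton] at ha
    obtain ⟨w, hw⟩ := ha
    have hs := congrArg s hw
    rw [map_mul, h.alg, ← hw, map_pow, map_mul, hzs, hzs] at hs
    have hZ : (z η * z η') ^ hh ≠ 0 := pow_ne_zero _ (mul_ne_zero (hz0 _) (hz0 _))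
    have hw2 : (η.1 * η'.1) ^ hh * sU s w = w := by
      apply Units.ext
      push_cast
      rw [sU_val]
      apply mul_left_cancel₀ hZ
      rw [← hs]; ring
    have hD1 : (η.1 * η'.1) ^ hh ∈ (dU s).range := by
      refine ⟨w⁻¹, ?_⟩
      rw [dU_apply, map_inv, div_inv_eq_mul, inv_mul_eq_iff_eq_mul, mul_comm]
      exact hw2.symm
    have hD2 : ∀ u ∈ (nU s).ker, u ^ 2 ∈ (dU s).range := by
      intro u hu
      refine ⟨u⁻¹, ?_⟩
      have : sU s u = u⁻¹ := by
        rw [MonoidHom.mem_ker, nU_apply] at hu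
        exact eq_inv_of_mul_eq_one_left hu
      rw [dU_apply, map_inv, this]; simp [pow_two]
    have hD3 : η.1 * η'.1 ∈ (dU s).range := by
      obtain ⟨k, rfl⟩ := hodd
      rw [pow_succ, pow_mul] at hD1
      exact ((dU s).range.mul_mem_cancel_left (pow_mem (hD2 _ (mul_mem η.2 η'.2)) k)).1 hD1
    rw [Quotient.eq'', QuotientGroup.leftRel_apply, Subgroup.mem_subgroupOf]
    have : ((η⁻¹ * η' : (nU s).ker) : Bˣ) = (η.1 ^ 2)⁻¹ * (η.1 * η'.1) := by
      push_cast; rw [pow_two]; group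
    rw [this]
    exact mul_mem (inv_mem (hD2 _ η.2)) hD3
  have hle := Nat.card_le_card_of_injective f hf
  rw [Nat.card_prod, Nat.card_fun, Nat.card_zmod] at hle
  exact hle

lemma class_data (h : Invol A s) {hh : ℕ} (hodd : Odd hh)
    (hpr : ∀ I : Ideal A, I ≠ ⊥ → ∃ a, I ^ hh = Ideal.span {a}) (c : ClassGroup B) (hc : c ^ 2 = 1) :
    ∃ (I : (Ideal B)⁰) (x y : B) (u : Usub h), ClassGroup.mk0 I = c ∧ x ≠ 0 ∧ y ≠ 0 ∧
      Ideal.span {x} * (I : Ideal B) = Ideal.span {y} * (I : Ideal B).map s ∧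
      x * s x = u.1 * (y * s y) := by
  obtain ⟨I0, hI0⟩ := ClassGroup.mk0_surjective c
  have hI00 : (I0 : Ideal B) ≠ ⊥ := nonZeroDivisors.ne_zero I0.2
  have hcI : ClassGroup.mk0 (I0 ^ hh) = c := by rw [map_pow, hI0, odd_two_pow hc hodd]
  obtain ⟨J, hJ⟩ := h.norm_ext I0 hI00
  have hJ0 : J ≠ ⊥ := by
    rintro rfl
    rw [Ideal.map_bot] at hJ
    exact mul_ne_zero hI00 (h.map_ne hI00) hJ.symm
  obtain ⟨a, ha⟩ := hpr J hJ0
  set I := I0 ^ hh with hI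
  have hIv : (I : Ideal B) = (I0 : Ideal B) ^ hh := rfl
  have hIn : (I : Ideal B) ≠ ⊥ := nonZeroDivisors.ne_zero I.2
  have e1 : (I : Ideal B) * (I : Ideal B).map s = Ideal.span {algebraMap A B a} := by
    rw [hIv, Ideal.map_pow, ← mul_pow, ← hJ, ← Ideal.map_pow, ha, Ideal.map_span, Set.image_singleton]
  obtain ⟨b, hb0, hb⟩ := mk0_eq_one_span (I * I) (by rw [map_mul, hcI, ← pow_two, hc])
  have hx0 : algebraMap A B a ≠ 0 := by
    intro h0
    rw [h0] at e1
    exact mul_ne_zero hIn (h.map_ne hIn) (by rw [e1]; simp)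
  have e2 : Ideal.span {algebraMap A B a} * (I : Ideal B) = Ideal.span {b} * (I : Ideal B).map s := by
    rw [← hb, ← e1]; push_cast; ring
  have e3 : Ideal.span {s (algebraMap A B a)} * (I : Ideal B).map s = Ideal.span {s b} * (I : Ideal B) := by
    have := congrArg (Ideal.map s) e2
    rwa [Ideal.map_mul, Ideal.map_mul, h.map_map, Ideal.map_span, Ideal.map_span, Set.image_singleton, Set.image_singleton] at this
  set x := algebraMap A B a
  have e4 : Ideal.span {b * s b} = Ideal.span {x * s x} := by
    have hn : (I : Ideal B) * (I : Ideal B).map s ≠ 0 := mul_ne_zero hIn (h.map_ne hIn)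
    apply mul_right_cancel₀ hn
    rw [← Ideal.span_singleton_mul_span_singleton, ← Ideal.span_singleton_mul_span_singleton]
    calc _ = (Ideal.span {b} * (I : Ideal B).map s) * (Ideal.span {s b} * (I : Ideal B)) := by ring
      _ = _ := by rw [← e2, ← e3]; ring
  rw [Ideal.span_singleton_eq_span_singleton] at e4
  obtain ⟨u, hu⟩ := e4
  have hsb0 : s b ≠ 0 := by
    intro h0; exact hb0 (h.s_inj (by rw [h0, map_zero]))
  have hus : s u = u := by
    have h5 := congrArg s hu
    rw [map_mul, map_mul, map_mul, h.inv, h.inv, mul_comm (s b), mul_comm (s x), ← hu] at h5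
    exact mul_left_cancel₀ (mul_ne_zero hb0 hsb0) h5
  have hu' : x * s x = u * (b * s b) := by rw [← hu]; ring
  exact ⟨I, x, b, ⟨u, hus, x, b, hx0, hb0, hu'⟩, hcI, hx0, hb0, e2, hu'⟩

lemma count_two (h : Invol A s) {hh : ℕ} (hodd : Odd hh)
    (hpr : ∀ I : Ideal A, I ≠ ⊥ → ∃ a, I ^ hh = Ideal.span {a})
    [Finite (ClassGroup B)] (hfin : (nU s).range.relIndex (Usub h) ≠ 0) :
    Nat.card {c : ClassGroup B // c ^ 2 = 1} ≤ Nat.card (Cst s) * (nU s).range.relIndex (Usub h) := by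
  classical
  choose I x y u hI hx hy hxy hu using fun c : {c : ClassGroup B // c ^ 2 = 1} => class_data h hodd hpr c.1 c.2
  let Q := Usub h ⧸ ((nU s).range.subgroupOf (Usub h))
  let f : {c : ClassGroup B // c ^ 2 = 1} → Q := fun c => QuotientGroup.mk (u c)
  have key : ∀ c c', f c = f c' → c.1 * c'.1 ∈ Cst s := by
    intro c c' hcc
    refine ⟨by rw [mul_pow, c.2, c'.2, one_mul], ?_⟩
    rw [QuotientGroup.eq, Subgroup.mem_subgroupOf] at hcc
    obtain ⟨η, hη⟩ := hcc
    have hη' : s η * η * (u c).1 = (u c').1 := by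
      have h1 : (u c').1 = nU s η * (u c).1 := by
        rw [hη]; push_cast; rw [mul_right_comm, inv_mul_cancel, one_mul]
      rw [h1]; rfl
    have hus : s (u c).1 = (u c).1 := (u c).2.1
    set y1 : B := η * (u c).1 * (y c * y c') with hy1
    have hy10 : y1 ≠ 0 := mul_ne_zero (mul_ne_zero η.ne_zero (u c).1.ne_zero) (mul_ne_zero (hy c) (hy c'))
    have e1 : (x c * x c') * s (x c * x c') = y1 * s y1 := by
      rw [hy1]
      simp only [map_mul, hus]
      have h1 := hu c
      have h2 := hu c'
      rw [← hη'] at h2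
      linear_combination (x c' * s (x c')) * h1 + ((u c).1 * (y c * s (y c))) * h2
    obtain ⟨z, hz, e2⟩ := h.h90 hy10 e1
    let Jz : Ideal B := Ideal.span {z} * ((I c : Ideal B) * (I c' : Ideal B))
    have hIc : ((I c : Ideal B) * (I c' : Ideal B)) ≠ 0 :=
      mul_ne_zero (nonZeroDivisors.ne_zero (I c).2) (nonZeroDivisors.ne_zero (I c').2)
    have hJz : Jz ≠ ⊥ := mul_ne_zero (by rw [Ne, Ideal.zero_eq_bot, Ideal.span_singleton_eq_bot]; exact hz) hIc
    have e3 : Ideal.span {x c * x c'} * ((I c : Ideal B) * (I c' : Ideal B)) =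
        Ideal.span {y1} * ((I c : Ideal B) * (I c' : Ideal B)).map s := by
      have h3 : Ideal.span {y1} = Ideal.span {y c * y c'} := by
        rw [hy1, Ideal.span_singleton_eq_span_singleton]
        refine Associated.symm ⟨η * (u c).1, ?_⟩
        push_cast; ring
      rw [h3, Ideal.map_mul, ← Ideal.span_singleton_mul_span_singleton, ← Ideal.span_singleton_mul_span_singleton]
      calc _ = (Ideal.span {x c} * (I c : Ideal B)) * (Ideal.span {x c'} * (I c' : Ideal B)) := by ring
        _ = _ := by rw [hxy, hxy]; ring
    refine ⟨⟨Jz, mem_nonZeroDivisors_of_ne_zero hJz⟩, ?_, ?_⟩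
    · change Jz.map s = Jz
      have hsp : Ideal.span {y1} ≠ ⊥ := by rw [Ne, Ideal.span_singleton_eq_bot]; exact hy10
      apply mul_left_cancel₀ hsp
      simp only [Jz]
      rw [Ideal.map_mul, Ideal.map_span, Set.image_singleton, mul_left_comm, ← e3, ← mul_assoc,
        Ideal.span_singleton_mul_span_singleton, e2, mul_comm z, ← Ideal.span_singleton_mul_span_singleton, mul_assoc]
    · rw [← hI c, ← hI c', ← map_mul, ClassGroup.mk0_eq_mk0_iff]
      refine ⟨1, z, one_ne_zero, hz, ?_⟩
      simp [Jz]
  have : Nonempty {c : ClassGroup B // c ^ 2 = 1} := ⟨⟨1, one_pow _⟩⟩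
  let g : {c : ClassGroup B // c ^ 2 = 1} → Cst s × Q := fun c =>
    (⟨c.1 * (Function.invFun f (f c)).1, key _ _ (Function.invFun_eq ⟨c, rfl⟩).symm⟩, f c)
  have : Finite Q := by
    apply Nat.finite_of_card_ne_zero
    exact hfin
  have hg : Function.Injective g := by
    intro c c' hcc
    have h1 := (Prod.ext_iff.1 hcc).2
    have h2 := congrArg Subtype.val (Prod.ext_iff.1 hcc).1
    simp only [g] at h1 h2
    rw [h1] at h2
    exact Subtype.ext (mul_right_cancel h2)
  have hle := Nat.card_le_card_of_injective g hg
  rw [Nat.card_prod] at hle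
  exact hle

/-- Abstract Theorem A -/
theorem thmA (h : Invol A s) {hh : ℕ} (hodd : Odd hh)
    (hpr : ∀ I : Ideal A, I ≠ ⊥ → ∃ a, I ^ hh = Ideal.span {a})
    [Finite (ClassGroup B)] [Finite (Ram s)]
    (h1 : (dU s).range.relIndex (nU s).ker = 2 * (nU s).range.relIndex (dU s).ker)
    (h2 : (nU s).range.relIndex (dU s).ker ≠ 0) :
    2 * (nU s).range.relIndex (dU s).ker ≤ 2 ^ Nat.card (Ram s) ∧
    Nat.card {c : ClassGroup B // c ^ 2 = 1} * (2 * (Usub h).relIndex (dU s).ker) ≤ 2 ^ Nat.card (Ram s) := by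
  have k1 := count_st h hodd hpr
  have k3 := Subgroup.relIndex_mul_relIndex _ _ _ (nrange_le_U h) (U_le_dker h)
  have hfin : (nU s).range.relIndex (Usub h) ≠ 0 := by
    intro h0; rw [h0, zero_mul] at k3; exact h2 k3.symm
  have k2 := count_two h hodd hpr hfin
  have hC : 1 ≤ Nat.card (Cst s) := by
    have : Nonempty (Cst s) := ⟨⟨1, one_pow _, 1, by
      change (1 : Ideal B).map s = 1
      rw [Ideal.one_eq_top, Ideal.map_top], map_one _⟩⟩
    exact Nat.card_pos
  rw [h1] at k1
  constructor
  · calc _ ≤ Nat.card (Cst s) * (2 * (nU s).range.relIndex (dU s).ker) := Nat.le_mul_of_pos_left _ hC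
      _ ≤ _ := k1
  · calc _ ≤ (Nat.card (Cst s) * (nU s).range.relIndex (Usub h)) * (2 * (Usub h).relIndex (dU s).ker) :=
        Nat.mul_le_mul_right _ k2
      _ = Nat.card (Cst s) * (2 * (nU s).range.relIndex (dU s).ker) := by rw [← k3]; ring
      _ ≤ _ := k1
end Count
end GB

open IntermediateField NumberField
namespace GB
set_option linter.unusedSectionVars false
open scoped nonZeroDivisors

/-- K = k(δ), at most quadratic -/
structure QE (k K : IntermediateField ℚ ℂ) (δ : ℂ) : Prop where
  le : k ≤ K
  mem : δ ∈ K
  sq : δ ^ 2 ∈ k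
  rep : ∀ z ∈ K, ∃ a ∈ k, ∃ b ∈ k, z = a + b * δ

variable {k K : IntermediateField ℚ ℂ} {δ : ℂ}

lemma QE.uniq (hn : δ ∉ k) {a b : ℂ} (ha : a ∈ k) (hb : b ∈ k) (h : a + b * δ = 0) :
    a = 0 ∧ b = 0 := by
  by_cases hb0 : b = 0
  · subst hb0; simpa using h
  · exfalso
    apply hn
    have : δ = -a / b := by field_simp; linear_combination h
    rw [this]
    exact k.div_mem (k.neg_mem ha) hb

lemma QE.eqv (h : QE k K δ) (hn : δ ∉ k) :
    ∃ e : (k × k) ≃ₗ[ℚ] K, ∀ p, ((e p : K) : ℂ) = p.1 + p.2 * δ := by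
  let f : (k × k) →ₗ[ℚ] K :=
    { toFun := fun p => ⟨p.1 + p.2 * δ, K.add_mem (h.le p.1.2) (K.mul_mem (h.le p.2.2) h.mem)⟩
      map_add' := fun p q => Subtype.ext (by simp; ring)
      map_smul' := fun r p => Subtype.ext (by simp [Algebra.smul_def]; ring) }
  have hf : Function.Bijective f := by
    constructor
    · refine (injective_iff_map_eq_zero f).2 ?_
      intro p hp
      have h1 : (p.1 : ℂ) + p.2 * δ = 0 := congrArg Subtype.val hp
      obtain ⟨ha, hb⟩ := QE.uniq hn p.1.2 p.2.2 h1
      exact Prod.ext (Subtype.ext ha) (Subtype.ext hb)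
    · rintro ⟨z, hz⟩
      obtain ⟨a, ha, b, hb, rfl⟩ := h.rep z hz
      exact ⟨(⟨a, ha⟩, ⟨b, hb⟩), rfl⟩
  exact ⟨LinearEquiv.ofBijective f hf, fun p => rfl⟩

lemma QE.sigma (h : QE k K δ) (hn : δ ∉ k) :
    ∃ σ : K →+* K, ∀ (a b : k) (z : K), (z : ℂ) = a + b * δ → ((σ z : K) : ℂ) = a - b * δ := by
  obtain ⟨e, he⟩ := h.eqv hn
  let g : K → K := fun z => e ((e.symm z).1, -(e.symm z).2)
  have hg : ∀ (a b : k) (z : K), (z : ℂ) = a + b * δ → ((g z : K) : ℂ) = a - b * δ := by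
    intro a b z hz
    have : e.symm z = (a, b) := by
      rw [LinearEquiv.symm_apply_eq]
      exact Subtype.ext (by rw [he, hz])
    simp only [g, he, this]
    push_cast; ring
  have rep : ∀ z : K, ∃ a b : k, (z : ℂ) = a + b * δ := by
    intro z
    obtain ⟨a, ha, b, hb, e⟩ := h.rep z z.2
    exact ⟨⟨a, ha⟩, ⟨b, hb⟩, e⟩
  refine ⟨{ toFun := g, map_one' := ?_, map_zero' := ?_, map_add' := ?_, map_mul' := ?_ }, hg⟩
  · exact Subtype.ext (by rw [hg 1 0 1 (by simp)]; simp)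
  · intro x y
    obtain ⟨a, b, hx⟩ := rep x
    obtain ⟨c, d, hy⟩ := rep y
    let m : k := ⟨δ ^ 2, h.sq⟩
    have hm : ((m : k) : ℂ) = δ ^ 2 := rfl
    refine Subtype.ext ?_
    rw [hg (a * c + b * d * m) (a * d + b * c) (x * y) (by push_cast; rw [hx, hy, hm]; ring)]
    push_cast; rw [hg a b x hx, hg c d y hy, hm]; ring
  · exact Subtype.ext (by rw [hg 0 0 0 (by simp)]; simp)
  · intro x y
    obtain ⟨a, b, hx⟩ := rep x
    obtain ⟨c, d, hy⟩ := rep y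
    refine Subtype.ext ?_
    rw [hg (a + c) (b + d) (x + y) (by push_cast; rw [hx, hy]; ring)]
    push_cast; rw [hg a b x hx, hg c d y hy]; ring

lemma QE.finite (h : QE k K δ) [FiniteDimensional ℚ k] : FiniteDimensional ℚ K := by
  by_cases hn : δ ∈ k
  · have : K ≤ k := by
      intro z hz
      obtain ⟨a, ha, b, hb, rfl⟩ := h.rep z hz
      exact k.add_mem ha (k.mul_mem hb hn)
    rw [le_antisymm this h.le]; infer_instance
  · obtain ⟨e, -⟩ := h.eqv hn
    exact Module.Finite.equiv e

/-- two-torsion count of the class group -/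
noncomputable def T2 (k : IntermediateField ℚ ℂ) : ℕ := Nat.card {c : ClassGroup (𝓞 k) // c ^ 2 = 1}

/-- units -/
structure IsU (k : IntermediateField ℚ ℂ) (u : ℂ) : Prop where
  mem : u ∈ k
  int : IsIntegral ℤ u
  inv : IsIntegral ℤ u⁻¹
  ne : u ≠ 0

/-- norm form -/
def NF (k : IntermediateField ℚ ℂ) (m u : ℂ) : Prop := ∃ a ∈ k, ∃ b ∈ k, u = a ^ 2 - m * b ^ 2

lemma odd_of_T2 [FiniteDimensional ℚ k] (h : T2 k ≤ 1) : Odd (Nat.card (ClassGroup (𝓞 k))) := by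
  classical
  have : NumberField k := ⟨⟩
  by_contra hc
  rw [Nat.not_odd_iff_even, even_iff_two_dvd] at hc
  have : Fact (Nat.Prime 2) := ⟨Nat.prime_two⟩
  obtain ⟨g, hg⟩ := exists_prime_orderOf_dvd_card' 2 hc
  have h1 : (⟨g, by rw [← hg, pow_orderOf_eq_one]⟩ : {c : ClassGroup (𝓞 k) // c ^ 2 = 1}) = ⟨1, one_pow 2⟩ := by
    have := Finite.card_le_one_iff_subsingleton.1 h
    exact Subsingleton.elim _ _
  have h2 : g = 1 := congrArg Subtype.val h1
  rw [h2, orderOf_one] at hg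
  omega

lemma T2_of_odd [FiniteDimensional ℚ k] (h : Odd (Nat.card (ClassGroup (𝓞 k)))) : T2 k ≤ 1 := by
  have : NumberField k := ⟨⟩
  apply Finite.card_le_one_iff_subsingleton.2
  refine ⟨fun a b => Subtype.ext ?_⟩
  rw [odd_two_one a.2 h pow_card_eq_one', odd_two_one b.2 h pow_card_eq_one']

lemma pow_principal [FiniteDimensional ℚ k] (I : Ideal (𝓞 k)) (hI : I ≠ ⊥) :
    ∃ a, I ^ Nat.card (ClassGroup (𝓞 k)) = Ideal.span {a} := by
  have : NumberField k := ⟨⟩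
  let J : (Ideal (𝓞 k))⁰ := ⟨I, mem_nonZeroDivisors_of_ne_zero hI⟩
  obtain ⟨b, -, hb⟩ := mk0_eq_one_span (J ^ Nat.card (ClassGroup (𝓞 k))) (by rw [map_pow, pow_card_eq_one'])
  exact ⟨b, hb⟩

end GB

open IntermediateField NumberField
namespace GB
set_option linter.unusedSectionVars false
open scoped nonZeroDivisors

lemma idx_two {G : Type*} [CommGroup G] {U E : Subgroup G} (h0 : U.relIndex E ≠ 0) {u : G} (hu : u ∈ E)
    (hn : u ∉ U) : 2 ≤ U.relIndex E := by
  have : U.relIndex E ≠ 1 := by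
    rw [Ne, Subgroup.relIndex_eq_one]
    exact fun h => hn (h hu)
  omega

lemma idx_four {G : Type*} [CommGroup G] {U E : Subgroup G} (hUE : U ≤ E) (h0 : U.relIndex E ≠ 0) {u v : G} (hu : u ∈ E)
    (hv : v ∈ E) (h2 : u ^ 2 ∈ U)
    (hun : u ∉ U) (hvn : v ∉ U) (huv : u * v ∉ U) : 4 ≤ U.relIndex E := by
  have hle : U ≤ U ⊔ Subgroup.zpowers u := le_sup_left
  have hle2 : U ⊔ Subgroup.zpowers u ≤ E := sup_le hUE (by rwa [Subgroup.zpowers_le])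
  have e := Subgroup.relIndex_mul_relIndex _ _ _ hle hle2
  have hne1 : U.relIndex (U ⊔ Subgroup.zpowers u) ≠ 0 := by
    intro h; rw [h, zero_mul] at e; exact h0 e.symm
  have hne2 : (U ⊔ Subgroup.zpowers u).relIndex E ≠ 0 := by
    intro h; rw [h, mul_zero] at e; exact h0 e.symm
  have k1 := idx_two hne1 (u := u) (Subgroup.mem_sup_right (Subgroup.mem_zpowers u)) hun
  have k2 := idx_two hne2 hv (by
    intro hmem
    obtain ⟨w, hw, _, ⟨n, rfl⟩, hwn⟩ := Subgroup.mem_sup.1 hmem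
    simp only at hwn
    rcases Int.even_or_odd' n with ⟨m, rfl | rfl⟩
    · apply hvn
      rw [← hwn, zpow_mul]
      exact mul_mem hw (zpow_mem (by exact_mod_cast h2) m)
    · apply huv
      rw [← hwn, zpow_add, zpow_mul, zpow_one]
      have : u * (w * ((u ^ (2 : ℤ)) ^ m * u)) = w * (u ^ (2 : ℤ)) ^ m * u ^ 2 := by
        rw [pow_two]
        simp only [mul_assoc, mul_comm, mul_left_comm]
      rw [this]
      exact mul_mem (mul_mem hw (zpow_mem (by exact_mod_cast h2) m)) h2)
  nlinarith

lemma real_torsion {K : Type*} [Field K] [NumberField K] [IsTotallyReal K] (x : (𝓞 K)ˣ) (n : ℤ) (hn : n ≠ 0)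
    (h : x ^ n = 1) : x = 1 ∨ x = -1 := by
  obtain ⟨w⟩ : Nonempty (InfinitePlace K) := inferInstance
  have hw : w.IsReal := IsTotallyReal.isReal w
  let φ := InfinitePlace.embedding_of_isReal hw
  have hx : (φ (x : K)) ^ n = 1 := by
    have : (((x ^ n : (𝓞 K)ˣ) : 𝓞 K) : K) = 1 := by rw [h]; simp
    have h2 : (((x ^ n : (𝓞 K)ˣ) : 𝓞 K) : K) = ((x : 𝓞 K) : K) ^ n := NumberField.Units.coe_zpow x n
    rw [← map_zpow₀, ← h2, this, map_one]
  have h1 : |φ (x : K)| = 1 := by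
    have := congrArg (fun t => |t|) hx
    simp only [abs_zpow, abs_one] at this
    by_contra hne
    exact hn ((zpow_eq_one_iff_right₀ (abs_nonneg _) hne).1 this)
  rcases (abs_eq zero_le_one).1 h1 with h2 | h2
  · left
    apply Units.ext
    apply RingOfIntegers.ext
    exact φ.injective (by rw [h2]; simp)
  · right
    apply Units.ext
    apply RingOfIntegers.ext
    exact φ.injective (by rw [h2]; simp)

variable {k K : IntermediateField ℚ ℂ} {δ : ℂ}

/-- candidate ramified primes -/
def RamP (k : IntermediateField ℚ ℂ) (δ : ℂ) : Set (Ideal (𝓞 k)) :=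
  {P | P.IsPrime ∧ P ≠ ⊥ ∧ ∀ a b : k, IsIntegral ℤ ((a : ℂ) + b * δ) →
    ∀ y : 𝓞 k, ((y : k) : ℂ) = 4 * b ^ 2 * δ ^ 2 → y ∈ P}

lemma int_coe {k : IntermediateField ℚ ℂ} {x : k} : IsIntegral ℤ x ↔ IsIntegral ℤ (x : ℂ) :=
  (isIntegral_algebraMap_iff (algebraMap k ℂ).injective).symm

lemma mkO {k : IntermediateField ℚ ℂ} {x : ℂ} (hx : x ∈ k) (hi : IsIntegral ℤ x) :
    ∃ y : 𝓞 k, ((y : k) : ℂ) = x :=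
  ⟨⟨⟨x, hx⟩, int_coe.2 hi⟩, rfl⟩

/-- involution data -/
structure SD (k K : IntermediateField ℚ ℂ) (δ : ℂ) (alg : Algebra (𝓞 k) (𝓞 K)) (σ : K →+* K)
    (s : 𝓞 K →+* 𝓞 K) : Prop where
  halg : ∀ x : 𝓞 k, (((algebraMap (𝓞 k) (𝓞 K) x : 𝓞 K) : K) : ℂ) = ((x : k) : ℂ)
  hσ : ∀ (a b : k) (z : K), (z : ℂ) = a + b * δ → ((σ z : K) : ℂ) = a - b * δ
  hs : ∀ x : 𝓞 K, ((s x : 𝓞 K) : K) = σ x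
  hinv : Invol (𝓞 k) s

lemma QE.sd (h : QE k K δ) (hn : δ ∉ k) [FiniteDimensional ℚ k] : ∃ alg σ s, SD k K δ alg σ s := by
  have hfK := h.finite
  have nk : NumberField k := ⟨⟩
  have nK : NumberField K := ⟨⟩
  obtain ⟨σ, hσ⟩ := h.sigma hn
  have rep : ∀ z : K, ∃ a b : k, (z : ℂ) = a + b * δ := by
    intro z
    obtain ⟨a, ha, b, hb, e⟩ := h.rep z z.2
    exact ⟨⟨a, ha⟩, ⟨b, hb⟩, e⟩
  let ι : k →+* K := (inclusion h.le : k →ₐ[ℚ] K)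
  let alg : Algebra (𝓞 k) (𝓞 K) := (RingOfIntegers.mapRingHom ι).toAlgebra
  have halg : ∀ x : 𝓞 k, (((algebraMap (𝓞 k) (𝓞 K) x : 𝓞 K) : K) : ℂ) = ((x : k) : ℂ) := fun x => rfl
  let s : 𝓞 K →+* 𝓞 K := RingOfIntegers.mapRingHom σ
  have hs : ∀ x : 𝓞 K, ((s x : 𝓞 K) : K) = σ x := fun x => rfl
  have extK : ∀ x y : 𝓞 K, ((x : K) : ℂ) = ((y : K) : ℂ) → x = y := fun x y hxy =>
    RingOfIntegers.ext (Subtype.ext hxy)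
  have extk : ∀ x y : 𝓞 k, ((x : k) : ℂ) = ((y : k) : ℂ) → x = y := fun x y hxy =>
    RingOfIntegers.ext (Subtype.ext hxy)
  have mulK : ∀ x y : 𝓞 K, (((x * y : 𝓞 K) : K) : ℂ) = ((x : K) : ℂ) * ((y : K) : ℂ) := fun x y => rfl
  have subK : ∀ x y : 𝓞 K, (((x - y : 𝓞 K) : K) : ℂ) = ((x : K) : ℂ) - ((y : K) : ℂ) := fun x y => rfl
  have hδ0 : δ ≠ 0 := fun h0 => hn (by rw [h0]; exact k.zero_mem)
  refine ⟨alg, σ, s, halg, hσ, hs, ?_⟩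
  clear_value s alg
  · refine ⟨?_, ?_, ?_, ?_, ?_⟩
    · intro x
      apply extK
      obtain ⟨a, b, hx⟩ := rep x
      have h1 := hσ a b x hx
      rw [hs, hs, hσ a (-b) (σ x) (by rw [h1]; push_cast; ring), hx]
      push_cast; ring
    · intro x
      apply extK
      rw [hs, hσ (x : k) 0 _ (by rw [halg]; simp), halg]; simp
    · intro x hx
      obtain ⟨a, b, hab⟩ := rep x
      have h1 := hσ a b x hab
      rw [← hs, hx, hab] at h1
      have hb : (b : ℂ) = 0 := by
        have : (b : ℂ) * δ = 0 := by linear_combination h1 / 2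
        exact (mul_eq_zero.1 this).resolve_right hδ0
      rw [hb] at hab
      have ha : IsIntegral ℤ (a : ℂ) := by
        have := int_coe.1 x.2
        change IsIntegral ℤ ((x : K) : ℂ) at this
        rw [hab] at this
        simpa using this
      obtain ⟨y, hy⟩ := mkO a.2 ha
      exact ⟨y, extK _ _ (by rw [halg, hab, hy]; simp)⟩
    · intro x y hxy
      apply extk
      rw [← halg, hxy, halg]
    · -- a multiple of δ is integral
      have hKδ : IsIntegral ℚ (⟨δ, h.mem⟩ : K) := Algebra.IsIntegral.isIntegral _
      have hZ : IsAlgebraic ℤ (⟨δ, h.mem⟩ : K) := (IsFractionRing.isAlgebraic_iff ℤ ℚ K).2 hKδ.isAlgebraic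
      obtain ⟨m, hm0, hm⟩ := hZ.exists_integral_multiple
      obtain ⟨x, hx⟩ := mkO (m • (⟨δ, h.mem⟩ : K)).2 (int_coe.1 hm)
      refine ⟨x, ?_⟩
      intro hc
      have h1 : ((x : K) : ℂ) = (0 : k) + (m : k) * δ := by
        rw [hx]
        simp
      have h2 := hσ 0 m _ h1
      rw [← hs, hc, h1] at h2
      have : (m : ℂ) * δ = 0 := by
        push_cast at h2
        linear_combination h2 / 2
      exact mul_ne_zero (by exact_mod_cast hm0) hδ0 this

lemma QE.totReal (h : QE k K δ) [FiniteDimensional ℚ k] (hK : IsTotallyReal K) : IsTotallyReal k := by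
  have hfK := h.finite
  have nk : NumberField k := ⟨⟩
  have nK : NumberField K := ⟨⟩
  let ι : k →+* K := (inclusion h.le : k →ₐ[ℚ] K)
  let _ := ι.toAlgebra
  have : Algebra.IsAlgebraic k K := by
    refine ⟨fun x => ?_⟩
    have hx : IsAlgebraic ℚ x := Algebra.IsAlgebraic.isAlgebraic x
    have : IsScalarTower ℚ k K := IsScalarTower.of_algebraMap_eq (fun q => Subtype.ext rfl)
    exact hx.tower_top k
  exact IsTotallyReal.of_algebra k K

lemma SD.ram (h : QE k K δ) [FiniteDimensional ℚ k] {alg : Algebra (𝓞 k) (𝓞 K)} {σ : K →+* K} {s : 𝓞 K →+* 𝓞 K} (hd : SD k K δ alg σ s)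
    (t : ℕ) (ht : (RamP k δ).encard ≤ t) : Finite (Ram s) ∧ Nat.card (Ram s) ≤ t := by
  have hfK := h.finite
  have nk : NumberField k := ⟨⟩
  have nK : NumberField K := ⟨⟩
  obtain ⟨halg, hσ, hs, hinv⟩ := hd
  have extK : ∀ x y : 𝓞 K, ((x : K) : ℂ) = ((y : K) : ℂ) → x = y := fun x y hxy =>
    RingOfIntegers.ext (Subtype.ext hxy)
  have extk : ∀ x y : 𝓞 k, ((x : k) : ℂ) = ((y : k) : ℂ) → x = y := fun x y hxy =>
    RingOfIntegers.ext (Subtype.ext hxy)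
  have mulK : ∀ x y : 𝓞 K, (((x * y : 𝓞 K) : K) : ℂ) = ((x : K) : ℂ) * ((y : K) : ℂ) := fun x y => rfl
  have subK : ∀ x y : 𝓞 K, (((x - y : 𝓞 K) : K) : ℂ) = ((x : K) : ℂ) - ((y : K) : ℂ) := fun x y => rfl
  have hbot : ∀ P : Ideal (𝓞 K), P ≠ ⊥ → P.comap (algebraMap (𝓞 k) (𝓞 K)) ≠ ⊥ := by
    intro P hP hc
    obtain ⟨x, hx, hx0⟩ := Submodule.exists_mem_ne_zero_of_ne_bot hP
    obtain ⟨a, ha⟩ := hinv.fix (x * s x) (by rw [map_mul, hinv.inv, mul_comm])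
    have : a ∈ P.comap (algebraMap (𝓞 k) (𝓞 K)) := by
      rw [Ideal.mem_comap, ha]; exact P.mul_mem_right _ hx
    rw [hc, Ideal.mem_bot] at this
    rw [this, map_zero] at ha
    rcases mul_eq_zero.1 ha.symm with h1 | h1
    · exact hx0 h1
    · exact hx0 (hinv.s_inj (by rw [h1, map_zero]))
  let F : Ideal (𝓞 K) → Ideal (𝓞 k) := fun P => P.comap (algebraMap (𝓞 k) (𝓞 K))
  have hmaps : ∀ P ∈ Ram s, F P ∈ RamP k δ := by
    intro P hP
    have := hP.1
    refine ⟨Ideal.comap_isPrime _ _, hbot P hP.2.1, ?_⟩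
    intro a b hab y hy
    rw [Ideal.mem_comap]
    obtain ⟨x, hx⟩ := mkO (K.add_mem (h.le a.2) (K.mul_mem (h.le b.2) h.mem)) hab
    have e1 : algebraMap (𝓞 k) (𝓞 K) y = (x - s x) * (x - s x) := by
      apply extK
      rw [halg, hy]
      rw [mulK, subK, hs, hσ a b _ hx, hx]; ring
    rw [e1]
    exact P.mul_mem_left _ (hP.2.2 x)
  have hinj : Set.InjOn F (Ram s) := by
    intro P hP Q hQ hPQ
    rcases hinv.conj hP.1 hQ.1 hP.2.1 (le_of_eq hPQ) with h1 | h1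
    · exact h1.symm
    · rw [hinv.ram_map hP] at h1; exact h1.symm
  have hRamcard : (Ram s).encard ≤ t := by
    rw [← hinj.encard_image]
    refine (Set.encard_le_encard ?_).trans ht
    rintro _ ⟨P, hP, rfl⟩
    exact hmaps P hP
  have hfinR : (Ram s).Finite := Set.finite_of_encard_le_coe hRamcard
  refine ⟨hfinR, ?_⟩
  rw [Nat.card_coe_set_eq]
  have := hfinR.cast_ncard_eq
  rw [← this] at hRamcard
  exact_mod_cast hRamcard

lemma relIndex_add {G : Type*} [CommGroup G] (f g : G →* G) :
    (MonoidHom.toAdditive f).range.relIndex (MonoidHom.toAdditive g).ker = f.range.relIndex g.ker := by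
  have h1 : (MonoidHom.toAdditive f).range = Subgroup.toAddSubgroup f.range := SetLike.ext fun x => Iff.rfl
  have h2 : (MonoidHom.toAdditive g).ker = Subgroup.toAddSubgroup g.ker := SetLike.ext fun x => Iff.rfl
  rw [h1, h2, Subgroup.relIndex_toAddSubgroup]

lemma unit_index_mul {G H : Type*} [CommGroup G] [CommGroup H] [Module.Finite ℤ (Additive G)] (τ : G →* G)
    (hτ : ∀ x, τ (τ x) = x) (e : G) (heτ : τ e = e) (he : e ≠ 1) (he2 : e * e = 1)
    (ht : ∀ (x : G) (n : ℤ), n ≠ 0 → x ^ n = 1 → x = 1 ∨ x = e) (g : H →* G) (hg : Function.Injective g)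
    (hr : g.range = (τ / MonoidHom.id G).ker)
    (hrk : Module.finrank ℤ (Additive G) = 2 * Module.finrank ℤ (Additive H) + 1) :
    (τ / MonoidHom.id G).range.relIndex (τ * MonoidHom.id G).ker =
      2 * (τ * MonoidHom.id G).range.relIndex (τ / MonoidHom.id G).ker ∧
    (τ * MonoidHom.id G).range.relIndex (τ / MonoidHom.id G).ker ≠ 0 := by
  have hUI := unit_index (V := Additive G) (MonoidHom.toAdditive τ)
    (fun x => by
      apply Additive.toMul.injective
      exact hτ _)
    (Additive.ofMul e) (by
      apply Additive.toMul.injective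
      exact heτ)
    (fun h0 => he (Additive.ofMul.injective h0))
    (by
      apply Additive.toMul.injective
      exact he2)
    (fun x n hn' hx => by
      have h1 : (Additive.toMul x) ^ n = 1 := hx
      rcases ht _ n hn' h1 with h2 | h2
      · left; exact h2
      · right; exact h2)
    (by
      let g' : Additive H →+ Additive G := MonoidHom.toAdditive g
      have hg' : Function.Injective g' := hg
      have hr' : g'.range = (MonoidHom.toAdditive τ - AddMonoidHom.id (Additive G)).ker := by
        ext x
        have := SetLike.ext_iff.1 hr (Additive.toMul x)
        exact this
      have e3 := (AddMonoidHom.ofInjective hg').toIntLinearEquiv.finrank_eq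
      rw [← hr', ← e3, hrk])
  have c1 : MonoidHom.toAdditive τ - AddMonoidHom.id (Additive G) = MonoidHom.toAdditive (τ / MonoidHom.id G) :=
    AddMonoidHom.ext fun x => rfl
  have c2 : MonoidHom.toAdditive τ + AddMonoidHom.id (Additive G) = MonoidHom.toAdditive (τ * MonoidHom.id G) :=
    AddMonoidHom.ext fun x => rfl
  rw [c1, c2, relIndex_add, relIndex_add] at hUI
  exact hUI

lemma Invol.units {A B : Type*} [CommRing A] [CommRing B] [IsDedekindDomain A] [IsDedekindDomain B] [Algebra A B]
    {s : B →+* B} (hinv : Invol A s) [Module.Finite ℤ (Additive Bˣ)] (hc : (-1 : Bˣ) ≠ 1)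
    (ht : ∀ (x : Bˣ) (n : ℤ), n ≠ 0 → x ^ n = 1 → x = 1 ∨ x = -1)
    (hrk : Module.finrank ℤ (Additive Bˣ) = 2 * Module.finrank ℤ (Additive Aˣ) + 1) :
    (dU s).range.relIndex (nU s).ker = 2 * (nU s).range.relIndex (dU s).ker ∧
    (nU s).range.relIndex (dU s).ker ≠ 0 := by
  refine unit_index_mul (sU s) (fun x => Units.ext (hinv.inv _)) (-1) (Units.ext (by rw [sU_val]; simp)) hc (by simp) ht
    (Units.map (algebraMap A B : A →* B)) (Units.map_injective hinv.inj) ?_ hrk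
  change _ = (dU s).ker
  ext u
  rw [mem_dker]
  constructor
  · rintro ⟨y, rfl⟩
    exact hinv.alg _
  · intro hx
    obtain ⟨a, ha⟩ := hinv.fix u hx
    have hx'' : sU s u⁻¹ = u⁻¹ := by rw [map_inv, show sU s u = u from Units.ext hx]
    obtain ⟨b, hb⟩ := hinv.fix (u⁻¹ : Bˣ) (congrArg Units.val hx'')
    have hab : a * b = 1 := hinv.inj (by rw [map_mul, ha, hb, map_one, Units.mul_inv])
    exact ⟨⟨a, b, hab, by rw [mul_comm, hab]⟩, Units.ext ha⟩

lemma rank_real (F : Type*) [Field F] [NumberField F] [IsTotallyReal F] :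
    Module.finrank ℤ (Additive (𝓞 F)ˣ) + 1 = Module.finrank ℚ F := by
  have e1 : Module.finrank ℤ (Additive (𝓞 F)ˣ) = Module.finrank ℚ F - 1 := by
    rw [Units.finrank_eq, Units.rank, InfinitePlace.card_eq_nrRealPlaces_add_nrComplexPlaces,
      IsTotallyReal.nrComplexPlaces_eq_zero, IsTotallyReal.finrank]; simp
  have : 0 < Module.finrank ℚ F := Module.finrank_pos
  omega

lemma SD.units (h : QE k K δ) (hn : δ ∉ k) [FiniteDimensional ℚ k] (hK : IsTotallyReal K)
    {alg : Algebra (𝓞 k) (𝓞 K)} {σ : K →+* K} {s : 𝓞 K →+* 𝓞 K} (hd : SD k K δ alg σ s) :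
    (dU s).range.relIndex (nU s).ker = 2 * (nU s).range.relIndex (dU s).ker ∧
    (nU s).range.relIndex (dU s).ker ≠ 0 := by
  have hfK := h.finite
  have nk : NumberField k := ⟨⟩
  have nK : NumberField K := ⟨⟩
  obtain ⟨e, he⟩ := h.eqv hn
  have hrank : Module.finrank ℚ K = 2 * Module.finrank ℚ k := by
    rw [← e.finrank_eq, Module.finrank_prod]; ring
  have hkR := h.totReal hK
  have e1 := rank_real K
  have e2 := rank_real k
  refine hd.hinv.units ?_ (fun x n => real_torsion x n) (by omega)
  intro h1
  have h2 := congrArg (fun u : (𝓞 K)ˣ => (((u : 𝓞 K) : K) : ℂ)) h1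
  simp at h2
  norm_num at h2

theorem QE.key (h : QE k K δ) (hn : δ ∉ k) [FiniteDimensional ℚ k] (hK : IsTotallyReal K)
    (hk : T2 k ≤ 1) (t : ℕ) (ht : (RamP k δ).encard ≤ t) :
    (t ≤ 1 → T2 K ≤ 1 ∧ ∀ u, IsU k u → ∃ a ∈ k, ∃ b ∈ k, IsU K (a + b * δ) ∧ u = a ^ 2 - δ ^ 2 * b ^ 2) ∧
    (t ≤ 3 → (∃ u, IsU k u ∧ ¬ NF k (δ ^ 2) u) → T2 K ≤ 2) ∧
    (t ≤ 3 → (∃ u v, IsU k u ∧ IsU k v ∧ ¬ NF k (δ ^ 2) u ∧ ¬ NF k (δ ^ 2) v ∧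
      ¬ NF k (δ ^ 2) (u * v)) → T2 K ≤ 1) := by
  have hfK := h.finite
  have nk : NumberField k := ⟨⟩
  have nK : NumberField K := ⟨⟩
  obtain ⟨alg, σ, s, hd⟩ := h.sd hn
  obtain ⟨u1, u2⟩ := SD.units h hn hK hd
  obtain ⟨hfinR, hRt⟩ := SD.ram h hd t ht
  obtain ⟨halg, hσ, hs, hinv⟩ := hd
  have rep : ∀ z : K, ∃ a b : k, (z : ℂ) = a + b * δ := by
    intro z
    obtain ⟨a, ha, b, hb, e⟩ := h.rep z z.2
    exact ⟨⟨a, ha⟩, ⟨b, hb⟩, e⟩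
  have extK : ∀ x y : 𝓞 K, ((x : K) : ℂ) = ((y : K) : ℂ) → x = y := fun x y hxy =>
    RingOfIntegers.ext (Subtype.ext hxy)
  have extk : ∀ x y : 𝓞 k, ((x : k) : ℂ) = ((y : k) : ℂ) → x = y := fun x y hxy =>
    RingOfIntegers.ext (Subtype.ext hxy)
  have mulK : ∀ x y : 𝓞 K, (((x * y : 𝓞 K) : K) : ℂ) = ((x : K) : ℂ) * ((y : K) : ℂ) := fun x y => rfl
  have subK : ∀ x y : 𝓞 K, (((x - y : 𝓞 K) : K) : ℂ) = ((x : K) : ℂ) - ((y : K) : ℂ) := fun x y => rfl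
  obtain ⟨A1, A2⟩ := thmA hinv (odd_of_T2 hk) pow_principal u1 u2
  have hpow : 2 ^ Nat.card (Ram s) ≤ 2 ^ t := Nat.pow_le_pow_right (by norm_num) hRt
  replace A1 := A1.trans hpow
  replace A2 := A2.trans hpow
  change T2 K * _ ≤ _ at A2
  have k3 := Subgroup.relIndex_mul_relIndex _ _ _ (nrange_le_U hinv) (U_le_dker hinv)
  have hU0 : (Usub hinv).relIndex (dU s).ker ≠ 0 := by
    intro h0; rw [h0, mul_zero] at k3; exact u2 k3.symm
  -- units
  have mkU : ∀ u, IsU k u → ∃ v : (𝓞 K)ˣ, v ∈ (dU s).ker ∧ (((v : 𝓞 K) : K) : ℂ) = u := by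
    intro u hu
    obtain ⟨x, hx⟩ := mkO (h.le hu.mem) hu.int
    obtain ⟨y, hy⟩ := mkO (h.le (k.inv_mem hu.mem)) hu.inv
    have hxy : x * y = 1 := extK _ _ (by push_cast; rw [hx, hy, mul_inv_cancel₀ hu.ne])
    let v : (𝓞 K)ˣ := ⟨x, y, hxy, by rw [mul_comm, hxy]⟩
    have hv : (((v : 𝓞 K) : K) : ℂ) = u := hx
    refine ⟨v, ?_, hv⟩
    rw [mem_dker]
    apply extK
    rw [hs, hσ ⟨u, hu.mem⟩ 0 _ (by rw [hv]; simp), hv]; simp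
  have nonU : ∀ u, ¬ NF k (δ ^ 2) u → ∀ v : (𝓞 K)ˣ, (((v : 𝓞 K) : K) : ℂ) = u → v ∉ Usub hinv := by
    rintro u hu v hv ⟨-, x, y, hx0, hy0, hxy⟩
    apply hu
    obtain ⟨a, b, hab⟩ := rep ((x : K) / (y : K))
    refine ⟨a, a.2, b, b.2, ?_⟩
    have h1 := hσ a b _ hab
    have hy' : ((y : K) : ℂ) ≠ 0 := by
      intro h0; exact hy0 (extK _ _ (by rw [h0]; simp))
    have hsy' : ((σ (y : K) : K) : ℂ) ≠ 0 := by
      intro h0; exact hy0 (hinv.s_inj (extK _ _ (by rw [hs, h0, map_zero]; simp)))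
    have h2 := congrArg (fun z : 𝓞 K => ((z : K) : ℂ)) hxy
    simp only [mulK] at h2
    rw [hs, hs, hv] at h2
    rw [map_div₀] at h1
    push_cast at h1 hab
    have h3 : u = ((x : K) : ℂ) / ((y : K) : ℂ) * (((σ (x : K) : K) : ℂ) / ((σ (y : K) : K) : ℂ)) := by
      field_simp
      linear_combination -h2
    rw [h3, hab, h1]; ring
  refine ⟨fun h1 => ?_, fun h3 => ?_, fun h3 => ?_⟩
  · have hp : 2 ^ t ≤ 2 := by
      calc 2 ^ t ≤ 2 ^ 1 := Nat.pow_le_pow_right (by norm_num) h1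
        _ = 2 := by norm_num
    constructor
    · have : 1 ≤ (Usub hinv).relIndex (dU s).ker := Nat.pos_of_ne_zero hU0
      nlinarith
    · intro u hu
      have hone : (nU s).range.relIndex (dU s).ker = 1 := by omega
      rw [Subgroup.relIndex_eq_one] at hone
      obtain ⟨v, hv, hvu⟩ := mkU u hu
      obtain ⟨w, hw⟩ := hone hv
      obtain ⟨a, b, hab⟩ := rep ((w : 𝓞 K) : K)
      have hwinv : (((((w⁻¹ : (𝓞 K)ˣ)) : 𝓞 K) : K) : ℂ) = (((w : 𝓞 K) : K) : ℂ)⁻¹ := by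
        apply eq_inv_of_mul_eq_one_left
        have := congrArg (fun z : 𝓞 K => ((z : K) : ℂ)) (Units.inv_mul w)
        simp only [mulK] at this
        rw [this]; simp
      refine ⟨a, a.2, b, b.2, ⟨?_, ?_, ?_, ?_⟩, ?_⟩
      · rw [← hab]; exact ((w : 𝓞 K) : K).2
      · rw [← hab]; exact int_coe.1 (w : 𝓞 K).2
      · rw [← hab, ← hwinv]; exact int_coe.1 ((w⁻¹ : (𝓞 K)ˣ) : 𝓞 K).2
      · rw [← hab]
        intro h0
        exact w.ne_zero (extK _ _ (by rw [h0]; simp))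
      · have h2 := congrArg (fun z : (𝓞 K)ˣ => (((z : 𝓞 K) : K) : ℂ)) hw
        simp only [nU_apply, Units.val_mul, mulK] at h2
        rw [hvu] at h2
        rw [sU_val, hs, hσ a b _ hab, hab] at h2
        rw [← h2]; ring
  · rintro ⟨u, hu, hnu⟩
    have hp : 2 ^ t ≤ 8 := by
      calc 2 ^ t ≤ 2 ^ 3 := Nat.pow_le_pow_right (by norm_num) h3
        _ = 8 := by norm_num
    obtain ⟨v, hv, hvu⟩ := mkU u hu
    have := idx_two hU0 hv (nonU u hnu v hvu)
    nlinarith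
  · rintro ⟨u, u', hu, hu', hnu, hnu', hnuu⟩
    have hp : 2 ^ t ≤ 8 := by
      calc 2 ^ t ≤ 2 ^ 3 := Nat.pow_le_pow_right (by norm_num) h3
        _ = 8 := by norm_num
    obtain ⟨v, hv, hvu⟩ := mkU u hu
    obtain ⟨v', hv', hvu'⟩ := mkU u' hu'
    have := idx_four (U_le_dker hinv) hU0 hv hv' (by
      refine nrange_le_U hinv ⟨v, ?_⟩
      rw [nU_apply, pow_two]
      have : sU s v = v := Units.ext ((mem_dker v).1 hv)
      rw [this]) (nonU u hnu v hvu) (nonU u' hnu' v' hvu') (nonU _ hnuu (v * v') (by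
        rw [Units.val_mul, mulK, hvu, hvu']))
    nlinarith
end GB

open IntermediateField NumberField
namespace GB
set_option linter.unusedSectionVars false
open scoped nonZeroDivisors

section
variable {A B : Type*} [CommRing A] [CommRing B] [IsDedekindDomain A] [IsDedekindDomain B] [Algebra A B]
  {s : B →+* B}
lemma Invol.ideal_inj (h : Invol A s) : Function.Injective (Ideal.map (algebraMap A B)) := by
  have : FaithfulSMul A B := (faithfulSMul_iff_algebraMap_injective A B).2 h.inj
  have : Algebra.IsIntegral A B := by
    refine ⟨fun x => ?_⟩
    obtain ⟨t, ht⟩ := h.fix (x + s x) (by rw [map_add, h.inv, add_comm])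
    obtain ⟨n, hn⟩ := h.fix (x * s x) (by rw [map_mul, h.inv, mul_comm])
    refine ⟨Polynomial.X ^ 2 - Polynomial.C t * Polynomial.X + Polynomial.C n, ?_, ?_⟩
    · monicity!
    · simp [ht, hn]; ring
  have : Module.IsTorsionFree A B := by
    infer_instance
  have : Module.Flat A B := inferInstance
  have : Module.FaithfullyFlat A B := inferInstance
  intro I J hIJ
  rw [← I.comap_map_eq_self_of_faithfullyFlat (B := B), hIJ, J.comap_map_eq_self_of_faithfullyFlat (B := B)]

lemma Invol.transfer (h : Invol A s) (n : ℕ) (hB : ∀ I : Ideal B, I ≠ ⊥ → ∃ a, I ^ n = Ideal.span {a})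
    (I : Ideal A) (hI : I ≠ ⊥) : ∃ a, I ^ (2 * n) = Ideal.span {a} := by
  have hI' : I.map (algebraMap A B) ≠ ⊥ := by
    intro h0
    exact hI (h.ideal_inj (by rw [h0, Ideal.map_bot]))
  obtain ⟨γ, hγ⟩ := hB _ hI'
  obtain ⟨a, ha⟩ := h.fix (γ * s γ) (by rw [map_mul, h.inv, mul_comm])
  refine ⟨a, h.ideal_inj ?_⟩
  have e1 : (I.map (algebraMap A B)).map s = I.map (algebraMap A B) := by
    rw [Ideal.map_map]
    congr 1
    exact RingHom.ext h.alg
  have e2 : Ideal.span {s γ} = (I.map (algebraMap A B)) ^ n := by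
    rw [← Set.image_singleton, ← Ideal.map_span, ← hγ, Ideal.map_pow, e1]
  rw [Ideal.map_pow, Ideal.map_span, Set.image_singleton, ha, ← Ideal.span_singleton_mul_span_singleton, e2, ← hγ,
    two_mul, pow_add]
end

variable {k K : IntermediateField ℚ ℂ} {δ : ℂ}

lemma QE.sup (k : IntermediateField ℚ ℂ) {δ : ℂ} (h : δ ^ 2 ∈ k) : QE k (k ⊔ ℚ⟮δ⟯) δ := by
  have hδ : δ ∈ k ⊔ ℚ⟮δ⟯ := (le_sup_right : ℚ⟮δ⟯ ≤ _) (mem_adjoin_simple_self ℚ δ)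
  refine ⟨le_sup_left, hδ, h, ?_⟩
  by_cases hn : δ ∈ k
  · intro z hz
    have : k ⊔ ℚ⟮δ⟯ = k := by
      rw [sup_eq_left, adjoin_simple_le_iff]; exact hn
    rw [this] at hz
    exact ⟨z, hz, 0, k.zero_mem, by simp⟩
  · let S : IntermediateField ℚ ℂ :=
      { carrier := {z | ∃ a ∈ k, ∃ b ∈ k, z = a + b * δ}
        mul_mem' := by
          rintro _ _ ⟨a, ha, b, hb, rfl⟩ ⟨c, hc, d, hd, rfl⟩
          exact ⟨a * c + b * d * δ ^ 2, k.add_mem (k.mul_mem ha hc) (k.mul_mem (k.mul_mem hb hd) h),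
            a * d + b * c, k.add_mem (k.mul_mem ha hd) (k.mul_mem hb hc), by ring⟩
        one_mem' := ⟨1, k.one_mem, 0, k.zero_mem, by simp⟩
        add_mem' := by
          rintro _ _ ⟨a, ha, b, hb, rfl⟩ ⟨c, hc, d, hd, rfl⟩
          exact ⟨a + c, k.add_mem ha hc, b + d, k.add_mem hb hd, by ring⟩
        zero_mem' := ⟨0, k.zero_mem, 0, k.zero_mem, by simp⟩
        algebraMap_mem' := fun r => ⟨algebraMap ℚ ℂ r, k.algebraMap_mem r, 0, k.zero_mem, by simp⟩
        inv_mem' := by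
          rintro _ ⟨a, ha, b, hb, rfl⟩
          by_cases h0 : a + b * δ = 0
          · exact ⟨0, k.zero_mem, 0, k.zero_mem, by rw [h0]; simp⟩
          have h1 : a - b * δ ≠ 0 := by
            intro h1
            have := QE.uniq hn ha (k.neg_mem hb) (by linear_combination h1)
            apply h0
            rw [this.1, neg_eq_zero.1 this.2]; simp
          have h2 : a ^ 2 - δ ^ 2 * b ^ 2 ≠ 0 := by
            have := mul_ne_zero h0 h1
            intro h2; apply this; linear_combination h2
          have h3 : a ^ 2 - δ ^ 2 * b ^ 2 ∈ k := k.sub_mem (k.pow_mem ha 2) (k.mul_mem h (k.pow_mem hb 2))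
          refine ⟨a / (a ^ 2 - δ ^ 2 * b ^ 2), k.div_mem ha h3, -b / (a ^ 2 - δ ^ 2 * b ^ 2), k.div_mem (k.neg_mem hb) h3, ?_⟩
          rw [inv_eq_iff_eq_inv, eq_comm, inv_eq_iff_eq_inv, eq_comm]
          rw [inv_eq_of_mul_eq_one_left]
          field_simp
          ring }
    have : k ⊔ ℚ⟮δ⟯ ≤ S := by
      refine sup_le ?_ ?_
      · intro z hz
        exact ⟨z, hz, 0, k.zero_mem, by simp⟩
      · rw [adjoin_simple_le_iff]
        exact ⟨0, k.zero_mem, 1, k.one_mem, by simp⟩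
    exact this

lemma QE.eq_of_mem (h : QE k K δ) (hn : δ ∈ k) : K = k := by
  refine le_antisymm ?_ h.le
  intro z hz
  obtain ⟨a, ha, b, hb, rfl⟩ := h.rep z hz
  exact k.add_mem ha (k.mul_mem hb hn)

/-- surjectivity of norms on units -/
def NS (k K : IntermediateField ℚ ℂ) (δ : ℂ) : Prop :=
  ∀ u, IsU k u → ∃ a ∈ k, ∃ b ∈ k, IsU K (a + b * δ) ∧ u = a ^ 2 - δ ^ 2 * b ^ 2

lemma QE.cor1 (h : QE k K δ) (h0 : δ ≠ 0) [FiniteDimensional ℚ k] (hK : IsTotallyReal K)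
    (hk : T2 k ≤ 1) (ht : (RamP k δ).encard ≤ 1) : T2 K ≤ 1 ∧ NS k K δ := by
  by_cases hn : δ ∈ k
  · have e := h.eq_of_mem hn
    refine ⟨by rw [e]; exact hk, ?_⟩
    intro u hu
    have h2 : (2 : ℂ) ∈ k := by exact_mod_cast k.natCast_mem 2
    refine ⟨(u + 1) / 2, k.div_mem (k.add_mem hu.mem k.one_mem) h2, (u - 1) / (2 * δ),
      k.div_mem (k.sub_mem hu.mem k.one_mem) (k.mul_mem h2 hn), ?_, ?_⟩
    · have : (u + 1) / 2 + (u - 1) / (2 * δ) * δ = u := by field_simp; ring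
      rw [this, e]; exact hu
    · field_simp; ring
  · exact (h.key hn hK hk 1 (by exact_mod_cast ht)).1 le_rfl

lemma QE.cor2 (h : QE k K δ) [FiniteDimensional ℚ k] (hK : IsTotallyReal K)
    (hk : T2 k ≤ 1) (ht : (RamP k δ).encard ≤ 3) (hu : ∃ u, IsU k u ∧ ¬ NF k (δ ^ 2) u) : T2 K ≤ 2 := by
  by_cases hn : δ ∈ k
  · rw [h.eq_of_mem hn]; omega
  · exact (h.key hn hK hk 3 (by exact_mod_cast ht)).2.1 le_rfl hu

lemma QE.cor3 (h : QE k K δ) [FiniteDimensional ℚ k] (hK : IsTotallyReal K)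
    (hk : T2 k ≤ 1) (ht : (RamP k δ).encard ≤ 3) (hu : ∃ u v, IsU k u ∧ IsU k v ∧ ¬ NF k (δ ^ 2) u ∧ ¬ NF k (δ ^ 2) v ∧
      ¬ NF k (δ ^ 2) (u * v)) : T2 K ≤ 1 := by
  by_cases hn : δ ∈ k
  · rw [h.eq_of_mem hn]; omega
  · exact (h.key hn hK hk 3 (by exact_mod_cast ht)).2.2 le_rfl hu

lemma exp_of_ideals [FiniteDimensional ℚ k] (n : ℕ) (h : ∀ I : Ideal (𝓞 k), I ≠ ⊥ → ∃ a, I ^ n = Ideal.span {a})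
    (c : ClassGroup (𝓞 k)) : c ^ n = 1 := by
  have : NumberField k := ⟨⟩
  obtain ⟨I, rfl⟩ := ClassGroup.mk0_surjective c
  rw [← map_pow, ClassGroup.mk0_eq_one_iff]
  obtain ⟨a, ha⟩ := h I (nonZeroDivisors.ne_zero I.2)
  exact ⟨a, by simpa using ha⟩

lemma QE.exponent (h : QE k K δ) [FiniteDimensional ℚ k] (hK : T2 K ≤ 1) :
    ∃ n, Odd n ∧ ∀ c : ClassGroup (𝓞 k), c ^ (2 * n) = 1 := by
  have hfK := h.finite
  have nk : NumberField k := ⟨⟩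
  have nK : NumberField K := ⟨⟩
  refine ⟨Nat.card (ClassGroup (𝓞 K)), odd_of_T2 hK, ?_⟩
  by_cases hn : δ ∈ k
  · have e := h.eq_of_mem hn
    subst e
    intro c
    rw [mul_comm, pow_mul, pow_card_eq_one', one_pow]
  · obtain ⟨alg, σ, s, hd⟩ := h.sd hn
    exact exp_of_ideals _ (hd.hinv.transfer _ pow_principal)

lemma prim_le_T2 [FiniteDimensional ℚ k] (n : ℕ) (hn : Odd n) (h : ∀ c : ClassGroup (𝓞 k), c ^ (2 * n) = 1) :
    Nat.card (CommGroup.primaryComponent (ClassGroup (𝓞 k)) 2) ≤ T2 k := by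
  have nk : NumberField k := ⟨⟩
  have key : ∀ c ∈ CommGroup.primaryComponent (ClassGroup (𝓞 k)) 2, c ^ 2 = 1 := by
    rintro c ⟨m, hm⟩
    have h1 : (c ^ 2) ^ (Nat.gcd n (2 ^ m)) = 1 := by
      refine pow_gcd_eq_one.2 ⟨?_, ?_⟩
      · rw [← pow_mul]; exact h c
      · rw [← pow_mul, mul_comm, pow_mul, hm, one_pow]
    have h2 : Nat.gcd n (2 ^ m) = 1 := Nat.Coprime.pow_right m (Nat.coprime_two_right.2 hn)
    rwa [h2, pow_one] at h1
  exact Nat.card_le_card_of_injective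
    (fun c : CommGroup.primaryComponent (ClassGroup (𝓞 k)) 2 => (⟨c.1, key c.1 c.2⟩ : {c : ClassGroup (𝓞 k) // c ^ 2 = 1}))
    (fun a b hab => by
      simp only [Subtype.mk.injEq] at hab
      exact Subtype.ext hab)

lemma prim_of_T2_one [FiniteDimensional ℚ k] (h : T2 k ≤ 1) :
    Nat.card (CommGroup.primaryComponent (ClassGroup (𝓞 k)) 2) ≤ 1 := by
  have nk : NumberField k := ⟨⟩
  refine (prim_le_T2 _ (odd_of_T2 h) ?_).trans h
  intro c
  rw [mul_comm, pow_mul, pow_card_eq_one', one_pow]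

lemma prim_finite [FiniteDimensional ℚ k] :
    Nat.card (CommGroup.primaryComponent (ClassGroup (𝓞 k)) 2) ≤ Nat.card (ClassGroup (𝓞 k)) := by
  have nk : NumberField k := ⟨⟩
  exact Nat.card_le_card_of_injective Subtype.val Subtype.val_injective
end GB

open IntermediateField NumberField
namespace GB
set_option linter.unusedSectionVars false
open scoped nonZeroDivisors

/-- the numbers 2cos(2π/2^(n+2)) -/
noncomputable def cc (n : ℕ) : ℂ := ((2 * Real.cos (2 * Real.pi / 2 ^ (n + 2)) : ℝ) : ℂ)

lemma cc_zero : cc 0 = 0 := by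
  unfold cc
  have : 2 * Real.pi / 2 ^ (0 + 2) = Real.pi / 2 := by ring
  rw [this, Real.cos_pi_div_two]; simp

lemma cc_succ (n : ℕ) : cc (n + 1) ^ 2 = 2 + cc n := by
  unfold cc
  have : 2 * Real.pi / 2 ^ (n + 2) = 2 * (2 * Real.pi / 2 ^ (n + 1 + 2)) := by
    rw [pow_succ 2 (n + 1 + 1)]
    field_simp
  rw [this, Real.cos_two_mul]
  push_cast; ring

lemma cc_int (n : ℕ) : IsIntegral ℤ (cc n) := by
  induction n with
  | zero => rw [cc_zero]; exact isIntegral_zero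
  | succ n ih =>
    refine IsIntegral.of_pow (n := 2) (by norm_num) ?_
    rw [cc_succ]
    have : IsIntegral ℤ (2 : ℂ) := by exact_mod_cast isIntegral_algebraMap (R := ℤ) (A := ℂ) (x := 2)
    exact this.add ih

lemma cc_ne (n : ℕ) : cc (n + 1) ≠ 0 := by
  have h8 : (8 : ℝ) ≤ 2 ^ (n + 1 + 2) := by
    calc (8 : ℝ) = 2 ^ 3 := by norm_num
      _ ≤ 2 ^ (n + 1 + 2) := pow_le_pow_right₀ (by norm_num) (by omega)
  have hpi := Real.pi_pos
  have h1 : 0 < Real.cos (2 * Real.pi / 2 ^ (n + 1 + 2)) := by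
    apply Real.cos_pos_of_mem_Ioo
    constructor
    · have : 0 < 2 * Real.pi / 2 ^ (n + 1 + 2) := by positivity
      linarith
    · rw [div_lt_iff₀ (by positivity)]
      nlinarith
  unfold cc
  exact_mod_cast (by positivity : (2 * Real.cos (2 * Real.pi / 2 ^ (n + 1 + 2)) : ℝ) ≠ 0)

variable {k K : IntermediateField ℚ ℂ} {δ : ℂ}

lemma cc_mem {n : ℕ} (h : cc n ∈ k) {i : ℕ} (hi : i ≤ n) : cc i ∈ k := by
  induction n generalizing i with
  | zero => rwa [Nat.le_zero.1 hi]
  | succ n ih =>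
    rcases Nat.lt_or_ge i (n + 1) with h1 | h1
    · refine ih ?_ (by omega)
      have : cc n = cc (n + 1) ^ 2 - (2 : ℕ) := by rw [cc_succ]; push_cast; ring
      rw [this]
      exact k.sub_mem (k.pow_mem h 2) (k.natCast_mem 2)
    · rwa [le_antisymm hi h1]

lemma cc_seq {n : ℕ} (h : cc n ∈ k) : ∃ x : ℕ → 𝓞 k, (∀ i ≤ n, ((x i : k) : ℂ) = cc i) ∧ x 0 = 0 ∧
    ∀ i < n, x (i + 1) ^ 2 = 2 + x i := by
  have : ∀ i, ∃ y : 𝓞 k, i ≤ n → ((y : k) : ℂ) = cc i := by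
    intro i
    by_cases hi : i ≤ n
    · obtain ⟨y, hy⟩ := mkO (cc_mem h hi) (cc_int i)
      exact ⟨y, fun _ => hy⟩
    · exact ⟨0, fun h => absurd h hi⟩
  choose x hx using this
  refine ⟨x, hx, ?_, ?_⟩
  · exact RingOfIntegers.ext (Subtype.ext (by rw [hx 0 (by omega), cc_zero]; simp))
  · intro i hi
    refine RingOfIntegers.ext (Subtype.ext ?_)
    have := cc_succ i
    rw [← hx i (by omega), ← hx (i + 1) (by omega)] at this
    exact this

/-- primes over ℓ -/
def PO (k : IntermediateField ℚ ℂ) (l : ℕ) : Set (Ideal (𝓞 k)) :=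
  {P | P.IsPrime ∧ P ≠ ⊥ ∧ (l : 𝓞 k) ∈ P}

lemma count [FiniteDimensional ℚ k] {l : ℕ} (hl : 2 ≤ l) (e f t : ℕ)
    (h : ∀ P ∈ PO k l, (l : 𝓞 k) ∈ P ^ e ∧ l ^ f ≤ Nat.card (𝓞 k ⧸ P)) (hN : Module.finrank ℚ k < (t + 1) * (e * f)) :
    (PO k l).encard ≤ t := by
  have nk : NumberField k := ⟨⟩
  by_contra hc
  rw [not_le] at hc
  have hc' : ((t + 1 : ℕ) : ℕ∞) ≤ (PO k l).encard := by
    push_cast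
    exact Order.add_one_le_of_lt hc
  obtain ⟨T, hT, hTc⟩ := Set.exists_subset_encard_eq hc'
  have hfin : T.Finite := Set.finite_of_encard_eq_coe hTc
  lift T to Finset (Ideal (𝓞 k)) using hfin
  rw [Set.encard_coe_eq_coe_finsetCard] at hTc
  have hTc' : T.card = t + 1 := by exact_mod_cast hTc
  have hdvd : ∏ P ∈ T, P ^ e ∣ Ideal.span {(l : 𝓞 k)} := by
    refine Finset.prod_dvd_of_coprime ?_ ?_
    · intro P hP Q hQ hne
      have hP' := hT hP
      have hQ' := hT hQ
      have := hP'.1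
      have := hQ'.1
      have m1 : P.IsMaximal := hP'.1.isMaximal hP'.2.1
      have m2 : Q.IsMaximal := hQ'.1.isMaximal hQ'.2.1
      exact (Ideal.isCoprime_iff_sup_eq.2 (m1.coprime_of_ne m2 hne)).pow
    · intro P hP
      rw [Ideal.dvd_span_singleton]
      exact (h P (hT hP)).1
  have h1 := Nat.le_of_dvd (by
    rw [Ideal.absNorm_span_natCast, RingOfIntegers.rank]
    positivity) (Ideal.absNorm_dvd_absNorm_of_le (Ideal.dvd_iff_le.1 hdvd))
  rw [Ideal.absNorm_span_natCast, RingOfIntegers.rank, map_prod] at h1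
  have h2 : ∏ P ∈ T, (l ^ (e * f)) ≤ ∏ P ∈ T, Ideal.absNorm (P ^ e) := by
    refine Finset.prod_le_prod' ?_
    intro P hP
    rw [map_pow, mul_comm, pow_mul]
    exact Nat.pow_le_pow_left (h P (hT hP)).2 e
  rw [Finset.prod_const, hTc', ← pow_mul] at h2
  have h3 := (Nat.pow_le_pow_iff_right (by omega)).1 (h2.trans h1)
  rw [mul_comm] at h3
  omega

lemma residue_order {F : Type*} [Field F] [Finite F] (h2 : (2 : F) ≠ 0) (n : ℕ) (y : ℕ → F) (h0 : y 0 = 0)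
    (hy : ∀ i < n, y (i + 1) ^ 2 = 2 + y i) : 2 ^ (n + 3) ∣ Nat.card F ^ 2 - 1 := by
  have : Fintype F := Fintype.ofFinite F
  let Ω := AlgebraicClosure F
  let z : ℕ → Ω := fun i => algebraMap F Ω (y i)
  obtain ⟨ζ, hζ⟩ : ∃ ζ : Ω, ζ * ζ - z n * ζ + 1 = 0 := by
    have hd : (Polynomial.X ^ 2 - Polynomial.C (z n) * Polynomial.X + 1 : Polynomial Ω).degree = 2 := by
      compute_degree!
    obtain ⟨r, hr⟩ := IsAlgClosed.exists_root _ (show (Polynomial.X ^ 2 - Polynomial.C (z n) * Polynomial.X + 1 : Polynomial Ω).degree ≠ 0 by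
      rw [hd]; norm_num)
    refine ⟨r, ?_⟩
    simp [Polynomial.IsRoot] at hr
    linear_combination hr
  have hζ0 : ζ ≠ 0 := by rintro rfl; simp at hζ
  have hz : ∀ i < n, z (i + 1) ^ 2 = 2 + z i := by
    intro i hi
    simp only [z]
    rw [← map_pow, hy i hi, map_add, map_ofNat]
  have key : ∀ i ≤ n, ζ ^ 2 ^ i * ζ ^ 2 ^ i + 1 = z (n - i) * ζ ^ 2 ^ i := by
    intro i
    induction i with
    | zero => intro _; simp; linear_combination hζ
    | succ i ih =>
      intro hi
      have h3 := ih (by omega)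
      have h4 := hz (n - (i + 1)) (by omega)
      rw [show n - (i + 1) + 1 = n - i by omega] at h4
      have h5 : z (n - (i + 1)) = z (n - i) ^ 2 - 2 := by rw [h4]; ring
      rw [h5, pow_succ 2 i, pow_mul]
      set w := ζ ^ 2 ^ i
      linear_combination (w * w + 1 + z (n - i) * w) * h3
  have h3 := key n le_rfl
  have hz0 : z 0 = 0 := by simp [z, h0]
  rw [Nat.sub_self, hz0, zero_mul] at h3
  have h4 : ζ ^ 2 ^ (n + 1) = -1 := by
    rw [pow_succ, pow_mul]; linear_combination h3
  have h2Ω : (2 : Ω) ≠ 0 := by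
    intro h; apply h2
    apply (algebraMap F Ω).injective
    rw [map_ofNat, h, map_zero]
  have hord : orderOf ζ = 2 ^ (n + 2) := by
    refine orderOf_eq_prime_pow ?_ ?_
    · rw [h4]
      intro h
      apply h2Ω
      linear_combination -h
    · rw [pow_succ, pow_mul, h4]; norm_num
  set a := Nat.card F with ha
  have ha' : a = Fintype.card F := Nat.card_eq_fintype_card
  have ha1 : 1 < a := Finite.one_lt_card
  -- Frobenius
  have hza : z n ^ a = z n := by
    simp only [z]; rw [← map_pow, ha', FiniteField.pow_card]
  obtain ⟨p, hp⟩ := CharP.exists F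
  have hpp : Fact p.Prime := ⟨CharP.char_is_prime F p⟩
  obtain ⟨m, -, hm⟩ := FiniteField.card F p
  have hpΩ : CharP Ω p := charP_of_injective_algebraMap (algebraMap F Ω).injective p
  have h5 : (ζ * ζ - z n * ζ + 1) ^ a = 0 := by rw [hζ, zero_pow (by omega)]
  rw [ha', hm, add_pow_char_pow, sub_pow_char_pow, mul_pow, mul_pow, ← hm, ← ha', hza, one_pow] at h5
  have h6 : (ζ ^ a - ζ) * (ζ ^ (a + 1) - 1) = 0 := by
    have : (ζ ^ a - ζ) * (ζ ^ (a + 1) - 1) = ζ * (ζ ^ a * ζ ^ a - z n * ζ ^ a + 1) - ζ ^ a * (ζ * ζ - z n * ζ + 1) := by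
      rw [pow_succ]; ring
    rw [this, h5, hζ]; ring
  have h7 : a ^ 2 - 1 = (a + 1) * (a - 1) := by
    have := Nat.sq_sub_sq a 1
    simpa using this
  have hodd : Odd a := by
    rw [ha', hm]
    refine Odd.pow (hpp.out.odd_of_ne_two ?_)
    rintro rfl
    exact h2 (CharTwo.two_eq_zero)
  obtain ⟨b, hb⟩ := hodd
  rw [h7, show n + 3 = (n + 2) + 1 by omega, pow_succ]
  rcases mul_eq_zero.1 h6 with h8 | h8
  · have : ζ ^ (a - 1) = 1 := by
      apply mul_left_cancel₀ hζ0
      rw [← pow_succ', Nat.sub_add_cancel (by omega)]; linear_combination h8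
    have := orderOf_dvd_of_pow_eq_one this
    rw [hord] at this
    rw [mul_comm]
    exact mul_dvd_mul ⟨b + 1, by omega⟩ this
  · have : ζ ^ (a + 1) = 1 := by linear_combination h8
    have := orderOf_dvd_of_pow_eq_one this
    rw [hord] at this
    exact mul_dvd_mul this ⟨b, by omega⟩

lemma lte (l f n c : ℕ) (hl : l % 2 = 1) (hl1 : 1 < l) (hf : f ≠ 0) (hc : padicValNat 2 (l + 1) + padicValNat 2 (l - 1) = c)
    (h : 2 ^ (n + c) ∣ (l ^ f) ^ 2 - 1) : 2 ^ n ≤ f := by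
  have : Fact (Nat.Prime 2) := ⟨Nat.prime_two⟩
  rw [← pow_mul] at h
  have h1 := padicValNat.pow_two_sub_one (x := l) (n := f * 2) hl1 (by omega) (by omega) (by simp)
  rw [padicValNat.mul hf (by norm_num), padicValNat.self (by norm_num)] at h1
  have h2 : n + c ≤ padicValNat 2 (l ^ (f * 2) - 1) := by
    refine (padicValNat_dvd_iff_le ?_).1 h
    have : 1 < l ^ (f * 2) := Nat.one_lt_pow (by omega) hl1
    omega
  have h3 : n ≤ padicValNat 2 f := by omega
  exact Nat.le_of_dvd (by omega) ((padicValNat_dvd_iff_le hf).2 h3)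

lemma residue_card [FiniteDimensional ℚ k] {l : ℕ} (hl : l.Prime) (hl2 : l ≠ 2) {P : Ideal (𝓞 k)} (hP : P ∈ PO k l)
    {n : ℕ} (hc : cc n ∈ k) : ∃ f, f ≠ 0 ∧ Nat.card (𝓞 k ⧸ P) = l ^ f ∧ 2 ^ (n + 3) ∣ (l ^ f) ^ 2 - 1 := by
  have nk : NumberField k := ⟨⟩
  have hm : P.IsMaximal := hP.1.isMaximal hP.2.1
  let _ : Field (𝓞 k ⧸ P) := Ideal.Quotient.field P
  have hfin : Finite (𝓞 k ⧸ P) := Ideal.finiteQuotientOfFreeOfNeBot P hP.2.1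
  have hft : Fintype (𝓞 k ⧸ P) := Fintype.ofFinite _
  have hl0 : (l : 𝓞 k ⧸ P) = 0 := by
    have := Ideal.Quotient.eq_zero_iff_mem.2 hP.2.2
    simpa using this
  have hpp : Fact l.Prime := ⟨hl⟩
  have hch : CharP (𝓞 k ⧸ P) l := (CharP.charP_iff_prime_eq_zero hl).2 hl0
  obtain ⟨m, -, hm⟩ := FiniteField.card (𝓞 k ⧸ P) l
  refine ⟨m, m.pos.ne', by rw [Nat.card_eq_fintype_card, hm], ?_⟩
  obtain ⟨x, -, x0, hx⟩ := cc_seq hc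
  have := residue_order (F := 𝓞 k ⧸ P) (by
    intro h
    have h' : ((2 : ℕ) : 𝓞 k ⧸ P) = 0 := by exact_mod_cast h
    rw [CharP.cast_eq_zero_iff (𝓞 k ⧸ P) l] at h'
    exact hl2 ((Nat.prime_dvd_prime_iff_eq hl Nat.prime_two).1 h')) n (fun i => Ideal.Quotient.mk P (x i)) (by simp [x0]) (by
    intro i hi
    rw [← map_pow, hx i hi, map_add, map_ofNat])
  rwa [Nat.card_eq_fintype_card, hm] at this

lemma two_mem_pow [FiniteDimensional ℚ k] {P : Ideal (𝓞 k)} (hP : P ∈ PO k 2) {n : ℕ} (hc : cc n ∈ k) :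
    ((2 : ℕ) : 𝓞 k) ∈ P ^ (2 ^ n) := by
  have nk : NumberField k := ⟨⟩
  have hp := hP.1
  have h2 : (2 : 𝓞 k) ∈ P := by exact_mod_cast hP.2.2
  obtain ⟨x, -, x0, hx⟩ := cc_seq hc
  rcases Nat.eq_zero_or_pos n with rfl | hn
  · simpa using h2
  have hxP : ∀ i ≤ n, x i ∈ P := by
    intro i
    induction i with
    | zero => intro _; rw [x0]; exact P.zero_mem
    | succ i ih =>
      intro hi
      refine hp.mem_of_pow_mem 2 ?_
      rw [hx i (by omega)]
      exact P.add_mem h2 (ih (by omega))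
  have key : ∀ i, i + 1 ≤ n → ∃ s r, s ∉ P ∧ s * 2 = x (i + 1) ^ 2 ^ (i + 1) * r := by
    intro i
    induction i with
    | zero =>
      intro hi
      refine ⟨1, 1, fun h => hp.ne_top ((Ideal.eq_top_iff_one P).2 h), ?_⟩
      rw [zero_add, pow_one, hx 0 (by omega), x0]; ring
    | succ i ih =>
      intro hi
      obtain ⟨s, r, hs, e⟩ := ih (by omega)
      set w := x (i + 1) with hw
      have e2 : x (i + 1 + 1) ^ 2 = 2 + w := hx (i + 1) (by omega)
      obtain ⟨m, hm⟩ : ∃ m, 2 ^ (i + 1) = (m + 1) + 1 := ⟨2 ^ (i + 1) - 2, by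
        have : 2 ≤ 2 ^ (i + 1) := by rw [pow_succ]; have := Nat.one_le_two_pow (n := i); omega
        omega⟩
      let s' := s + w ^ (m + 1) * r
      have hs' : s' ∉ P := by
        intro h
        apply hs
        have h9 : w ^ (m + 1) * r ∈ P := P.mul_mem_right _ (by
          rw [pow_succ]; exact P.mul_mem_left _ (hxP (i + 1) (by omega)))
        have := P.sub_mem h h9
        simpa [s'] using this
      have e3 : w * s' = s * x (i + 1 + 1) ^ 2 := by
        rw [e2]
        have : w ^ 2 ^ (i + 1) = w * w ^ (m + 1) := by rw [hm, pow_succ' w (m + 1)]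
        rw [this] at e
        simp only [s']
        linear_combination -e
      refine ⟨s' ^ 2 ^ (i + 1) * s, s ^ 2 ^ (i + 1) * r, ?_, ?_⟩
      · intro h
        rcases hp.mem_or_mem h with h | h
        · exact hs' (hp.mem_of_pow_mem _ h)
        · exact hs h
      · rw [mul_assoc, e, ← mul_assoc, ← mul_pow, mul_comm s' w, e3, mul_pow, ← pow_mul, pow_succ' 2 (i + 1)]
        ring
  obtain ⟨s, r, hs, e⟩ := key (n - 1) (by omega)
  rw [Nat.sub_add_cancel hn] at e
  have : s * 2 ∈ P ^ 2 ^ n := by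
    rw [e]
    exact Ideal.mul_mem_right _ _ (Ideal.pow_mem_pow (hxP n le_rfl) _)
  have := (Ideal.IsPrime.mul_mem_pow P this).resolve_left hs
  exact_mod_cast this

lemma card_ge_four {F : Type*} [Field F] [Finite F] (h2 : (2 : F) = 0) {θ : F} (h : θ ^ 2 + θ + 1 = 0) : 4 ≤ Nat.card F := by
  classical
  have : Fintype F := Fintype.ofFinite F
  have h0 : θ ≠ 0 := by rintro rfl; simp at h
  have h1 : θ ≠ 1 := by
    rintro rfl
    have : (1 : F) = 0 := by linear_combination h - h2
    exact one_ne_zero this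
  have h3 : θ + 1 ≠ 0 := by
    intro h3; apply h1; linear_combination h3 - h2
  have hcard : ({0, 1, θ, θ + 1} : Finset F).card = 4 := by
    rw [Finset.card_insert_of_notMem, Finset.card_insert_of_notMem, Finset.card_insert_of_notMem, Finset.card_singleton]
    · simp
    · simp [h1.symm, h0]
    · simp [h0.symm, h3.symm]
  rw [Nat.card_eq_fintype_card, ← hcard]
  exact Finset.card_le_univ _
end GB

open IntermediateField NumberField
namespace GB
set_option linter.unusedSectionVars false
open scoped nonZeroDivisors
variable {k K : IntermediateField ℚ ℂ} {δ : ℂ}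

lemma val_two (m a b : ℕ) (h : m = 2 ^ a * (2 * b + 1)) : padicValNat 2 m = a := by
  have : Fact (Nat.Prime 2) := ⟨Nat.prime_two⟩
  rw [h, padicValNat.mul (by positivity) (by omega), padicValNat.prime_pow,
    padicValNat.eq_zero_of_not_dvd (by omega), add_zero]

lemma card_PO_pm3 [FiniteDimensional ℚ k] {l : ℕ} (hl : l.Prime) (h8 : l % 8 = 3 ∨ l % 8 = 5) {n t : ℕ} (hc : cc n ∈ k)
    (hr : Module.finrank ℚ k ≤ t * 2 ^ n) : (PO k l).encard ≤ t := by
  have hv : padicValNat 2 (l + 1) + padicValNat 2 (l - 1) = 3 := by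
    rcases h8 with h8 | h8
    · rw [val_two (l + 1) 2 (l / 8) (by omega), val_two (l - 1) 1 ((l - 3) / 4) (by omega)]
    · rw [val_two (l + 1) 1 ((l - 1) / 4) (by omega), val_two (l - 1) 2 (l / 8) (by omega)]
  refine count hl.two_le 1 (2 ^ n) t ?_ ?_
  · intro P hP
    obtain ⟨f, hf, hcard, hd⟩ := residue_card hl (by omega) hP hc
    refine ⟨by simpa using hP.2.2, ?_⟩
    rw [hcard]
    exact Nat.pow_le_pow_right hl.pos (lte l f n 3 (by omega) hl.one_lt hf hv hd)
  · have := Nat.one_le_two_pow (n := n)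
    nlinarith

lemma card_PO_7 [FiniteDimensional ℚ k] {l : ℕ} (hl : l.Prime) (h8 : l % 16 = 7) {n : ℕ} (hc : cc (n + 1) ∈ k)
    (hr : Module.finrank ℚ k ≤ 2 ^ (n + 1)) : (PO k l).encard ≤ 2 := by
  have hv : padicValNat 2 (l + 1) + padicValNat 2 (l - 1) = 4 := by
    rw [val_two (l + 1) 3 (l / 16) (by omega), val_two (l - 1) 1 ((l - 3) / 4) (by omega)]
  refine count hl.two_le 1 (2 ^ n) 2 ?_ ?_
  · intro P hP
    obtain ⟨f, hf, hcard, hd⟩ := residue_card hl (by omega) hP hc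
    refine ⟨by simpa using hP.2.2, ?_⟩
    rw [hcard]
    exact Nat.pow_le_pow_right hl.pos (lte l f n 4 (by omega) hl.one_lt hf hv hd)
  · have := Nat.one_le_two_pow (n := n)
    rw [pow_succ] at hr
    nlinarith

lemma two_le_card_quot [FiniteDimensional ℚ k] {l : ℕ} {P : Ideal (𝓞 k)} (hP : P ∈ PO k l) : 2 ≤ Nat.card (𝓞 k ⧸ P) := by
  have nk : NumberField k := ⟨⟩
  have hm : P.IsMaximal := hP.1.isMaximal hP.2.1
  have hfin : Finite (𝓞 k ⧸ P) := Ideal.finiteQuotientOfFreeOfNeBot P hP.2.1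
  have : Nontrivial (𝓞 k ⧸ P) := Ideal.Quotient.nontrivial_iff.2 hP.1.ne_top
  exact Finite.one_lt_card

lemma card_PO_2 [FiniteDimensional ℚ k] {n : ℕ} (hc : cc n ∈ k)
    (hr : Module.finrank ℚ k ≤ 2 ^ n) : (PO k 2).encard ≤ 1 := by
  refine count le_rfl (2 ^ n) 1 1 ?_ ?_
  · intro P hP
    exact ⟨two_mem_pow hP hc, by rw [pow_one]; exact two_le_card_quot hP⟩
  · have := Nat.one_le_two_pow (n := n)
    omega

lemma half_int {p : ℕ} (hp : p % 4 = 1) {δ : ℂ} (hδ : δ ^ 2 = p) : IsIntegral ℤ ((1 + δ) / 2) := by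
  refine ⟨Polynomial.X ^ 2 - Polynomial.X - Polynomial.C ((p / 4 : ℕ) : ℤ), ?_, ?_⟩
  · monicity!
  · have h1 : (p : ℂ) = 4 * ((p / 4 : ℕ) : ℂ) + 1 := by
      have : p = 4 * (p / 4) + 1 := by omega
      exact_mod_cast this
    simp only [Polynomial.eval₂_sub, Polynomial.eval₂_pow, Polynomial.eval₂_X, Polynomial.eval₂_C]
    rw [h1] at hδ
    simp only [algebraMap_int_eq, eq_intCast, Int.cast_natCast]
    linear_combination hδ / 4

lemma coeO2 : (((((2 : ℕ) : 𝓞 k)) : k) : ℂ) = 2 := by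
  have h : (((2 : ℕ) : 𝓞 k)) = 1 + 1 := by norm_num
  have h1 : (((1 + 1 : 𝓞 k) : k) : ℂ) = 1 + 1 := rfl
  rw [h, h1]; norm_num

lemma coeHalf : ((1 / 2 : k) : ℂ) = 1 / 2 := by
  have h : (1 / 2 : k) = 1 / (1 + 1) := by norm_num
  have h1 : ((1 / (1 + 1) : k) : ℂ) = 1 / (1 + 1) := rfl
  rw [h, h1]; norm_num

lemma card_PO_2' [FiniteDimensional ℚ k] {n p : ℕ} (hp : p % 8 = 5) (hδ : δ ^ 2 = p) (hδk : δ ∈ k) (hc : cc n ∈ k)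
    (hr : Module.finrank ℚ k ≤ 2 ^ (n + 1)) : (PO k 2).encard ≤ 1 := by
  have nk : NumberField k := ⟨⟩
  refine count le_rfl (2 ^ n) 2 1 ?_ ?_
  · intro P hP
    refine ⟨two_mem_pow hP hc, ?_⟩
    have hm : P.IsMaximal := hP.1.isMaximal hP.2.1
    let _ : Field (𝓞 k ⧸ P) := Ideal.Quotient.field P
    have hfin : Finite (𝓞 k ⧸ P) := Ideal.finiteQuotientOfFreeOfNeBot P hP.2.1
    have h2k : (2 : ℂ) ∈ k := by exact_mod_cast k.natCast_mem 2
    obtain ⟨θ, hθ⟩ := mkO (k.div_mem (k.add_mem k.one_mem hδk) h2k) (half_int (by omega) hδ)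
    obtain ⟨y, hy⟩ : ∃ y : ℕ, p = 8 * y + 5 := ⟨p / 8, by omega⟩
    have e : θ ^ 2 + θ + 1 = ((2 : ℕ) : 𝓞 k) * (θ + y + 1) := by
      refine RingOfIntegers.ext (Subtype.ext ?_)
      have h1 : (((θ ^ 2 + θ + 1 : 𝓞 k) : k) : ℂ) = ((θ : k) : ℂ) ^ 2 + ((θ : k) : ℂ) + 1 := rfl
      have h2 : (((((2 : ℕ) : 𝓞 k) * (θ + y + 1) : 𝓞 k) : k) : ℂ) = 2 * (((θ : k) : ℂ) + y + 1) := by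
        have c2 := coeO2 (k := k)
        have e1 : (((((2 : ℕ) : 𝓞 k) * (θ + y + 1) : 𝓞 k) : k) : ℂ)
          = (((((2 : ℕ) : 𝓞 k)) : k) : ℂ) * ((((θ + y + 1 : 𝓞 k)) : k) : ℂ) := rfl
        rw [e1, c2]
        congr 1
      rw [h1, h2, hθ]
      rw [hy] at hδ
      push_cast at hδ
      linear_combination hδ / 4
    have e2 : θ ^ 2 + θ + 1 ∈ P := by rw [e]; exact P.mul_mem_right _ hP.2.2
    have e3 := Ideal.Quotient.eq_zero_iff_mem.2 e2
    have e4 := Ideal.Quotient.eq_zero_iff_mem.2 hP.2.2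
    exact card_ge_four (F := 𝓞 k ⧸ P) (θ := Ideal.Quotient.mk P θ) (by rw [map_natCast] at e4; exact_mod_cast e4) (by simpa using e3)
  · have := Nat.one_le_two_pow (n := n)
    rw [pow_succ] at hr
    omega

lemma ram_four {y : 𝓞 k} (hδ : IsIntegral ℤ δ) (hy : ((y : k) : ℂ) = δ ^ 2) {P : Ideal (𝓞 k)} (hP : P ∈ RamP k δ) :
    ((2 : ℕ) : 𝓞 k) ∈ P ∨ y ∈ P := by
  obtain ⟨hp, h0, h⟩ := hP
  have h1 := h 0 1 (by simpa using hδ) (((2 : ℕ) : 𝓞 k) * ((2 : ℕ) : 𝓞 k) * y) (by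
    have e1 : ((((((2 : ℕ) : 𝓞 k) * ((2 : ℕ) : 𝓞 k) * y : 𝓞 k)) : k) : ℂ)
          = (((((2 : ℕ) : 𝓞 k)) : k) : ℂ) * (((((2 : ℕ) : 𝓞 k)) : k) : ℂ) * ((y : k) : ℂ) := rfl
    have e2 : ((1 : k) : ℂ) = 1 := rfl
    rw [e1, coeO2, hy, e2]; ring)
  rcases hp.mem_or_mem h1 with h2 | h2
  · left
    rcases hp.mem_or_mem h2 with h3 | h3 <;> exact h3
  · right; exact h2

lemma ram_sqrt {m : ℕ} (hδ : δ ^ 2 = m) : RamP k δ ⊆ PO k 2 ∪ PO k m := by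
  intro P hP
  have hintg : IsIntegral ℤ δ := by
    refine IsIntegral.of_pow (n := 2) (by norm_num) ?_
    rw [hδ]
    exact_mod_cast isIntegral_algebraMap (R := ℤ) (A := ℂ) (x := m)
  rcases ram_four (y := (m : 𝓞 k)) hintg (by rw [hδ]; simp) hP with h | h
  · exact Or.inl ⟨hP.1, hP.2.1, h⟩
  · exact Or.inr ⟨hP.1, hP.2.1, h⟩

lemma ram_sqrt_1 {m : ℕ} (hδ : δ ^ 2 = m) (h4 : m % 4 = 1) : RamP k δ ⊆ PO k m := by
  intro P hP
  refine ⟨hP.1, hP.2.1, hP.2.2 (1 / 2) (1 / 2) ?_ (m : 𝓞 k) ?_⟩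
  · have := half_int h4 hδ
    convert this using 1
    rw [coeHalf]; ring
  · rw [hδ, coeHalf]
    have : (((m : 𝓞 k) : k) : ℂ) = m := by simp
    rw [this]; ring

lemma PO_mul (p q : ℕ) : PO k (p * q) ⊆ PO k p ∪ PO k q := by
  rintro P ⟨h1, h2, h3⟩
  rw [Nat.cast_mul] at h3
  rcases h1.mem_or_mem h3 with h | h
  · exact Or.inl ⟨h1, h2, h⟩
  · exact Or.inr ⟨h1, h2, h⟩

lemma ram_cc {n : ℕ} (hc : cc n ∈ k) : RamP k (cc (n + 1)) ⊆ PO k 2 := by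
  intro P hP
  refine ⟨hP.1, hP.2.1, ?_⟩
  obtain ⟨x, hx, x0, hxs⟩ := cc_seq hc
  rcases ram_four (y := 2 + x n) (cc_int (n + 1)) (by
    rw [cc_succ, ← hx n le_rfl]; rfl) hP with h | h
  · exact h
  · have hp := hP.1
    have key : ∀ i ≤ n, x (n - i) - 2 ∈ P ∨ x (n - i) + 2 ∈ P := by
      intro i
      induction i with
      | zero => intro _; right; rw [add_comm]; exact h
      | succ i ih =>
        intro hi
        have e := hxs (n - (i + 1)) (by omega)
        rw [show n - (i + 1) + 1 = n - i by omega] at e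
        left
        have : x (n - (i + 1)) - 2 = (x (n - i) - 2) * (x (n - i) + 2) := by
          linear_combination -e
        rw [this]
        rcases ih (by omega) with h | h
        · exact P.mul_mem_right _ h
        · exact P.mul_mem_left _ h
    rcases key n le_rfl with h1 | h1
    · rw [Nat.sub_self, x0, zero_sub, neg_mem_iff] at h1
      exact_mod_cast h1
    · rw [Nat.sub_self, x0, zero_add] at h1
      exact_mod_cast h1

lemma QE.finrank_le (h : QE k K δ) [FiniteDimensional ℚ k] : Module.finrank ℚ K ≤ 2 * Module.finrank ℚ k := by
  by_cases hn : δ ∈ k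
  · rw [h.eq_of_mem hn]; omega
  · obtain ⟨e, -⟩ := h.eqv hn
    rw [← e.finrank_eq, Module.finrank_prod]; omega

/-- all embeddings are real -/
def TR (k : IntermediateField ℚ ℂ) : Prop := ∀ (φ : k →+* ℂ) (x : k), starRingEnd ℂ (φ x) = φ x

lemma TR.tot [FiniteDimensional ℚ k] (h : TR k) : IsTotallyReal k := by
  refine ⟨fun w => ?_⟩
  rw [← InfinitePlace.mk_embedding w, InfinitePlace.isReal_mk_iff]
  exact RingHom.ext (fun x => h _ x)

lemma QE.TR (h : QE k K δ) (hk : TR k) (hδ : ∀ φ : K →+* ℂ, starRingEnd ℂ (φ ⟨δ, h.mem⟩) = φ ⟨δ, h.mem⟩) : TR K := by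
  intro φ z
  obtain ⟨a, ha, b, hb, e⟩ := h.rep z z.2
  have e2 : z = (⟨a, h.le ha⟩ : K) + ⟨b, h.le hb⟩ * ⟨δ, h.mem⟩ := Subtype.ext e
  let ι : k →+* K := (inclusion h.le : k →ₐ[ℚ] K)
  have h1 := hk (φ.comp ι) ⟨a, ha⟩
  have h2 := hk (φ.comp ι) ⟨b, hb⟩
  change starRingEnd ℂ (φ ⟨a, h.le ha⟩) = φ ⟨a, h.le ha⟩ at h1
  change starRingEnd ℂ (φ ⟨b, h.le hb⟩) = φ ⟨b, h.le hb⟩ at h2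
  rw [e2, map_add, map_mul, map_add, map_mul, h1, h2, hδ]

lemma sq_real {z : ℂ} {r : ℝ} (hr : 0 ≤ r) (h : z ^ 2 = r) : ∃ x : ℝ, z = x ∧ x ^ 2 = r := by
  have h1 : (z - Real.sqrt r) * (z + Real.sqrt r) = 0 := by
    have : ((Real.sqrt r : ℝ) : ℂ) ^ 2 = r := by
      rw [← Complex.ofReal_pow, Real.sq_sqrt hr]
    linear_combination h - this
  rcases mul_eq_zero.1 h1 with h2 | h2
  · exact ⟨Real.sqrt r, by linear_combination h2, Real.sq_sqrt hr⟩
  · exact ⟨-Real.sqrt r, by push_cast; linear_combination h2, by rw [neg_sq, Real.sq_sqrt hr]⟩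

lemma cc_real (φ : K →+* ℂ) (n : ℕ) (hc : cc n ∈ K) : ∃ r : ℝ, φ ⟨cc n, hc⟩ = r ∧ |r| ≤ 2 := by
  induction n with
  | zero =>
    refine ⟨0, ?_, by norm_num⟩
    have : (⟨cc 0, hc⟩ : K) = 0 := Subtype.ext cc_zero
    rw [this]; simp
  | succ n ih =>
    obtain ⟨r, hr, hr2⟩ := ih (cc_mem hc (by omega))
    rw [abs_le] at hr2
    have h1 : (φ ⟨cc (n + 1), hc⟩) ^ 2 = ((2 + r : ℝ) : ℂ) := by
      rw [← map_pow]
      have : (⟨cc (n + 1), hc⟩ : K) ^ 2 = 2 + ⟨cc n, cc_mem hc (by omega)⟩ := Subtype.ext (cc_succ n)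
      rw [this, map_add, hr, map_ofNat]; push_cast; rfl
    obtain ⟨x, hx, hx2⟩ := sq_real (by linarith) h1
    exact ⟨x, hx, abs_le_of_sq_le_sq (by nlinarith) (by norm_num)⟩

lemma QE.TR_sqrt (h : QE k K δ) (hk : GB.TR k) {m : ℕ} (hδ : δ ^ 2 = m) : GB.TR K := by
  refine h.TR hk fun φ => ?_
  have h1 : (φ ⟨δ, h.mem⟩) ^ 2 = ((m : ℝ) : ℂ) := by
    rw [← map_pow]
    have : (⟨δ, h.mem⟩ : K) ^ 2 = (m : K) := Subtype.ext hδ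
    rw [this, map_natCast]; simp
  obtain ⟨x, hx, -⟩ := sq_real (by positivity) h1
  rw [hx, Complex.conj_ofReal]

lemma QE.TR_cc {n : ℕ} (h : QE k K (cc n)) (hk : GB.TR k) : GB.TR K := by
  refine h.TR hk fun φ => ?_
  obtain ⟨x, hx, -⟩ := cc_real φ n h.mem
  rw [hx, Complex.conj_ofReal]

lemma TR_bot : TR ⊥ := by
  rintro φ ⟨x, hx⟩
  obtain ⟨r, rfl⟩ := IntermediateField.mem_bot.1 hx
  have : (⟨algebraMap ℚ ℂ r, hx⟩ : (⊥ : IntermediateField ℚ ℂ)) = (r : (⊥ : IntermediateField ℚ ℂ)) := Subtype.ext (by simp)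
  rw [this, map_ratCast]; simp
end GB

open IntermediateField NumberField
namespace GB
set_option linter.unusedSectionVars false
open scoped nonZeroDivisors
variable {k K : IntermediateField ℚ ℂ} {δ : ℂ}

lemma NF.mul {m u v : ℂ} (hm : m ∈ k) (hu : NF k m u) (hv : NF k m v) : NF k m (u * v) := by
  obtain ⟨a, ha, b, hb, rfl⟩ := hu
  obtain ⟨c, hc, d, hd, rfl⟩ := hv
  exact ⟨a * c + m * (b * d), k.add_mem (k.mul_mem ha hc) (k.mul_mem hm (k.mul_mem hb hd)),
    a * d + b * c, k.add_mem (k.mul_mem ha hd) (k.mul_mem hb hc), by ring⟩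

lemma QE.fd (h : QE k K δ) (hn : δ ∉ k) {m a b : ℂ} (hm : m ∈ k) (ha : a ∈ k) (hb : b ∈ k)
    (hz : NF K m (a + b * δ)) : NF K m (a - b * δ) ∧ NF k m (a ^ 2 - δ ^ 2 * b ^ 2) := by
  obtain ⟨x, hx, y, hy, e⟩ := hz
  obtain ⟨x1, hx1, x2, hx2, rfl⟩ := h.rep x hx
  obtain ⟨y1, hy1, y2, hy2, rfl⟩ := h.rep y hy
  have hs := h.sq
  have e0 : (a - (x1 ^ 2 + δ ^ 2 * x2 ^ 2 - m * (y1 ^ 2 + δ ^ 2 * y2 ^ 2)))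
      + (b - (2 * x1 * x2 - m * (2 * y1 * y2))) * δ = 0 := by linear_combination e
  have h2 : (2 : ℂ) ∈ k := by exact_mod_cast k.natCast_mem 2
  obtain ⟨e1, e2⟩ := QE.uniq hn (by
    refine k.sub_mem ha (k.sub_mem (k.add_mem (k.pow_mem hx1 2) (k.mul_mem hs (k.pow_mem hx2 2)))
      (k.mul_mem hm (k.add_mem (k.pow_mem hy1 2) (k.mul_mem hs (k.pow_mem hy2 2)))))) (by
    refine k.sub_mem hb (k.sub_mem (k.mul_mem (k.mul_mem h2 hx1) hx2)
      (k.mul_mem hm (k.mul_mem (k.mul_mem h2 hy1) hy2)))) e0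
  have ec : a - b * δ = (x1 - x2 * δ) ^ 2 - m * (y1 - y2 * δ) ^ 2 := by
    linear_combination e1 - e2 * δ
  refine ⟨⟨x1 - x2 * δ, K.sub_mem (h.le hx1) (K.mul_mem (h.le hx2) h.mem),
    y1 - y2 * δ, K.sub_mem (h.le hy1) (K.mul_mem (h.le hy2) h.mem), ec⟩, ?_⟩
  have key : a ^ 2 - δ ^ 2 * b ^ 2 = ((x1 ^ 2 - δ ^ 2 * x2 ^ 2) + m * (y1 ^ 2 - δ ^ 2 * y2 ^ 2)) ^ 2
      - m * (2 * (x1 * y1 - δ ^ 2 * (x2 * y2))) ^ 2 := by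
    have : a ^ 2 - δ ^ 2 * b ^ 2 = (a + b * δ) * (a - b * δ) := by ring
    rw [this, e, ec]
    ring
  refine ⟨_, ?_, _, ?_, key⟩
  · exact k.add_mem (k.sub_mem (k.pow_mem hx1 2) (k.mul_mem hs (k.pow_mem hx2 2)))
      (k.mul_mem hm (k.sub_mem (k.pow_mem hy1 2) (k.mul_mem hs (k.pow_mem hy2 2))))
  · exact k.mul_mem h2 (k.sub_mem (k.mul_mem hx1 hy1) (k.mul_mem hs (k.mul_mem hx2 hy2)))

lemma IsU.mul {u v : ℂ} (hu : IsU k u) (hv : IsU k v) : IsU k (u * v) :=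
  ⟨k.mul_mem hu.mem hv.mem, hu.int.mul hv.int, by rw [mul_inv]; exact hu.inv.mul hv.inv,
    mul_ne_zero hu.ne hv.ne⟩

lemma QE.conjU (h : QE k K δ) (hn : δ ∉ k) {a b : ℂ} (ha : a ∈ k) (hb : b ∈ k)
    (hz : IsU K (a + b * δ)) : IsU K (a - b * δ) := by
  obtain ⟨σ, hσ⟩ := h.sigma hn
  have hs : ((σ ⟨a + b * δ, hz.mem⟩ : K) : ℂ) = a - b * δ := hσ ⟨a, ha⟩ ⟨b, hb⟩ _ rfl
  have key : ∀ z : K, IsIntegral ℤ (z : ℂ) → IsIntegral ℤ ((σ z : K) : ℂ) := by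
    intro z hz
    have h1 : IsIntegral ℤ z := (isIntegral_algHom_iff (K.val.toRingHom.toIntAlgHom) K.val.injective).1 hz
    have h2 := h1.map (K.val.toRingHom.toIntAlgHom.comp σ.toIntAlgHom)
    exact h2
  refine ⟨by rw [← hs]; exact (σ _).2, by rw [← hs]; exact key _ hz.int, ?_, ?_⟩
  · rw [← hs]
    have : ((σ ⟨a + b * δ, hz.mem⟩ : K) : ℂ)⁻¹ = ((σ (⟨a + b * δ, hz.mem⟩ : K)⁻¹ : K) : ℂ) := by
      rw [map_inv₀]; rfl
    rw [this]
    exact key _ hz.inv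
  · rw [← hs]
    intro h0
    have h1 : σ ⟨a + b * δ, hz.mem⟩ = 0 := Subtype.ext h0
    have h2 := (map_eq_zero σ).1 h1
    exact hz.ne (congrArg Subtype.val h2)

/-- one non-norm unit -/
def N1 (k : IntermediateField ℚ ℂ) (m : ℂ) : Prop := ∃ u, IsU k u ∧ ¬ NF k m u
/-- two independent non-norm units -/
def N2 (k : IntermediateField ℚ ℂ) (m : ℂ) : Prop :=
  ∃ u v, IsU k u ∧ IsU k v ∧ ¬ NF k m u ∧ ¬ NF k m v ∧ ¬ NF k m (u * v)

lemma QE.N1 (h : QE k K δ) (ns : NS k K δ) {m : ℂ} (hm : m ∈ k) (hk : N1 k m) : N1 K m := by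
  by_cases hn : δ ∈ k
  · rw [h.eq_of_mem hn]; exact hk
  obtain ⟨u, hu, nu⟩ := hk
  obtain ⟨a, ha, b, hb, hU, e⟩ := ns u hu
  exact ⟨_, hU, fun hc => nu (e ▸ (h.fd hn hm ha hb hc).2)⟩

lemma QE.N2 (h : QE k K δ) (ns : NS k K δ) {m : ℂ} (hm : m ∈ k) (hk : N2 k m) : N2 K m := by
  by_cases hn : δ ∈ k
  · rw [h.eq_of_mem hn]; exact hk
  obtain ⟨u, v, hu, hv, nu, nv, nuv⟩ := hk
  obtain ⟨a, ha, b, hb, hU, e⟩ := ns u hu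
  obtain ⟨c, hc, d, hd, hV, e'⟩ := ns v hv
  refine ⟨_, _, hU, hV, fun hc => nu (e ▸ (h.fd hn hm ha hb hc).2),
    fun hx => nv (e' ▸ (h.fd hn hm hc hd hx).2), fun hx => nuv ?_⟩
  have e1 : (a + b * δ) * (c + d * δ) = (a * c + δ ^ 2 * (b * d)) + (a * d + b * c) * δ := by ring
  rw [e1] at hx
  have := (h.fd hn hm (k.add_mem (k.mul_mem ha hc) (k.mul_mem h.sq (k.mul_mem hb hd)))
    (k.add_mem (k.mul_mem ha hd) (k.mul_mem hb hc)) hx).2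
  convert this using 1
  rw [e, e']; ring

lemma noQl {q : ℕ} [Fact q.Prime] (hq : q % 4 = 3) (m : ℚ_[q]) (hm0 : m ≠ 0) (hm : Odd m.valuation)
    (x y : ℚ_[q]) : x ^ 2 - m * y ^ 2 ≠ -1 := by
  intro h
  have e : m * y ^ 2 = x ^ 2 + 1 := by linear_combination -h
  by_cases hx : ‖x‖ ≤ 1
  · have hlt : ‖x ^ 2 + 1‖ < 1 := by
      have hle : ‖x ^ 2 + 1‖ ≤ 1 := by
        refine (Padic.nonarchimedean _ _).trans (max_le ?_ (by simp))
        rw [norm_pow]; exact pow_le_one₀ (norm_nonneg _) hx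
      refine lt_of_le_of_ne hle ?_
      intro h1
      rw [← e] at h1
      by_cases hy : y = 0
      · rw [hy] at h1; simp at h1
      rw [Padic.norm_eq_zpow_neg_valuation (mul_ne_zero hm0 (pow_ne_zero 2 hy))] at h1
      have h2 := (zpow_eq_one_iff_right₀ (by positivity) (by exact_mod_cast (Fact.out : q.Prime).one_lt.ne')).1 h1
      rw [Padic.valuation_mul hm0 (pow_ne_zero 2 hy), Padic.valuation_pow] at h2
      obtain ⟨r, hr⟩ := hm
      push_cast at h2
      omega
    let X : ℤ_[q] := ⟨x, hx⟩
    have h1 : PadicInt.toZMod (X ^ 2 + 1) = 0 := by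
      rw [← RingHom.mem_ker, PadicInt.ker_toZMod, IsLocalRing.mem_maximalIdeal, PadicInt.mem_nonunits]
      exact hlt
    rw [map_add, map_pow, map_one] at h1
    exact ZMod.mod_four_ne_three_of_sq_eq_neg_one (eq_neg_of_add_eq_zero_left h1) hq
  · push Not at hx
    have hx0 : x ≠ 0 := by rintro rfl; simp at hx; linarith
    have h1 : ‖x ^ 2 + 1‖ = ‖x‖ ^ 2 := by
      rw [← norm_pow]
      have : ‖x ^ 2‖ ≠ ‖(1 : ℚ_[q])‖ := by
        rw [norm_pow, norm_one]; exact (one_lt_pow₀ hx (by norm_num)).ne'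
      rw [Padic.add_eq_max_of_ne this, norm_one, norm_pow]
      exact max_eq_left (one_lt_pow₀ hx (by norm_num)).le
    have hy : y ≠ 0 := by
      rintro rfl
      rw [← e] at h1; simp at h1; exact hx0 (norm_eq_zero.1 ((pow_eq_zero_iff two_ne_zero).1 h1.symm))
    rw [← e, ← norm_pow, Padic.norm_eq_zpow_neg_valuation (mul_ne_zero hm0 (pow_ne_zero 2 hy)),
      Padic.norm_eq_zpow_neg_valuation (pow_ne_zero 2 hx0)] at h1
    have h2 := zpow_right_injective₀ (by exact_mod_cast (Fact.out : q.Prime).pos)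
      (by exact_mod_cast (Fact.out : q.Prime).one_lt.ne') h1
    rw [Padic.valuation_mul hm0 (pow_ne_zero 2 hy), Padic.valuation_pow, Padic.valuation_pow] at h2
    obtain ⟨r, hr⟩ := hm
    push_cast at h2
    omega

lemma sqrt_Ql {q : ℕ} [Fact q.Prime] (hq : q ≠ 2) (m : ℕ) (hm : IsSquare (m : ZMod q)) (h0 : (m : ZMod q) ≠ 0) :
    ∃ s : ℚ_[q], s ^ 2 = m := by
  obtain ⟨r, hr⟩ := hm
  have hr0 : r ≠ 0 := by rintro rfl; simp at hr; exact h0 hr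
  obtain ⟨a, rfl⟩ := ZMod.natCast_zmod_surjective r
  have hmem : ∀ z : ℤ_[q], PadicInt.toZMod z = 0 ↔ ‖z‖ < 1 := by
    intro z
    rw [← RingHom.mem_ker, PadicInt.ker_toZMod, IsLocalRing.mem_maximalIdeal, PadicInt.mem_nonunits]
  let F : Polynomial ℤ_[q] := Polynomial.X ^ 2 - Polynomial.C (m : ℤ_[q])
  have h1 : ‖(F.aeval (a : ℤ_[q]))‖ < 1 := by
    rw [← hmem]; simp [F, hr]; ring
  have h2 : ‖(F.derivative.aeval (a : ℤ_[q]))‖ = 1 := by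
    refine le_antisymm (PadicInt.norm_le_one _) (not_lt.1 ?_)
    rw [← hmem]; simp [F]
    refine ⟨?_, hr0⟩
    intro h
    have h' : ((2 : ℕ) : ZMod q) = 0 := by exact_mod_cast h
    rw [ZMod.natCast_eq_zero_iff] at h'
    exact hq ((Nat.prime_dvd_prime_iff_eq Fact.out Nat.prime_two).1 h')
  obtain ⟨z, hz, -⟩ := hensels_lemma (F := F) (a := (a : ℤ_[q])) (by rw [h2]; simpa using h1)
  refine ⟨z, ?_⟩
  have hz2 : z ^ 2 = (m : ℤ_[q]) := by
    simp [F] at hz; linear_combination hz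
  have := congrArg (fun t : ℤ_[q] => (t : ℚ_[q])) hz2
  simpa using this

/-- minus one is not a norm from D(√q) when D = ℚ(t) embeds in ℚ_q -/
lemma not_NF {q : ℕ} [Fact q.Prime] (hq : q % 4 = 3) {D : IntermediateField ℚ ℂ} {t : ℂ} (h : QE ⊥ D t)
    (hn : t ∉ (⊥ : IntermediateField ℚ ℂ)) {m : ℕ} (ht : t ^ 2 = m) {s : ℚ_[q]} (hs : s ^ 2 = m) :
    ¬ NF D (q : ℂ) (-1) := by
  rintro ⟨x, hx, y, hy, e⟩
  obtain ⟨x1, hx1, x2, hx2, rfl⟩ := h.rep x hx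
  obtain ⟨y1, hy1, y2, hy2, rfl⟩ := h.rep y hy
  obtain ⟨a, rfl⟩ := IntermediateField.mem_bot.1 hx1
  obtain ⟨b, rfl⟩ := IntermediateField.mem_bot.1 hx2
  obtain ⟨c, rfl⟩ := IntermediateField.mem_bot.1 hy1
  obtain ⟨d, rfl⟩ := IntermediateField.mem_bot.1 hy2
  simp only [eq_ratCast] at e
  have e0 : ((a ^ 2 + m * b ^ 2 - q * (c ^ 2 + m * d ^ 2) + 1 : ℚ) : ℂ) + ((2 * a * b - q * (2 * c * d) : ℚ) : ℂ) * t = 0 := by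
    push_cast
    rw [← ht]; linear_combination -e
  obtain ⟨e1, e2⟩ := QE.uniq hn (IntermediateField.mem_bot.2 ⟨_, eq_ratCast _ _⟩)
    (IntermediateField.mem_bot.2 ⟨_, eq_ratCast _ _⟩) e0
  have e1' := Rat.cast_eq_zero.1 e1
  have e2' := Rat.cast_eq_zero.1 e2
  have f1 : ((a ^ 2 + m * b ^ 2 - q * (c ^ 2 + m * d ^ 2) + 1 : ℚ) : ℚ_[q]) = 0 := by rw [e1']; simp
  have f2 : ((2 * a * b - q * (2 * c * d) : ℚ) : ℚ_[q]) = 0 := by rw [e2']; simp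
  push_cast at f1 f2
  rw [← hs] at f1
  have hq0 : (q : ℚ_[q]) ≠ 0 := by exact_mod_cast (Fact.out : q.Prime).ne_zero
  refine noQl hq (q : ℚ_[q]) hq0 (by rw [Padic.valuation_p]; exact odd_one) (a + b * s) (c + d * s) ?_
  linear_combination f1 + s * f2

/-- base non-norm over ℚ -/
lemma not_NF_bot {p q : ℕ} [Fact q.Prime] (hq : q % 4 = 3) (hp : p.Prime) (hpq : p ≠ q) :
    ¬ NF ⊥ ((p * q : ℕ) : ℂ) (-1) := by
  rintro ⟨x, hx, y, hy, e⟩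
  obtain ⟨a, rfl⟩ := IntermediateField.mem_bot.1 hx
  obtain ⟨b, rfl⟩ := IntermediateField.mem_bot.1 hy
  simp only [eq_ratCast] at e
  have e1 : (-1 : ℚ) = a ^ 2 - (p * q : ℕ) * b ^ 2 := by exact_mod_cast e
  have e2 : ((-1 : ℚ) : ℚ_[q]) = ((a ^ 2 - (p * q : ℕ) * b ^ 2 : ℚ) : ℚ_[q]) := by rw [← e1]
  push_cast at e2
  have hq0 : (q : ℚ_[q]) ≠ 0 := by exact_mod_cast (Fact.out : q.Prime).ne_zero
  have hp0 : (p : ℚ_[q]) ≠ 0 := by exact_mod_cast hp.ne_zero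
  refine noQl hq (p * q : ℚ_[q]) (mul_ne_zero hp0 hq0) ?_ a b e2.symm
  rw [Padic.valuation_mul hp0 hq0, Padic.valuation_p, Padic.valuation_natCast,
    padicValNat.eq_zero_of_not_dvd (fun h => hpq ((Nat.prime_dvd_prime_iff_eq Fact.out hp).1 h).symm)]
  simp
end GB

open IntermediateField NumberField
namespace GB
set_option linter.unusedSectionVars false
open scoped nonZeroDivisors
variable {k K : IntermediateField ℚ ℂ} {δ : ℂ}

/-- cyclotomic tower over k -/
noncomputable def Tw (k : IntermediateField ℚ ℂ) : ℕ → IntermediateField ℚ ℂ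
  | 0 => k
  | n + 1 => Tw k n ⊔ ℚ⟮cc (n + 1)⟯

lemma Tw_cc (k : IntermediateField ℚ ℂ) (n : ℕ) : cc n ∈ Tw k n := by
  cases n with
  | zero => rw [cc_zero]; exact zero_mem _
  | succ n => exact (le_sup_right : _ ≤ Tw k n ⊔ ℚ⟮cc (n + 1)⟯) (mem_adjoin_simple_self ℚ _)

lemma Tw_QE (k : IntermediateField ℚ ℂ) (n : ℕ) : QE (Tw k n) (Tw k (n + 1)) (cc (n + 1)) := by
  refine QE.sup _ ?_
  rw [cc_succ]
  exact add_mem (by exact_mod_cast (Tw k n).natCast_mem 2) (Tw_cc k n)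

lemma Tw_le (k : IntermediateField ℚ ℂ) (n : ℕ) : k ≤ Tw k n := by
  induction n with
  | zero => exact le_rfl
  | succ n ih => exact ih.trans (Tw_QE k n).le

instance Tw_fin [FiniteDimensional ℚ k] (n : ℕ) : FiniteDimensional ℚ (Tw k n) := by
  induction n with
  | zero => assumption
  | succ n ih => exact (Tw_QE k n).finite

lemma Tw_rank [FiniteDimensional ℚ k] (n : ℕ) : Module.finrank ℚ (Tw k n) ≤ Module.finrank ℚ k * 2 ^ n := by
  induction n with
  | zero => rw [pow_zero, mul_one]; exact le_rfl
  | succ n ih =>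
    refine (Tw_QE k n).finrank_le.trans ?_
    rw [pow_succ]; linarith

lemma Tw_TR (h : TR k) (n : ℕ) : TR (Tw k n) := by
  induction n with
  | zero => exact h
  | succ n ih => exact (Tw_QE k n).TR_cc ih

lemma Tw_odd [FiniteDimensional ℚ k] (h : TR k) (h2 : T2 k ≤ 1) (hP : ∀ n, (PO (Tw k n) 2).encard ≤ 1) (n : ℕ) :
    T2 (Tw k n) ≤ 1 ∧ NS (Tw k n) (Tw k (n + 1)) (cc (n + 1)) := by
  have step : ∀ n, T2 (Tw k n) ≤ 1 →
      T2 (Tw k (n + 1)) ≤ 1 ∧ NS (Tw k n) (Tw k (n + 1)) (cc (n + 1)) := fun n hn =>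
    (Tw_QE k n).cor1 (cc_ne n) (Tw_TR h (n + 1)).tot hn
      ((Set.encard_le_encard (ram_cc (Tw_cc k n))).trans (hP n))
  have all : ∀ n, T2 (Tw k n) ≤ 1 := by
    intro n
    induction n with
    | zero => exact h2
    | succ n ih => exact (step n ih).1
  exact ⟨all n, (step n (all n)).2⟩

lemma Tw_N1 (ns : ∀ n, NS (Tw k n) (Tw k (n + 1)) (cc (n + 1))) {m : ℂ} (hm : m ∈ k) (h : N1 k m) (n : ℕ) :
    N1 (Tw k n) m := by
  induction n with
  | zero => exact h
  | succ n ih => exact (Tw_QE k n).N1 (ns n) (Tw_le k n hm) ih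

lemma Tw_N2 (ns : ∀ n, NS (Tw k n) (Tw k (n + 1)) (cc (n + 1))) {m : ℂ} (hm : m ∈ k) (h : N2 (Tw k 1) m) (n : ℕ) :
    N2 (Tw k (n + 1)) m := by
  induction n with
  | zero => exact h
  | succ n ih => exact (Tw_QE k (n + 1)).N2 (ns (n + 1)) (Tw_le k (n + 1) hm) ih

instance : FiniteDimensional ℚ (⊥ : IntermediateField ℚ ℂ) := by infer_instance

lemma T2_bot : T2 ⊥ ≤ 1 := by
  have : NumberField (⊥ : IntermediateField ℚ ℂ) := ⟨⟩
  let e : 𝓞 ℚ ≃+* 𝓞 (⊥ : IntermediateField ℚ ℂ) :=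
    RingOfIntegers.mapRingEquiv (IntermediateField.botEquiv ℚ ℂ).symm.toRingEquiv
  have h1 : IsPrincipalIdealRing (𝓞 (⊥ : IntermediateField ℚ ℂ)) :=
    IsPrincipalIdealRing.of_surjective (Rat.ringOfIntegersEquiv.symm.trans e).toRingHom
      (Rat.ringOfIntegersEquiv.symm.trans e).surjective
  refine T2_of_odd ?_
  have h2 := card_classGroup_eq_one (R := 𝓞 (⊥ : IntermediateField ℚ ℂ))
  have h3 := (@Nat.card_eq_fintype_card (ClassGroup (𝓞 (⊥ : IntermediateField ℚ ℂ)))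
    instFintypeClassGroupOfIsPrincipalIdealRing).trans h2
  rw [h3]
  exact odd_one

lemma bot_rank : Module.finrank ℚ (⊥ : IntermediateField ℚ ℂ) = 1 := IntermediateField.finrank_bot

lemma A_PO2 (n : ℕ) : (PO (Tw ⊥ n) 2).encard ≤ 1 :=
  card_PO_2 (Tw_cc _ n) (by have := Tw_rank (k := ⊥) n; rwa [bot_rank, one_mul] at this)

lemma A_rank (n : ℕ) : Module.finrank ℚ (Tw ⊥ n) ≤ 2 ^ n := by
  have := Tw_rank (k := ⊥) n; rwa [bot_rank, one_mul] at this

lemma A_odd (n : ℕ) : T2 (Tw ⊥ n) ≤ 1 ∧ NS (Tw ⊥ n) (Tw ⊥ (n + 1)) (cc (n + 1)) :=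
  Tw_odd TR_bot T2_bot A_PO2 n

/-- square root in ℂ -/
noncomputable def rt (m : ℕ) : ℂ := ((Real.sqrt m : ℝ) : ℂ)

lemma rt_sq (m : ℕ) : rt m ^ 2 = m := by
  rw [rt, ← Complex.ofReal_pow, Real.sq_sqrt (by positivity)]; simp

lemma nat_mem (k : IntermediateField ℚ ℂ) (m : ℕ) : (m : ℂ) ∈ k := k.natCast_mem m

lemma rt_mul (p q : ℕ) : rt (p * q) = rt p * rt q := by
  rw [rt, rt, rt, Nat.cast_mul, Real.sqrt_mul (by positivity)]; push_cast; rfl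

lemma QE_rt (k : IntermediateField ℚ ℂ) (m : ℕ) : QE k (k ⊔ ℚ⟮rt m⟯) (rt m) :=
  QE.sup _ (by rw [rt_sq]; exact nat_mem k m)

lemma cc_one_sq : cc 1 ^ 2 = 2 := by rw [cc_succ, cc_zero, add_zero]

lemma not_bot {t : ℂ} {m : ℕ} (ht : t ^ 2 = m) (hm : ¬ IsSquare m) : t ∉ (⊥ : IntermediateField ℚ ℂ) := by
  intro h
  obtain ⟨r, rfl⟩ := IntermediateField.mem_bot.1 h
  rw [eq_ratCast] at ht
  have h1 : r ^ 2 = (m : ℚ) := by exact_mod_cast ht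
  exact hm (Rat.isSquare_natCast_iff.1 ⟨r, by rw [← h1, sq]⟩)

/-- biquadratic independence -/
lemma not_quad {t s : ℂ} {m l : ℕ} {D : IntermediateField ℚ ℂ} (h : QE ⊥ D t) (ht : t ^ 2 = m) (hs : s ^ 2 = l)
    (hm : ¬ IsSquare m) (hl : ¬ IsSquare l) (hml : ¬ IsSquare (m * l)) : s ∉ D := by
  intro hsD
  obtain ⟨a, ha, b, hb, e⟩ := h.rep s hsD
  have h2 : (2 : ℂ) ∈ (⊥ : IntermediateField ℚ ℂ) := by exact_mod_cast nat_mem ⊥ 2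
  have e0 : (a ^ 2 + m * b ^ 2 - l) + (2 * a * b) * t = 0 := by
    rw [← hs, ← ht, e]; ring
  obtain ⟨e1, e2⟩ := QE.uniq (not_bot ht hm)
    (sub_mem (add_mem (pow_mem ha 2) (mul_mem (nat_mem _ m) (pow_mem hb 2))) (nat_mem _ l))
    (mul_mem (mul_mem h2 ha) hb) e0
  have h3 : a = 0 ∨ b = 0 := by simpa using e2
  rcases h3 with rfl | rfl
  · refine not_bot (t := m * b) (m := m * l) ?_ hml (mul_mem (nat_mem _ m) hb)
    push_cast; linear_combination m * e1
  · refine not_bot (t := a) (m := l) ?_ hl ha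
    linear_combination e1

lemma prime_nsq {p : ℕ} (hp : p.Prime) : ¬ IsSquare p := hp.prime.not_isSquare

lemma Lplus_eq (n d : ℕ) : IntermediateField.adjoin ℚ
    ({((2 * Real.cos (2 * Real.pi / 2 ^ (n + 2)) : ℝ) : ℂ)} ∪ {z : ℂ | z ^ 2 = (((d : ℕ) : ℤ) : ℂ)})
    = Tw ⊥ n ⊔ ℚ⟮rt d⟯ := by
  have hcc : ((2 * Real.cos (2 * Real.pi / 2 ^ (n + 2)) : ℝ) : ℂ) = cc n := rfl
  rw [hcc]
  apply le_antisymm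
  · rw [adjoin_le_iff]
    rintro z (hz | hz)
    · rw [Set.mem_singleton_iff] at hz
      rw [hz]
      exact (le_sup_left : Tw ⊥ n ≤ _) (Tw_cc _ n)
    · have h1 : (z - rt d) * (z + rt d) = 0 := by
        have := rt_sq d
        have hz' : z ^ 2 = (d : ℂ) := by simpa using hz
        linear_combination hz' - this
      have h2 : rt d ∈ Tw ⊥ n ⊔ ℚ⟮rt d⟯ := (QE_rt _ d).mem
      rcases mul_eq_zero.1 h1 with h | h
      · rw [sub_eq_zero.1 h]; exact h2
      · rw [eq_neg_of_add_eq_zero_left h]; exact neg_mem h2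
  · set L := adjoin ℚ ({cc n} ∪ {z : ℂ | z ^ 2 = (((d : ℕ) : ℤ) : ℂ)})
    have hc : cc n ∈ L := subset_adjoin _ _ (Or.inl rfl)
    refine sup_le ?_ ?_
    · have : ∀ i ≤ n, Tw ⊥ i ≤ L := by
        intro i
        induction i with
        | zero => intro _; exact bot_le
        | succ i ih =>
          intro hi
          refine sup_le (ih (by omega)) ?_
          rw [adjoin_simple_le_iff]
          exact cc_mem hc hi
      exact this n le_rfl
    · rw [adjoin_simple_le_iff]
      exact subset_adjoin _ _ (Or.inr (by simpa using rt_sq d))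

end GB

open IntermediateField NumberField
namespace GB
set_option linter.unusedSectionVars false
open scoped nonZeroDivisors
variable {k K : IntermediateField ℚ ℂ} {δ : ℂ}

lemma enc_add {α : Type*} {S A B : Set α} {a b c : ℕ} (h : S ⊆ A ∪ B) (ha : A.encard ≤ a) (hb : B.encard ≤ b)
    (hc : a + b ≤ c) : S.encard ≤ c := by
  refine (Set.encard_le_encard h).trans ((Set.encard_union_le _ _).trans ((add_le_add ha hb).trans ?_))
  exact_mod_cast hc

lemma base1 {p : ℕ} (hp : p.Prime) (h16 : p % 16 = 7) : N2 (Tw ⊥ 1) (p : ℂ) := by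
  have : Fact p.Prime := ⟨hp⟩
  have h2 := cc_one_sq
  have h2' : cc 1 ^ 2 = ((2 : ℕ) : ℂ) := by rw [h2]; norm_num
  have hp2 : p ≠ 2 := by rintro rfl; omega
  have hsq : IsSquare (((2 : ℕ) : ZMod p)) := by
    push_cast
    exact (ZMod.exists_sq_eq_two_iff hp2).2 (by omega)
  have h20 : ((2 : ℕ) : ZMod p) ≠ 0 := by
    rw [Ne, ZMod.natCast_eq_zero_iff]
    intro h
    exact hp2 ((Nat.prime_dvd_prime_iff_eq hp Nat.prime_two).1 h)
  obtain ⟨s, hs⟩ := sqrt_Ql hp2 2 hsq h20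
  have hn : cc 1 ∉ (⊥ : IntermediateField ℚ ℂ) := not_bot h2' (prime_nsq Nat.prime_two)
  have hq : QE ⊥ (Tw ⊥ 1) (cc 1) := Tw_QE ⊥ 0
  have hneg := not_NF (by omega) hq hn h2' hs
  have one_mem' : (1 : ℂ) ∈ (⊥ : IntermediateField ℚ ℂ) := one_mem _
  have pm : (p : ℂ) ∈ (⊥ : IntermediateField ℚ ℂ) := nat_mem _ p
  have prod : (1 + 1 * cc 1) * (1 - 1 * cc 1) = -1 := by linear_combination -h2
  have i1 : IsIntegral ℤ (1 + 1 * cc 1) := by rw [one_mul]; exact isIntegral_one.add (cc_int 1)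
  have i2 : IsIntegral ℤ (1 - 1 * cc 1) := by rw [one_mul]; exact isIntegral_one.sub (cc_int 1)
  have n1 : (1 + 1 * cc 1) ≠ 0 := fun h => by rw [h, zero_mul] at prod; norm_num at prod
  have n2 : (1 - 1 * cc 1) ≠ 0 := fun h => by rw [h, mul_zero] at prod; norm_num at prod
  have v1 : (1 + 1 * cc 1)⁻¹ = -(1 - 1 * cc 1) := by
    rw [inv_eq_iff_eq_inv, eq_comm, inv_eq_iff_eq_inv, eq_comm]
    exact inv_eq_of_mul_eq_one_right (by linear_combination -prod)
  have v2 : (1 - 1 * cc 1)⁻¹ = -(1 + 1 * cc 1) :=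
    inv_eq_of_mul_eq_one_right (by linear_combination -prod)
  have m1 : (1 + 1 * cc 1) ∈ Tw ⊥ 1 := by rw [one_mul]; exact add_mem (one_mem _) (Tw_cc _ 1)
  have m2 : (1 - 1 * cc 1) ∈ Tw ⊥ 1 := by rw [one_mul]; exact sub_mem (one_mem _) (Tw_cc _ 1)
  have f1 : ¬ NF (Tw ⊥ 1) p (1 + 1 * cc 1) := by
    intro h
    have h' := (hq.fd hn pm one_mem' one_mem' h).1
    exact hneg (prod ▸ h.mul (Tw_le _ 1 pm) h')
  have f2 : ¬ NF (Tw ⊥ 1) p (1 - 1 * cc 1) := by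
    intro h
    have e : (1 - 1 * cc 1) = 1 + (-1) * cc 1 := by ring
    rw [e] at h
    have h' := (hq.fd hn pm one_mem' (neg_mem one_mem') h).1
    have e' : 1 - (-1) * cc 1 = 1 + 1 * cc 1 := by ring
    rw [e'] at h'
    exact f1 h'
  exact ⟨_, _, ⟨m1, i1, by rw [v1]; exact i2.neg, n1⟩, ⟨m2, i2, by rw [v2]; exact i1.neg, n2⟩, f1, f2,
    by rw [prod]; exact hneg⟩

lemma case1 {p : ℕ} (hp : p.Prime) (h16 : p % 16 = 7) (n : ℕ) : T2 (Tw ⊥ (n + 1) ⊔ ℚ⟮rt p⟯) ≤ 1 := by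
  have hq := QE_rt (Tw ⊥ (n + 1)) p
  have := hq.finite
  refine hq.cor3 (hq.TR_sqrt (Tw_TR TR_bot _) (rt_sq p)).tot (A_odd _).1 ?_ ?_
  · exact enc_add (a := 1) (b := 2) (c := 3) (ram_sqrt (rt_sq p)) (by exact_mod_cast A_PO2 _)
      (card_PO_7 hp h16 (Tw_cc _ _) (A_rank _)) (by norm_num)
  · rw [rt_sq]
    exact Tw_N2 (fun n => (A_odd n).2) (nat_mem _ p) (base1 hp h16) n

section case2
variable {p q : ℕ}

/-- the quadratic field -/
noncomputable def B0 (p : ℕ) : IntermediateField ℚ ℂ := ⊥ ⊔ ℚ⟮rt p⟯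

lemma B0_QE (p : ℕ) : QE ⊥ (B0 p) (rt p) := QE_rt ⊥ p

instance B0_fin (p : ℕ) : FiniteDimensional ℚ (B0 p) := (B0_QE p).finite

lemma B0_TR (p : ℕ) : TR (B0 p) := (B0_QE p).TR_sqrt TR_bot (rt_sq p)

lemma rt_ne (hp : p.Prime) : rt p ≠ 0 := by
  intro h
  have := rt_sq p
  rw [h] at this
  have h0 : (p : ℂ) ≠ 0 := by exact_mod_cast hp.ne_zero
  apply h0; rw [← this]; norm_num

lemma B0_odd (hp : p.Prime) (h8 : p % 8 = 5) : T2 (B0 p) ≤ 1 ∧ NS ⊥ (B0 p) (rt p) := by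
  refine (B0_QE p).cor1 (rt_ne hp) (B0_TR p).tot T2_bot ?_
  refine (Set.encard_le_encard (ram_sqrt_1 (rt_sq p) (by omega))).trans ?_
  have := card_PO_pm3 (k := ⊥) hp (Or.inr h8) (n := 0) (t := 1) (by rw [cc_zero]; exact zero_mem _)
    (by rw [bot_rank]; norm_num)
  exact_mod_cast this

lemma B_rank (p n : ℕ) : Module.finrank ℚ (Tw (B0 p) n) ≤ 2 ^ (n + 1) := by
  refine (Tw_rank n).trans ?_
  have := (B0_QE p).finrank_le
  rw [bot_rank] at this
  rw [pow_succ, mul_comm]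
  exact Nat.mul_le_mul le_rfl this

lemma B_rt (p n : ℕ) : rt p ∈ Tw (B0 p) n := Tw_le _ n (B0_QE p).mem

lemma B_PO2 (h8 : p % 8 = 5) (n : ℕ) : (PO (Tw (B0 p) n) 2).encard ≤ 1 :=
  card_PO_2' h8 (rt_sq p) (B_rt p n) (Tw_cc _ n) (B_rank p n)

lemma B_odd (hp : p.Prime) (h8 : p % 8 = 5) (n : ℕ) :
    T2 (Tw (B0 p) n) ≤ 1 ∧ NS (Tw (B0 p) n) (Tw (B0 p) (n + 1)) (cc (n + 1)) :=
  Tw_odd (B0_TR p) (B0_odd hp h8).1 (B_PO2 h8) n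

lemma QE.of_le (hk : k ≤ K) (hm : δ ∈ K) (hs : δ ^ 2 ∈ k) (hle : K ≤ k ⊔ ℚ⟮δ⟯) : QE k K δ := by
  have : K = k ⊔ ℚ⟮δ⟯ := le_antisymm hle (sup_le hk (adjoin_simple_le_iff.2 hm))
  rw [this]; exact QE.sup k hs

lemma B1_le {M : IntermediateField ℚ ℂ} (h1 : cc 1 ∈ M) (h2 : rt p ∈ M) : Tw (B0 p) 1 ≤ M := by
  refine sup_le (sup_le bot_le (adjoin_simple_le_iff.2 h2)) (adjoin_simple_le_iff.2 h1)

lemma A1_QE (p : ℕ) : QE (Tw ⊥ 1) (Tw (B0 p) 1) (rt p) := by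
  refine QE.of_le ?_ (B_rt p 1) (by rw [rt_sq]; exact nat_mem _ p) (B1_le ?_ ?_)
  · exact sup_le bot_le (adjoin_simple_le_iff.2 (Tw_cc _ 1))
  · exact (le_sup_left : Tw ⊥ 1 ≤ _) (Tw_cc _ 1)
  · exact (le_sup_right : ℚ⟮rt p⟯ ≤ _) (mem_adjoin_simple_self ℚ _)

lemma two_mem (k : IntermediateField ℚ ℂ) : (2 : ℂ) ∈ k := by exact_mod_cast nat_mem k 2

lemma N2_core {D B1 A1 : IntermediateField ℚ ℂ} {t : ℂ} (hDB : QE D B1 (cc 1)) (hn : cc 1 ∉ D)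
    (hneg : ¬ NF D (q : ℂ) (-1)) (hD : QE ⊥ D t) (ht : t ∉ (⊥ : IntermediateField ℚ ℂ))
    (hA : QE A1 B1 (rt p)) (hnA : rt p ∉ A1) (hcA : cc 1 ∈ A1) {c1 c2 d1 d2 x1 x2 y1 y2 : ℂ}
    (hc1 : c1 ∈ (⊥ : IntermediateField ℚ ℂ)) (hc2 : c2 ∈ (⊥ : IntermediateField ℚ ℂ))
    (hd1 : d1 ∈ (⊥ : IntermediateField ℚ ℂ)) (hd2 : d2 ∈ (⊥ : IntermediateField ℚ ℂ))
    (hx1 : x1 ∈ (⊥ : IntermediateField ℚ ℂ)) (hx2 : x2 ∈ (⊥ : IntermediateField ℚ ℂ))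
    (hy1 : y1 ∈ (⊥ : IntermediateField ℚ ℂ)) (hy2 : y2 ∈ (⊥ : IntermediateField ℚ ℂ))
    (hU : IsU B1 ((c1 + d1 * cc 1) + (c2 + d2 * cc 1) * rt p))
    (hN : (c1 ^ 2 + p * c2 ^ 2 - 2 * d1 ^ 2 - 2 * p * d2 ^ 2) ^ 2 - p * (2 * c1 * c2 - 4 * d1 * d2) ^ 2 = -1)
    (he : (c1 + d1 * cc 1) + (c2 + d2 * cc 1) * rt p = (x1 + x2 * t) + (y1 + y2 * t) * cc 1)
    (hN' : (x1 ^ 2 + t ^ 2 * x2 ^ 2 - 2 * y1 ^ 2 - 2 * t ^ 2 * y2 ^ 2) ^ 2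
      - t ^ 2 * (2 * x1 * x2 - 4 * y1 * y2) ^ 2 = -1) : N2 B1 (q : ℂ) := by
  have h2 := cc_one_sq
  have bD := hD.le
  have bA : (⊥ : IntermediateField ℚ ℂ) ≤ A1 := bot_le
  have a1 : c1 + d1 * cc 1 ∈ A1 := add_mem (bA hc1) (mul_mem (bA hd1) hcA)
  have a2 : c2 + d2 * cc 1 ∈ A1 := add_mem (bA hc2) (mul_mem (bA hd2) hcA)
  have f1 : ¬ NF B1 (q : ℂ) ((c1 + d1 * cc 1) + (c2 + d2 * cc 1) * rt p) := by
    intro h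
    rw [he] at h
    have h1 := (hDB.fd hn (nat_mem _ q) (add_mem (bD hx1) (mul_mem (bD hx2) hD.mem))
      (add_mem (bD hy1) (mul_mem (bD hy2) hD.mem)) h).2
    have e : (x1 + x2 * t) ^ 2 - cc 1 ^ 2 * (y1 + y2 * t) ^ 2
      = (x1 ^ 2 + t ^ 2 * x2 ^ 2 - 2 * y1 ^ 2 - 2 * t ^ 2 * y2 ^ 2) + (2 * x1 * x2 - 4 * y1 * y2) * t := by
      rw [h2]; ring
    rw [e] at h1
    have t2 := hD.sq
    have b2 := two_mem ⊥
    have b4 : (4 : ℂ) ∈ (⊥ : IntermediateField ℚ ℂ) := by exact_mod_cast nat_mem ⊥ 4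
    have h3 := (hD.fd ht (nat_mem _ q)
      (sub_mem (sub_mem (add_mem (pow_mem hx1 2) (mul_mem t2 (pow_mem hx2 2))) (mul_mem b2 (pow_mem hy1 2)))
        (mul_mem (mul_mem b2 t2) (pow_mem hy2 2)))
      (sub_mem (mul_mem (mul_mem b2 hx1) hx2) (mul_mem (mul_mem b4 hy1) hy2)) h1).1
    have h4 := h1.mul (nat_mem _ q) h3
    apply hneg
    convert h4 using 1
    linear_combination -hN'
  have f2 : ¬ NF B1 (q : ℂ) ((c1 + d1 * cc 1) - (c2 + d2 * cc 1) * rt p) := by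
    intro h
    rw [sub_eq_add_neg, ← neg_mul] at h
    have h1 := (hA.fd hnA (nat_mem _ q) a1 (neg_mem a2) h).1
    rw [neg_mul, sub_neg_eq_add] at h1
    exact f1 h1
  refine ⟨_, _, hU, hA.conjU hnA a1 a2 hU, f1, f2, ?_⟩
  intro h
  have e : ((c1 + d1 * cc 1) + (c2 + d2 * cc 1) * rt p) * ((c1 + d1 * cc 1) - (c2 + d2 * cc 1) * rt p)
    = (c1 ^ 2 + 2 * d1 ^ 2 - p * c2 ^ 2 - p * (2 * d2 ^ 2)) + (2 * (c1 * d1) - p * (2 * (c2 * d2))) * cc 1 := by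
    have hr := rt_sq p
    linear_combination (d1 ^ 2 - p * d2 ^ 2) * h2 - (c2 + d2 * cc 1) ^ 2 * hr
  rw [e] at h
  have b2 := two_mem ⊥
  have bp := nat_mem ⊥ p
  have h3 := (hDB.fd hn (nat_mem _ q)
    (bD (sub_mem (sub_mem (add_mem (pow_mem hc1 2) (mul_mem b2 (pow_mem hd1 2))) (mul_mem bp (pow_mem hc2 2)))
      (mul_mem bp (mul_mem b2 (pow_mem hd2 2)))))
    (bD (sub_mem (mul_mem b2 (mul_mem hc1 hd1)) (mul_mem bp (mul_mem b2 (mul_mem hc2 hd2))))) h).2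
  apply hneg
  convert h3 using 1
  rw [h2]
  linear_combination -hN

lemma sq_dich (hp : p.Prime) (hq : q.Prime) (hpq : p ≠ q) (h3 : q % 8 = 3) :
    (IsSquare (p : ZMod q) ∨ IsSquare ((2 * p : ℕ) : ZMod q)) ∧ (p : ZMod q) ≠ 0 ∧ ((2 * p : ℕ) : ZMod q) ≠ 0 := by
  have : Fact q.Prime := ⟨hq⟩
  have hq2 : q ≠ 2 := by rintro rfl; omega
  have hp0 : (p : ZMod q) ≠ 0 := by
    rw [Ne, ZMod.natCast_eq_zero_iff]
    intro h
    exact hpq ((Nat.prime_dvd_prime_iff_eq hq hp).1 h).symm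
  have h20 : (2 : ZMod q) ≠ 0 := by
    have : ((2 : ℕ) : ZMod q) ≠ 0 := by
      rw [Ne, ZMod.natCast_eq_zero_iff]
      intro h
      exact hq2 ((Nat.prime_dvd_prime_iff_eq hq Nat.prime_two).1 h)
    exact_mod_cast this
  have n2 : ¬ IsSquare (2 : ZMod q) := by
    rw [ZMod.exists_sq_eq_two_iff hq2]; omega
  refine ⟨?_, hp0, by push_cast; exact mul_ne_zero h20 hp0⟩
  by_cases h : IsSquare (p : ZMod q)
  · exact Or.inl h
  · right
    have hc : ringChar (ZMod q) ≠ 2 := by rw [ZMod.ringChar_zmod_n]; exact hq2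
    have e1 := (quadraticChar_neg_one_iff_not_isSquare (F := ZMod q)).2 h
    have e2 := (quadraticChar_neg_one_iff_not_isSquare (F := ZMod q)).2 n2
    have hne : (2 * p : ZMod q) ≠ 0 := mul_ne_zero h20 hp0
    push_cast
    rw [← quadraticChar_one_iff_isSquare hne, map_mul, e1, e2]; norm_num

lemma nsq4 (hp : p.Prime) : ¬ IsSquare (2 * p * 2) := by
  rintro ⟨r, hr⟩
  have h1 : Even (r * r) := ⟨2 * p, by rw [← hr]; ring⟩
  rw [Nat.even_mul, or_self] at h1
  obtain ⟨s, rfl⟩ := h1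
  refine prime_nsq hp ⟨s, ?_⟩
  nlinarith

lemma nsq2p (hp : p.Prime) (h2 : p ≠ 2) : ¬ IsSquare (2 * p) := by
  rintro ⟨r, hr⟩
  have h1 : Even (r * r) := ⟨p, by rw [← hr]; ring⟩
  rw [Nat.even_mul, or_self] at h1
  obtain ⟨s, rfl⟩ := h1
  have : p = 2 * (s * s) := by nlinarith
  have h3 : 2 ∣ p := ⟨_, this⟩
  exact h2 ((Nat.prime_dvd_prime_iff_eq Nat.prime_two hp).1 h3).symm

lemma IsU_neg_one (k : IntermediateField ℚ ℂ) : IsU k (-1) :=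
  ⟨neg_mem (one_mem _), isIntegral_one.neg, by rw [inv_neg, inv_one]; exact isIntegral_one.neg, by norm_num⟩

lemma base2 (hp : p.Prime) (hq : q.Prime) (h5 : p % 8 = 5) (h3 : q % 8 = 3) : N2 (Tw (B0 p) 1) (q : ℂ) := by
  have : Fact q.Prime := ⟨hq⟩
  have hpq : p ≠ q := by rintro rfl; omega
  have hp2 : p ≠ 2 := by rintro rfl; omega
  have hq2 : q ≠ 2 := by rintro rfl; omega
  obtain ⟨dich, hp0, h2p0⟩ := sq_dich hp hq hpq h3
  have h2 := cc_one_sq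
  have h2' : cc 1 ^ 2 = ((2 : ℕ) : ℂ) := by rw [h2]; norm_num
  have hr := rt_sq p
  obtain ⟨a, ha, b, hb, hU0, e0⟩ := (B0_odd hp h5).2 (-1) (IsU_neg_one _)
  obtain ⟨c, hc, d, hd, hU, e1⟩ := (B_odd hp h5 0).2 _ hU0
  obtain ⟨c1, hc1, c2, hc2, rfl⟩ := (B0_QE p).rep c hc
  obtain ⟨d1, hd1, d2, hd2, rfl⟩ := (B0_QE p).rep d hd
  rw [zero_add] at hU e1
  rw [h2] at e1
  rw [hr] at e0
  have hnp : rt p ∉ (⊥ : IntermediateField ℚ ℂ) := not_bot hr (prime_nsq hp)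
  have b2 := two_mem ⊥
  have bp := nat_mem ⊥ p
  have b4 : (4 : ℂ) ∈ (⊥ : IntermediateField ℚ ℂ) := by exact_mod_cast nat_mem ⊥ 4
  have e2 : (a - (c1 ^ 2 + p * c2 ^ 2 - 2 * d1 ^ 2 - 2 * p * d2 ^ 2))
      + (b - (2 * c1 * c2 - 4 * d1 * d2)) * rt p = 0 := by
    linear_combination e1 + (c2 ^ 2 - 2 * d2 ^ 2) * hr
  obtain ⟨ea, eb⟩ := QE.uniq hnp
    (sub_mem ha (sub_mem (sub_mem (add_mem (pow_mem hc1 2) (mul_mem bp (pow_mem hc2 2))) (mul_mem b2 (pow_mem hd1 2)))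
      (mul_mem (mul_mem b2 bp) (pow_mem hd2 2))))
    (sub_mem hb (sub_mem (mul_mem (mul_mem b2 hc1) hc2) (mul_mem (mul_mem b4 hd1) hd2))) e2
  have hN : (c1 ^ 2 + p * c2 ^ 2 - 2 * d1 ^ 2 - 2 * p * d2 ^ 2) ^ 2 - p * (2 * c1 * c2 - 4 * d1 * d2) ^ 2 = -1 := by
    rw [← sub_eq_zero.1 ea, ← sub_eq_zero.1 eb]; exact e0.symm
  have eU : c1 + c2 * rt p + (d1 + d2 * rt p) * cc 1 = (c1 + d1 * cc 1) + (c2 + d2 * cc 1) * rt p := by ring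
  have hU' : IsU (Tw (B0 p) 1) ((c1 + d1 * cc 1) + (c2 + d2 * cc 1) * rt p) := by rw [← eU]; exact hU
  have hnA : rt p ∉ Tw ⊥ 1 := not_quad (Tw_QE ⊥ 0) h2' hr (prime_nsq Nat.prime_two) (prime_nsq hp) (nsq2p hp hp2)
  rcases dich with hs | hs
  · obtain ⟨s, hs⟩ := sqrt_Ql hq2 p hs hp0
    refine N2_core (t := rt p) (Tw_QE (B0 p) 0) ?_ (not_NF (by omega) (B0_QE p) hnp hr hs) (B0_QE p) hnp
      (A1_QE p) hnA (Tw_cc _ 1) hc1 hc2 hd1 hd2 hc1 hc2 hd1 hd2 hU' hN eU.symm (by rw [hr]; exact hN)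
    refine not_quad (B0_QE p) hr h2' (prime_nsq hp) (prime_nsq Nat.prime_two) ?_
    rw [mul_comm]; exact nsq2p hp hp2
  · obtain ⟨s, hs⟩ := sqrt_Ql hq2 (2 * p) hs h2p0
    have ht : (cc 1 * rt p) ^ 2 = ((2 * p : ℕ) : ℂ) := by rw [mul_pow, h2, hr]; push_cast; ring
    have htn := not_bot ht (nsq2p hp hp2)
    have hD : QE ⊥ (⊥ ⊔ ℚ⟮cc 1 * rt p⟯) (cc 1 * rt p) := QE.sup _ (by rw [ht]; exact nat_mem _ _)
    have hDB : QE (⊥ ⊔ ℚ⟮cc 1 * rt p⟯) (Tw (B0 p) 1) (cc 1) := by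
      refine QE.of_le ?_ (Tw_cc _ 1) (by rw [h2]; exact two_mem _) (B1_le ?_ ?_)
      · exact sup_le bot_le (adjoin_simple_le_iff.2 (mul_mem (Tw_cc _ 1) (B_rt p 1)))
      · exact (le_sup_right : ℚ⟮cc 1⟯ ≤ _) (mem_adjoin_simple_self ℚ _)
      · have m1 : cc 1 ∈ (⊥ ⊔ ℚ⟮cc 1 * rt p⟯) ⊔ ℚ⟮cc 1⟯ :=
          (le_sup_right : ℚ⟮cc 1⟯ ≤ _) (mem_adjoin_simple_self ℚ _)
        have m2 : cc 1 * rt p ∈ (⊥ ⊔ ℚ⟮cc 1 * rt p⟯) ⊔ ℚ⟮cc 1⟯ :=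
          (le_sup_left : (⊥ ⊔ ℚ⟮cc 1 * rt p⟯) ≤ _) hD.mem
        have : rt p = cc 1 * rt p / cc 1 := by field_simp [cc_ne 0]
        have h3 := div_mem m2 m1
        rwa [← this] at h3
    refine N2_core (t := cc 1 * rt p) hDB ?_ (not_NF (by omega) hD htn ht hs) hD htn
      (A1_QE p) hnA (Tw_cc _ 1) hc1 hc2 hd1 hd2 hc1 hd2 hd1 (div_mem hc2 b2) hU' hN ?_ ?_
    · exact not_quad hD ht h2' (nsq2p hp hp2) (prime_nsq Nat.prime_two) (nsq4 hp)
    · linear_combination -(c2 / 2 * rt p) * h2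
    · rw [ht]; push_cast
      linear_combination hN

lemma F_odd (hp : p.Prime) (hq : q.Prime) (h5 : p % 8 = 5) (h3 : q % 8 = 3) (n : ℕ) :
    T2 (Tw (B0 p) (n + 1) ⊔ ℚ⟮rt q⟯) ≤ 1 := by
  have hQ := QE_rt (Tw (B0 p) (n + 1)) q
  have := hQ.finite
  refine hQ.cor3 (hQ.TR_sqrt (Tw_TR (B0_TR p) _) (rt_sq q)).tot (B_odd hp h5 _).1 ?_ ?_
  · exact enc_add (a := 1) (b := 2) (c := 3) (ram_sqrt (rt_sq q)) (by exact_mod_cast B_PO2 h5 _)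
      (card_PO_pm3 hq (Or.inl h3) (Tw_cc _ _) (by rw [← pow_succ']; exact B_rank p (n + 1))) (by norm_num)
  · rw [rt_sq]
    exact Tw_N2 (fun n => (B_odd hp h5 n).2) (nat_mem _ q) (base2 hp hq h5 h3) n

lemma C_two (hp : p.Prime) (hq : q.Prime) (h5 : p % 8 = 5) (h3 : q % 8 = 3) (n : ℕ) :
    T2 (Tw ⊥ n ⊔ ℚ⟮rt (p * q)⟯) ≤ 2 := by
  have : Fact q.Prime := ⟨hq⟩
  have hpq : p ≠ q := by rintro rfl; omega
  have hQ := QE_rt (Tw ⊥ n) (p * q)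
  have := hQ.finite
  refine hQ.cor2 (hQ.TR_sqrt (Tw_TR TR_bot _) (rt_sq _)).tot (A_odd _).1 ?_ ?_
  · have hr : Module.finrank ℚ (Tw ⊥ n) ≤ 1 * 2 ^ n := by rw [one_mul]; exact A_rank n
    have h1 : (PO (Tw ⊥ n) (p * q)).encard ≤ (2 : ℕ) :=
      enc_add (a := 1) (b := 1) (PO_mul p q) (card_PO_pm3 hp (Or.inr h5) (Tw_cc _ _) hr)
        (card_PO_pm3 hq (Or.inl h3) (Tw_cc _ _) hr) le_rfl
    exact enc_add (a := 1) (b := 2) (c := 3) (ram_sqrt (rt_sq _)) (by exact_mod_cast A_PO2 _) h1 (by norm_num)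
  · rw [rt_sq]
    exact Tw_N1 (fun n => (A_odd n).2) (nat_mem _ _) ⟨-1, IsU_neg_one _, not_NF_bot (by omega) hp hpq⟩ n

lemma CF_QE (hq : q.Prime) (n : ℕ) :
    QE (Tw ⊥ n ⊔ ℚ⟮rt (p * q)⟯) (Tw (B0 p) n ⊔ ℚ⟮rt q⟯) (rt q) := by
  set F := Tw (B0 p) n ⊔ ℚ⟮rt q⟯ with hF
  have leF : Tw (B0 p) n ≤ F := le_sup_left
  have qF : rt q ∈ F := (QE_rt _ q).mem
  have pF : rt p ∈ F := leF (B_rt p n)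
  have cF : cc n ∈ F := leF (Tw_cc _ n)
  have tw : ∀ {k M : IntermediateField ℚ ℂ}, k ≤ M → cc n ∈ M → Tw k n ≤ M := by
    intro k M hk hc
    have : ∀ i ≤ n, Tw k i ≤ M := by
      intro i
      induction i with
      | zero => intro _; exact hk
      | succ i ih =>
        intro hi
        exact sup_le (ih (by omega)) (adjoin_simple_le_iff.2 (cc_mem hc hi))
    exact this n le_rfl
  refine QE.of_le ?_ qF (by rw [rt_sq]; exact nat_mem _ q) ?_
  · refine sup_le (tw bot_le cF) (adjoin_simple_le_iff.2 ?_)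
    rw [rt_mul]; exact mul_mem pF qF
  · set M := (Tw ⊥ n ⊔ ℚ⟮rt (p * q)⟯) ⊔ ℚ⟮rt q⟯
    have hle : Tw ⊥ n ⊔ ℚ⟮rt (p * q)⟯ ≤ M := le_sup_left
    have qM : rt q ∈ M := (QE_rt _ q).mem
    have pqM : rt (p * q) ∈ M := hle (QE_rt _ _).mem
    have cM : cc n ∈ M := hle ((QE_rt (Tw ⊥ n) (p * q)).le (Tw_cc _ n))
    have pM : rt p ∈ M := by
      have : rt p = rt (p * q) / rt q := by rw [rt_mul]; field_simp [rt_ne hq]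
      rw [this]; exact div_mem pqM qM
    exact sup_le (tw (sup_le bot_le (adjoin_simple_le_iff.2 pM)) cM) (adjoin_simple_le_iff.2 qM)

end case2

lemma C_fin (n m : ℕ) : FiniteDimensional ℚ (Tw ⊥ n ⊔ ℚ⟮rt m⟯ : IntermediateField ℚ ℂ) := (QE_rt _ m).finite

lemma final (d : ℕ)
    (hd : (d.Prime ∧ d % 16 = 7) ∨
      (∃ p q : ℕ, p.Prime ∧ q.Prime ∧ p % 8 = 5 ∧ q % 8 = 3 ∧ d = p * q)) (n : ℕ) :
    Nat.card (CommGroup.primaryComponent (ClassGroup (𝓞 (Tw ⊥ (n + 1) ⊔ ℚ⟮rt d⟯ : IntermediateField ℚ ℂ))) 2) ≤ 2 := by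
  have := C_fin (n + 1) d
  rcases hd with ⟨hp, h16⟩ | ⟨p, q, hp, hq, h5, h3, rfl⟩
  · exact (prim_of_T2_one (case1 hp h16 n)).trans (by norm_num)
  · obtain ⟨m, hm, h⟩ := (CF_QE hq (n + 1)).exponent (F_odd hp hq h5 h3 n)
    exact (prim_le_T2 m hm h).trans (C_two hp hq h5 h3 (n + 1))
end GB

/-- if `d` is a prime `≡ 7 (mod 16)`, or `d = pq` with `p ≡ 5 (mod 8)`
and `q ≡ 3 (mod 8)` prime, then Greenberg's conjecture holds for the fields
`L_{n,d}⁺`: their 2-class numbers are uniformly bounded. -/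
theorem greenberg_conjecture_Lplus
    (d : ℕ)
    (hd : (d.Prime ∧ d % 16 = 7) ∨
      (∃ p q : ℕ, p.Prime ∧ q.Prime ∧ p % 8 = 5 ∧ q % 8 = 3 ∧ d = p * q)) :
    ∃ B : ℕ, ∀ n : ℕ, Nat.card (twoClassGroup (LplusField n (d : ℤ))) ≤ B := by
  obtain ⟨B, hB⟩ : ∃ B : ℕ, ∀ n : ℕ,
      Nat.card (CommGroup.primaryComponent
        (ClassGroup (𝓞 (GB.Tw ⊥ n ⊔ ℚ⟮GB.rt d⟯ : IntermediateField ℚ ℂ))) 2) ≤ B := by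
    refine ⟨max 2 (Nat.card (CommGroup.primaryComponent
      (ClassGroup (𝓞 (GB.Tw ⊥ 0 ⊔ ℚ⟮GB.rt d⟯ : IntermediateField ℚ ℂ))) 2)), ?_⟩
    rintro (_ | n)
    · exact le_max_right _ _
    · exact (GB.final d hd n).trans (le_max_left _ _)
  refine ⟨B, fun n => ?_⟩
  have e : LplusField n (d : ℤ) = GB.Tw ⊥ n ⊔ ℚ⟮GB.rt d⟯ := GB.Lplus_eq n d
  rw [e]
  exact hB n
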